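/- Suppose that for every n∈ℤ an at most countable set 𝔖(n)={s_n(i): i∈ℕ}⊂[1,2^b] is given. There is a constant C (depending only on b, c_+, c_- and the fixed cutoff function χ_+, and independent of the sets 𝔖(n) and of R) such that for all 1<p≤2 and all R∈ℕ, B_p(R) ≤ C (p-1)^{2-10/p}. -/

import Mathlib

open MeasureTheory Filter Set Topology
open scoped ENNReal NNReal Topology Classical

noncomputable section

/-- The homogeneous curve of degree `b`: `γ_b(t) = c₊ t^b` for `t > 0`,
`γ_b(t) = c₋ (-t)^b` for `t < 0`, `γ_b(0) = 0`. -/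
def curve (b cp cm t : ℝ) : ℝ :=
  if 0 < t then cp * t ^ b else if t < 0 then cm * (-t) ^ b else 0

/-- The maximal function along the curve `(t, u γ_b(t))`. -/
def Mu (b cp cm u : ℝ) (f : ℝ × ℝ → ℝ) (x : ℝ × ℝ) : ℝ :=
  ⨆ R : {R : ℝ // 0 < R},
    ((R : ℝ))⁻¹ * ∫ t in (0:ℝ)..(R : ℝ), |f (x - (t, u * curve b cp cm t))|

/-- The maximal function `𝓜^U f = sup_{u ∈ U} M^{(u)} f`. -/
def calM (b cp cm : ℝ) (U : Set ℝ) (f : ℝ × ℝ → ℝ) (x : ℝ × ℝ) : ℝ :=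
  ⨆ u : U, Mu b cp cm (u : ℝ) f x

/-- The Hilbert transform along the curve `(t, u γ_b(t))` (principal value). -/
def Hu (b cp cm u : ℝ) (f : ℝ × ℝ → ℝ) (x : ℝ × ℝ) : ℝ :=
  limUnder (𝓝[>] (0:ℝ)) fun ε : ℝ =>
    ∫ t in {t : ℝ | ε < |t| ∧ |t| < ε⁻¹}, f (x - (t, u * curve b cp cm t)) / t

/-- The maximal function `𝓗^U f = sup_{u ∈ U} |H^{(u)} f|`, valued in `ℝ≥0∞`. -/
def calH (b cp cm : ℝ) (U : Set ℝ) (f : ℝ × ℝ → ℝ) (x : ℝ × ℝ) : ℝ≥0∞ :=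
  ⨆ u : U, ENNReal.ofReal |Hu b cp cm (u : ℝ) f x|

/-- The `L^p` norm of an `ℝ≥0∞`-valued function on `ℝ²`. -/
def lpN (g : ℝ × ℝ → ℝ≥0∞) (p : ℝ) : ℝ≥0∞ :=
  (∫⁻ x : ℝ × ℝ, g x ^ p) ^ (1 / p)

def eN (p : ℝ) : ℝ≥0∞ := ENNReal.ofReal p

/-- `U^r = r⁻¹ U ∩ [1,2] = {ρ ∈ [1,2] : rρ ∈ U}`. -/
def UrSet (U : Set ℝ) (r : ℝ) : Set ℝ := {ρ : ℝ | ρ ∈ Icc (1:ℝ) 2 ∧ r * ρ ∈ U}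

/-- `N(A,δ)`: minimal number of intervals of length `δ` needed to cover `A`. -/
def covN (A : Set ℝ) (δ : ℝ) : ℕ :=
  sInf {n : ℕ | ∃ F : Finset ℝ, F.card = n ∧ A ⊆ ⋃ a ∈ F, Icc a (a + δ)}

/-- `𝒦_p(U,δ) = δ^{1-1/p} sup_{r>0} N(U^r,δ)^{1/p}`. -/
def Kp (U : Set ℝ) (δ p : ℝ) : ℝ :=
  δ ^ (1 - 1 / p) * ⨆ r : {r : ℝ // 0 < r}, ((covN (UrSet U (r : ℝ)) δ : ℝ)) ^ (1 / p)

/-- `p_cr(U) = 1 + limsup_{δ→0+} sup_{r>0} log N(U^r,δ) / log(1/δ)`. -/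
def pcr (U : Set ℝ) : ℝ :=
  1 + limsup (fun δ : ℝ =>
      (⨆ r : {r : ℝ // 0 < r}, Real.log (covN (UrSet U (r : ℝ)) δ)) / Real.log δ⁻¹)
    (𝓝[>] (0:ℝ))

/-- `𝔑(U) = 1 + #{n ∈ ℤ : [2ⁿ, 2ⁿ⁺¹] ∩ U ≠ ∅}`. -/
def frakN (U : Set ℝ) : ℕ∞ :=
  1 + Set.encard {n : ℤ | (Icc ((2:ℝ) ^ n) ((2:ℝ) ^ (n + 1)) ∩ U).Nonempty}

/-- `√(log 𝔑(U))`, valued in `ℝ≥0∞` (equal to `∞` if `𝔑(U) = ∞`). -/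
def sqrtLogN (U : Set ℝ) : ℝ≥0∞ :=
  if frakN U = ⊤ then ⊤
  else ENNReal.ofReal (Real.sqrt (Real.log ((frakN U).toNat : ℝ)))

/-- The `L^p → L^p` operator norm of `𝓜^U` (smallest admissible constant, possibly `∞`). -/
def opNormM (b cp cm : ℝ) (U : Set ℝ) (p : ℝ) : ℝ≥0∞ :=
  sInf {C : ℝ≥0∞ | ∀ f : SchwartzMap (ℝ × ℝ) ℝ,
    eLpNorm (calM b cp cm U ⇑f) (eN p) volume ≤ C * eLpNorm ⇑f (eN p) volume}

/-- The `L^p → L^p` operator norm of `𝓗^U` (smallest admissible constant, possibly `∞`). -/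
def opNormH (b cp cm : ℝ) (U : Set ℝ) (p : ℝ) : ℝ≥0∞ :=
  sInf {C : ℝ≥0∞ | ∀ f : SchwartzMap (ℝ × ℝ) ℝ,
    lpN (calH b cp cm U ⇑f) p ≤ C * eLpNorm ⇑f (eN p) volume}

/-- `θ_{p,ℓ}`. -/
def theta (p : ℝ) (l : ℕ) : ℝ :=
  if (l : ℝ) ≤ (p - 1)⁻¹ then (p - 1) ^ (3 - 10 / p) else (l : ℝ) ^ (7 * (2 / p - 1))

/-- `Σ_{ℓ≥1} θ_{p,ℓ} 𝒦_p(U, 2^{-ℓ})`, valued in `ℝ≥0∞`. -/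
def KpSum (U : Set ℝ) (p : ℝ) : ℝ≥0∞ :=
  ∑' l : ℕ, ENNReal.ofReal (theta p (l + 1) * Kp U ((2:ℝ) ^ (-((l : ℝ) + 1))) p)



/-- The Fourier transform on `ℝ²`. -/
def FT (f : ℝ × ℝ → ℂ) (ξ : ℝ × ℝ) : ℂ :=
  ∫ x : ℝ × ℝ,
    Complex.exp ((((-(2 * Real.pi * (x.1 * ξ.1 + x.2 * ξ.2))) : ℝ) : ℂ) * Complex.I) * f x

/-- The inverse Fourier transform on `ℝ²`. -/
def FTinv (g : ℝ × ℝ → ℂ) (x : ℝ × ℝ) : ℂ :=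
  ∫ ξ : ℝ × ℝ,
    Complex.exp (((2 * Real.pi * (x.1 * ξ.1 + x.2 * ξ.2) : ℝ) : ℂ) * Complex.I) * g ξ

/-- `τ̂₀(ξ) = ∫ e^{-2πi(ξ₁t + ξ₂γ_b(t))} χ₊(t) dt`. -/
def tauHat (b cp cm : ℝ) (χp : ℝ → ℝ) (ξ : ℝ × ℝ) : ℂ :=
  ∫ t : ℝ,
    Complex.exp ((((-(2 * Real.pi * (ξ.1 * t + ξ.2 * curve b cp cm t))) : ℝ) : ℂ) * Complex.I)
      * ((χp t : ℝ) : ℂ)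

/-- `σ̂(ξ) = ∫ e^{-2πi(ξ₁t + ξ₂γ_b(t))} χ(t) dt/t` for a cutoff `χ`. -/
def sigmaHat (b cp cm : ℝ) (χ : ℝ → ℝ) (ξ : ℝ × ℝ) : ℂ :=
  ∫ t : ℝ,
    Complex.exp ((((-(2 * Real.pi * (ξ.1 * t + ξ.2 * curve b cp cm t))) : ℝ) : ℂ) * Complex.I)
      * ((χ t / t : ℝ) : ℂ)

/-- `ρ̂₀(ξ) = (1-η₀(ξ)) ς₋(ξ₁/(c₊ξ₂)) τ̂₀(ξ)`. -/
def rhoHat (b cp cm : ℝ) (χp : ℝ → ℝ) (η : ℝ × ℝ → ℝ) (ςm : ℝ → ℝ) (ξ : ℝ × ℝ) : ℂ :=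
  (((1 - η ξ) * ςm (ξ.1 / (cp * ξ.2)) : ℝ) : ℂ) * tauHat b cp cm χp ξ

/-- `μ̂_{0,±}`; `sgn = true` is the `+` sign. -/
def muHat (b cp cm : ℝ) (χp : ℝ → ℝ) (η : ℝ × ℝ → ℝ) (ςp ςm : ℝ → ℝ) (sgn : Bool)
    (ξ : ℝ × ℝ) : ℂ :=
  if sgn then
    (((1 - η ξ) * ςm (ξ.1 / (cp * ξ.2)) : ℝ) : ℂ) * sigmaHat b cp cm χp ξ
  else
    (((1 - η ξ) * ςp (ξ.1 / (cm * ξ.2)) : ℝ) : ℂ) * sigmaHat b cp cm (fun t => χp (-t)) ξ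

/-- `ζ_ℓ(ξ) = ζ₀(2^{-ℓ}ξ) - ζ₀(2^{1-ℓ}ξ)`. -/
def zl (ζ : ℝ × ℝ → ℝ) (l : ℕ) (ξ : ℝ × ℝ) : ℝ :=
  ζ ((2:ℝ) ^ (-(l : ℝ)) • ξ) - ζ ((2:ℝ) ^ (1 - (l : ℝ)) • ξ)

/-- The anisotropic dilation `ξ ↦ (2^{-j}ξ₁, 2^{-jb} u ξ₂)`. -/
def dil (b : ℝ) (j : ℤ) (u : ℝ) (ξ : ℝ × ℝ) : ℝ × ℝ :=
  ((2:ℝ) ^ (-(j : ℝ)) * ξ.1, (2:ℝ) ^ (-((j : ℝ) * b)) * (u * ξ.2))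

/-- `A_{j,ℓ}^u`, defined via `(A_{j,ℓ}^u f)^(ξ) = ζ_ℓ(...) ρ̂₀(...) f̂(ξ)`. -/
def Ajl (b cp cm : ℝ) (χp : ℝ → ℝ) (η : ℝ × ℝ → ℝ) (ςm : ℝ → ℝ) (ζ : ℝ × ℝ → ℝ)
    (j : ℤ) (l : ℕ) (u : ℝ) (f : ℝ × ℝ → ℝ) : ℝ × ℝ → ℂ :=
  FTinv fun ξ =>
    ((zl ζ l (dil b j u ξ) : ℝ) : ℂ) * rhoHat b cp cm χp η ςm (dil b j u ξ)
      * FT (fun x => ((f x : ℝ) : ℂ)) ξ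

/-- `T_{j,ℓ,±}^u`, defined via `(T_{j,ℓ,±}^u f)^(ξ) = ζ_ℓ(...) μ̂_{0,±}(...) f̂(ξ)`. -/
def Tjl (b cp cm : ℝ) (χp : ℝ → ℝ) (η : ℝ × ℝ → ℝ) (ςp ςm : ℝ → ℝ) (ζ : ℝ × ℝ → ℝ)
    (sgn : Bool) (j : ℤ) (l : ℕ) (u : ℝ) (f : ℝ × ℝ → ℝ) : ℝ × ℝ → ℂ :=
  FTinv fun ξ =>
    ((zl ζ l (dil b j u ξ) : ℝ) : ℂ) * muHat b cp cm χp η ςp ςm sgn (dil b j u ξ)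
      * FT (fun x => ((f x : ℝ) : ℂ)) ξ

/-- `φ̂₀(ξ) = η₀(ξ)τ̂₀(ξ) + (1-η₀(ξ))(1-ς₋(ξ₁/(c₊ξ₂)))τ̂₀(ξ)` (maximal-function version). -/
def phiHatTau (b cp cm : ℝ) (χp : ℝ → ℝ) (η : ℝ × ℝ → ℝ) (ςm : ℝ → ℝ) (ξ : ℝ × ℝ) : ℂ :=
  ((η ξ + (1 - η ξ) * (1 - ςm (ξ.1 / (cp * ξ.2))) : ℝ) : ℂ) * tauHat b cp cm χp ξ

/-- `A_{j,0}^u`, defined via `(A_{j,0}^u f)^(ξ) = φ̂₀(2^{-j}ξ₁, 2^{-jb}uξ₂) f̂(ξ)`. -/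
def Aj0 (b cp cm : ℝ) (χp : ℝ → ℝ) (η : ℝ × ℝ → ℝ) (ςm : ℝ → ℝ)
    (j : ℤ) (u : ℝ) (f : ℝ × ℝ → ℝ) : ℝ × ℝ → ℂ :=
  FTinv fun ξ => phiHatTau b cp cm χp η ςm (dil b j u ξ) * FT (fun x => ((f x : ℝ) : ℂ)) ξ

/-- `φ̂₀(ξ)` (Hilbert-transform version, built from `σ̂_±`). -/
def phiHatSigma (b cp cm : ℝ) (χp : ℝ → ℝ) (η : ℝ × ℝ → ℝ) (ςp ςm : ℝ → ℝ)
    (ξ : ℝ × ℝ) : ℂ :=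
  ((η ξ : ℝ) : ℂ) * (sigmaHat b cp cm χp ξ + sigmaHat b cp cm (fun t => χp (-t)) ξ)
    + (((1 - η ξ) * (1 - ςm (ξ.1 / (cp * ξ.2))) : ℝ) : ℂ) * sigmaHat b cp cm χp ξ
    + (((1 - η ξ) * (1 - ςp (ξ.1 / (cm * ξ.2))) : ℝ) : ℂ)
        * sigmaHat b cp cm (fun t => χp (-t)) ξ

/-- `S^{(u)}`, defined via `(S^{(u)} f)^(ξ) = Σ_j φ̂₀(2^{-j}ξ₁, 2^{-jb}uξ₂) f̂(ξ)`. -/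
def Sop (b cp cm : ℝ) (χp : ℝ → ℝ) (η : ℝ × ℝ → ℝ) (ςp ςm : ℝ → ℝ)
    (u : ℝ) (f : ℝ × ℝ → ℝ) : ℝ × ℝ → ℂ :=
  FTinv fun ξ =>
    (∑' j : ℤ, phiHatSigma b cp cm χp η ςp ςm (dil b j u ξ)) * FT (fun x => ((f x : ℝ) : ℂ)) ξ

/-- The convolution `τ_j^u * f`. -/
def tauConv (b cp cm : ℝ) (χp : ℝ → ℝ) (j : ℤ) (u : ℝ) (f : ℝ × ℝ → ℝ) (x : ℝ × ℝ) : ℝ :=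
  ∫ t : ℝ, f (x - (t, u * curve b cp cm t)) * ((2:ℝ) ^ j * χp ((2:ℝ) ^ j * t))

/-- The `ℓ^p(ℕ)` norm of a sequence. -/
def wNorm (w : ℕ → ℂ) (p : ℝ) : ℝ≥0∞ :=
  (∑' i : ℕ, ENNReal.ofReal (‖w i‖ ^ p)) ^ (1 / p)

/-- The auxiliary maximal operator `𝔐_R[f,w]`. -/
def MfrakR (b cp cm : ℝ) (χp : ℝ → ℝ) (s : ℤ → ℕ → ℝ) (R : ℕ)
    (f : ℝ × ℝ → ℝ) (w : ℤ → ℕ → ℂ) (x : ℝ × ℝ) : ℝ≥0∞ :=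
  ⨆ (j : ℤ) (_ : -(R:ℤ) ≤ j ∧ j ≤ R) (n : ℤ) (_ : -(R:ℤ) ≤ n ∧ n ≤ R) (i : ℕ),
    ENNReal.ofReal
      (‖w n i‖ * |tauConv b cp cm χp j ((2:ℝ) ^ (b * (n : ℝ)) * s n i) f x|)

/-- `B_p(R)`: the best constant in `‖𝔐_R[f,w]‖_p ≤ C (sup_n ‖w_n‖_{ℓ^p}) ‖f‖_p`. -/
def BpR (b cp cm : ℝ) (χp : ℝ → ℝ) (s : ℤ → ℕ → ℝ) (p : ℝ) (R : ℕ) : ℝ≥0∞ :=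
  ⨆ (f : SchwartzMap (ℝ × ℝ) ℝ) (w : ℤ → ℕ → ℂ)
    (_ : eLpNorm ⇑f (eN p) volume ≤ 1) (_ : ∀ n : ℤ, wNorm (w n) p ≤ 1),
    lpN (MfrakR b cp cm χp s R ⇑f w) p

/-- `ℓ^q` norm (over an index type) of an `ℝ≥0∞`-valued family, `q ∈ (0,∞]`. -/
def lqS {ι : Type*} (q : ℝ≥0∞) (g : ι → ℝ≥0∞) : ℝ≥0∞ :=
  if q = ⊤ then ⨆ i, g i else (∑' i, g i ^ q.toReal) ^ (1 / q.toReal)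

/-- The quotient `p/q`, with the convention `p/∞ = 0`. -/
def pqr (p : ℝ) (q : ℝ≥0∞) : ℝ := if q = ⊤ then 0 else p / q.toReal

set_option linter.unusedSectionVars false

/-- Bounded strongly measurable functions of bounded support. -/
structure Nice {X E : Type*} [NormedAddCommGroup X] [MeasurableSpace X] [NormedAddCommGroup E]
    (f : X → E) : Prop where
  meas : StronglyMeasurable f
  bdd : ∃ C, ∀ x, ‖f x‖ ≤ C
  supp : ∃ R, ∀ x, R < ‖x‖ → f x = 0

namespace Nice

variable {X E : Type*} [NormedAddCommGroup X] [MeasurableSpace X] [NormedAddCommGroup E]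

theorem add {f g : X → E} (hf : Nice f) (hg : Nice g) : Nice (fun x => f x + g x) := by
  obtain ⟨C, hC⟩ := hf.bdd
  obtain ⟨D, hD⟩ := hg.bdd
  obtain ⟨R, hR⟩ := hf.supp
  obtain ⟨S, hS⟩ := hg.supp
  refine ⟨hf.meas.add hg.meas, ⟨C + D, fun x => (norm_add_le _ _).trans (add_le_add (hC x) (hD x))⟩,
    ⟨max R S, fun x hx => ?_⟩⟩
  rw [max_lt_iff] at hx
  simp [hR x hx.1, hS x hx.2]

theorem zero : Nice (fun _ : X => (0 : E)) :=
  ⟨stronglyMeasurable_const, ⟨0, by simp⟩, ⟨0, by simp⟩⟩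

theorem sum {ι : Type*} (s : Finset ι) {f : ι → X → E} (hf : ∀ i ∈ s, Nice (f i)) :
    Nice (fun x => ∑ i ∈ s, f i x) := by
  induction s using Finset.induction_on with
  | empty => simpa using zero
  | insert i s hi ih =>
    simp only [Finset.sum_insert hi]
    exact (hf i (by simp)).add (ih fun j hj => hf j (by simp [hj]))

/-- Composition with a map that fixes the origin, is measurable and bounded on bounded sets. -/
theorem comp {F : Type*} [NormedAddCommGroup F] {f : X → E} (hf : Nice f) (Φ : E → F)
    (h0 : Φ 0 = 0) (hm : StronglyMeasurable fun x => Φ (f x))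
    (hb : ∀ C, ∃ D, ∀ v, ‖v‖ ≤ C → ‖Φ v‖ ≤ D) : Nice (fun x => Φ (f x)) := by
  obtain ⟨C, hC⟩ := hf.bdd
  obtain ⟨D, hD⟩ := hb C
  obtain ⟨R, hR⟩ := hf.supp
  exact ⟨hm, ⟨D, fun x => hD _ (hC x)⟩, ⟨R, fun x hx => by rw [hR x hx, h0]⟩⟩

theorem smul_const [NormedSpace ℝ E] {f : X → E} (hf : Nice f) (c : ℝ) :
    Nice (fun x => c • f x) :=
  hf.comp (fun v => c • v) (smul_zero c) (hf.meas.const_smul c) fun C =>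
    ⟨|c| * C, fun v hv => by rw [norm_smul]; exact mul_le_mul_of_nonneg_left hv (norm_nonneg c)⟩

theorem neg {f : X → E} (hf : Nice f) : Nice (fun x => - f x) :=
  hf.comp (fun v => -v) neg_zero hf.meas.neg fun C => ⟨C, fun v hv => by simpa using hv⟩

theorem sub {f g : X → E} (hf : Nice f) (hg : Nice g) : Nice (fun x => f x - g x) := by
  simpa only [sub_eq_add_neg] using hf.add hg.neg

theorem norm {f : X → E} (hf : Nice f) : Nice (fun x => ‖f x‖) :=
  hf.comp (fun v => ‖v‖) norm_zero hf.meas.norm fun C => ⟨C, fun v hv => by simpa using hv⟩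

theorem abs {f : X → ℝ} (hf : Nice f) : Nice (fun x => |f x|) := hf.norm

theorem rpow {f : X → ℝ} (hf : Nice f) (h0 : ∀ x, 0 ≤ f x) {r : ℝ} (hr : 0 < r) :
    Nice (fun x => f x ^ r) := by
  obtain ⟨C, hC⟩ := hf.bdd
  obtain ⟨R, hR⟩ := hf.supp
  refine ⟨(hf.meas.measurable.pow_const r).stronglyMeasurable, ⟨C ^ r, fun x => ?_⟩,
    ⟨R, fun x hx => by rw [hR x hx, Real.zero_rpow hr.ne']⟩⟩
  rw [Real.norm_of_nonneg (Real.rpow_nonneg (h0 x) r)]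
  exact Real.rpow_le_rpow (h0 x) ((le_abs_self _).trans (hC x)) hr.le

theorem mul_bdd {f g : X → ℝ} (hf : Nice f) (hg : StronglyMeasurable g)
    (hb : ∃ C, ∀ x, ‖g x‖ ≤ C) : Nice (fun x => f x * g x) := by
  obtain ⟨C, hC⟩ := hf.bdd
  obtain ⟨D, hD⟩ := hb
  obtain ⟨R, hR⟩ := hf.supp
  refine ⟨hf.meas.mul hg, ⟨C * D, fun x => ?_⟩, ⟨R, fun x hx => by simp [hR x hx]⟩⟩
  rw [norm_mul]
  exact mul_le_mul (hC x) (hD x) (norm_nonneg _) ((norm_nonneg _).trans (hC x))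

theorem mul {f g : X → ℝ} (hf : Nice f) (hg : Nice g) : Nice (fun x => f x * g x) :=
  hf.mul_bdd hg.meas hg.bdd

theorem const_mul {f : X → ℝ} (hf : Nice f) (c : ℝ) : Nice (fun x => c * f x) :=
  hf.smul_const c

theorem sq {f : X → ℝ} (hf : Nice f) : Nice (fun x => f x ^ 2) := by
  simpa only [pow_two] using hf.mul hf

theorem max {f g : X → ℝ} (hf : Nice f) (hg : Nice g) : Nice (fun x => max (f x) (g x)) := by
  have : (fun x => Max.max (f x) (g x)) = fun x => (1/2 : ℝ) * (f x + g x + |f x - g x|) := by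
    funext x
    rcases le_total (f x) (g x) with h | h
    · rw [max_eq_right h, abs_of_nonpos (by linarith)]; ring
    · rw [max_eq_left h, abs_of_nonneg (by linarith)]; ring
  rw [this]
  exact ((hf.add hg).add (hf.sub hg).abs).const_mul _

theorem indicator {f : X → E} (hf : Nice f) {S : Set X} (hS : MeasurableSet S) :
    Nice (S.indicator f) := by
  obtain ⟨C, hC⟩ := hf.bdd
  obtain ⟨R, hR⟩ := hf.supp
  refine ⟨hf.meas.indicator hS, ⟨C, fun x => (norm_indicator_le_norm_self _ _).trans (hC x)⟩,
    ⟨R, fun x hx => ?_⟩⟩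
  by_cases h : x ∈ S <;> simp [h, hR x hx]

theorem integrable [BorelSpace X] [ProperSpace X] {μ : Measure X} [IsFiniteMeasureOnCompacts μ]
    {f : X → E} (hf : Nice f) : Integrable f μ := by
  obtain ⟨C, hC⟩ := hf.bdd
  obtain ⟨R, hR⟩ := hf.supp
  have hs : Function.support f ⊆ Metric.closedBall 0 R := by
    intro x hx
    by_contra h
    exact hx (hR x (by simpa using h))
  rw [← integrableOn_iff_integrable_of_support_subset hs]
  exact Measure.integrableOn_of_bounded (M := C)
    (isCompact_closedBall (0 : X) R).measure_lt_top.ne hf.meas.aestronglyMeasurable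
    (Eventually.of_forall hC)

theorem fst_slice {f : ℝ × ℝ → E} (hf : Nice f) (y : ℝ) : Nice (fun x => f (x, y)) := by
  obtain ⟨C, hC⟩ := hf.bdd
  obtain ⟨R, hR⟩ := hf.supp
  exact ⟨hf.meas.comp_measurable measurable_prodMk_right, ⟨C, fun x => hC _⟩,
    ⟨R, fun x hx => hR _ (hx.trans_le (le_max_left _ _))⟩⟩

theorem snd_slice {f : ℝ × ℝ → E} (hf : Nice f) (x : ℝ) : Nice (fun y => f (x, y)) := by
  obtain ⟨C, hC⟩ := hf.bdd
  obtain ⟨R, hR⟩ := hf.supp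
  exact ⟨hf.meas.comp_measurable measurable_prodMk_left, ⟨C, fun x => hC _⟩,
    ⟨R, fun x hx => hR _ (hx.trans_le (le_max_right _ _))⟩⟩

theorem integral_prod [NormedSpace ℝ E] {f : ℝ × ℝ → E} (hf : Nice f) :
    ∫ p, f p = ∫ x, ∫ y, f (x, y) := by
  have := hf.integrable (μ := (volume : Measure (ℝ × ℝ)))
  rw [Measure.volume_eq_prod] at this ⊢
  exact MeasureTheory.integral_prod _ this

theorem integral_prod_symm [NormedSpace ℝ E] {f : ℝ × ℝ → E} (hf : Nice f) :
    ∫ p, f p = ∫ y, ∫ x, f (x, y) := by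
  have := hf.integrable (μ := (volume : Measure (ℝ × ℝ)))
  rw [Measure.volume_eq_prod] at this ⊢
  exact MeasureTheory.integral_prod_symm _ this

theorem slice_integral_fst [NormedSpace ℝ E] {f : ℝ × ℝ → E} (hf : Nice f) :
    Integrable (fun y => ∫ x, f (x, y)) := by
  have := hf.integrable (μ := (volume : Measure (ℝ × ℝ)))
  rw [Measure.volume_eq_prod] at this
  exact this.integral_prod_right

theorem slice_integral_snd [NormedSpace ℝ E] {f : ℝ × ℝ → E} (hf : Nice f) :
    Integrable (fun x => ∫ y, f (x, y)) := by
  have := hf.integrable (μ := (volume : Measure (ℝ × ℝ)))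
  rw [Measure.volume_eq_prod] at this
  exact this.integral_prod_left

end Nice

theorem Nice.comp_of_norm {X E : Type*} [NormedAddCommGroup X] [MeasurableSpace X]
    [NormedAddCommGroup E] {f : X → E} (hf : Nice f) {Φ : X → X} (hΦ : Measurable Φ)
    {D : ℝ} (hD : ∀ x, ‖x‖ ≤ ‖Φ x‖ + D) : Nice (fun x => f (Φ x)) := by
  obtain ⟨C, hC⟩ := hf.bdd
  obtain ⟨R, hR⟩ := hf.supp
  exact ⟨hf.meas.comp_measurable hΦ, ⟨C, fun x => hC _⟩,
    ⟨R + D, fun x hx => hR _ (by linarith [hD x])⟩⟩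

section Avg

variable {X E : Type*} [NormedAddCommGroup X] [MeasurableSpace X] [NormedAddCommGroup E]
  [NormedSpace ℝ E]

/-- Averaging along a family of maps `Φ · u`, with weight `ν`. -/
def avg (ν : Measure ℝ) (Φ : X → ℝ → X) (f : X → E) (x : X) : E := ∫ u, f (Φ x u) ∂ν

/-- A measurable family of maps of uniformly bounded displacement. -/
structure NiceFam (ν : Measure ℝ) (Φ : X → ℝ → X) : Prop where
  meas : Measurable (Function.uncurry Φ)
  disp : ∃ D, ∀ x, ∀ᵐ u ∂ν, ‖x‖ ≤ ‖Φ x u‖ + D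

variable {ν : Measure ℝ} [IsProbabilityMeasure ν] {Φ : X → ℝ → X}

theorem NiceFam.meas_right (h : NiceFam ν Φ) (x : X) : Measurable (Φ x) :=
  h.meas.comp measurable_prodMk_left

theorem NiceFam.integrable (h : NiceFam ν Φ) {f : X → E} (hf : Nice f) (x : X) :
    Integrable (fun u => f (Φ x u)) ν := by
  obtain ⟨C, hC⟩ := hf.bdd
  exact Integrable.of_bound (hf.meas.comp_measurable (h.meas_right x)).aestronglyMeasurable C
    (Eventually.of_forall fun u => hC _)

theorem avg_nice (h : NiceFam ν Φ) {f : X → E} (hf : Nice f) : Nice (avg ν Φ f) := by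
  obtain ⟨C, hC⟩ := hf.bdd
  obtain ⟨R, hR⟩ := hf.supp
  obtain ⟨D, hD⟩ := h.disp
  refine ⟨?_, ⟨C, fun x => ?_⟩, ⟨R + D, fun x hx => ?_⟩⟩
  · exact (hf.meas.comp_measurable h.meas).integral_prod_right'
  · have := norm_integral_le_of_norm_le_const (μ := ν) (f := fun u => f (Φ x u)) (C := C)
      (Eventually.of_forall fun u => hC _)
    simpa [avg] using this
  · apply integral_eq_zero_of_ae
    filter_upwards [hD x] with u hu
    exact hR _ (by linarith)

theorem avg_add (h : NiceFam ν Φ) {f g : X → E} (hf : Nice f) (hg : Nice g) (x : X) :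
    avg ν Φ (fun x => f x + g x) x = avg ν Φ f x + avg ν Φ g x :=
  integral_add (h.integrable hf x) (h.integrable hg x)

theorem avg_sub (h : NiceFam ν Φ) {f g : X → E} (hf : Nice f) (hg : Nice g) (x : X) :
    avg ν Φ (fun x => f x - g x) x = avg ν Φ f x - avg ν Φ g x :=
  integral_sub (h.integrable hf x) (h.integrable hg x)

theorem avg_sum (h : NiceFam ν Φ) {ι : Type*} (s : Finset ι) {f : ι → X → E}
    (hf : ∀ i ∈ s, Nice (f i)) (x : X) :
    avg ν Φ (fun x => ∑ i ∈ s, f i x) x = ∑ i ∈ s, avg ν Φ (f i) x :=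
  integral_finsetSum s fun i hi => h.integrable (hf i hi) x

theorem avg_const_mul (c : ℝ) (f : X → ℝ) (x : X) :
    avg ν Φ (fun x => c * f x) x = c * avg ν Φ f x :=
  integral_const_mul c _

theorem avg_mono (h : NiceFam ν Φ) {f g : X → ℝ} (hf : Nice f) (hg : Nice g)
    (hfg : ∀ x, f x ≤ g x) (x : X) : avg ν Φ f x ≤ avg ν Φ g x :=
  integral_mono (h.integrable hf x) (h.integrable hg x) fun _ => hfg _

theorem avg_nonneg {f : X → ℝ} (hf : ∀ x, 0 ≤ f x) (x : X) : 0 ≤ avg ν Φ f x :=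
  integral_nonneg fun _ => hf _

theorem norm_avg_le (f : X → E) (x : X) : ‖avg ν Φ f x‖ ≤ avg ν Φ (fun x => ‖f x‖) x :=
  norm_integral_le_integral_norm _

theorem avg_rpow_le (h : NiceFam ν Φ) {f : X → ℝ} (hf : Nice f) (h0 : ∀ x, 0 ≤ f x)
    {r : ℝ} (hr : 1 ≤ r) (x : X) : avg ν Φ f x ^ r ≤ avg ν Φ (fun x => f x ^ r) x :=
  (convexOn_rpow hr).map_integral_le
    (Real.continuous_rpow_const (by linarith)).continuousOn isClosed_Ici
    (Eventually.of_forall fun u => h0 _) (h.integrable hf x)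
    (h.integrable (hf.rpow h0 (by linarith)) x)

theorem norm_avg_rpow_le (h : NiceFam ν Φ) {f : X → E} (hf : Nice f)
    {r : ℝ} (hr : 1 ≤ r) (x : X) : ‖avg ν Φ f x‖ ^ r ≤ avg ν Φ (fun x => ‖f x‖ ^ r) x :=
  (Real.rpow_le_rpow (norm_nonneg _) (norm_avg_le f x) (by linarith)).trans
    (avg_rpow_le h hf.norm (fun _ => norm_nonneg _) hr x)

theorem norm_avg_sq_le (h : NiceFam ν Φ) {f : X → E} (hf : Nice f) (x : X) :
    ‖avg ν Φ f x‖ ^ 2 ≤ avg ν Φ (fun x => ‖f x‖ ^ 2) x := by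
  have := norm_avg_rpow_le h hf (r := 2) (by norm_num) x
  simpa only [Real.rpow_two] using this

theorem avg_sq_le (h : NiceFam ν Φ) {f : X → ℝ} (hf : Nice f) (x : X) :
    avg ν Φ f x ^ 2 ≤ avg ν Φ (fun x => f x ^ 2) x := by
  simpa using norm_avg_sq_le h hf x

end Avg

section Dyadic

/-- Lebesgue measure on `[0,1)`. -/
def unitMeas : Measure ℝ := volume.restrict (Ico 0 1)

instance : IsProbabilityMeasure unitMeas := ⟨by simp [unitMeas]⟩

theorem unitMeas_ae : ∀ᵐ u ∂unitMeas, u ∈ Ico (0:ℝ) 1 := ae_restrict_mem measurableSet_Ico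

/-- The point with parameter `u` in the dyadic cell of side `2^{-n}` containing `x`. -/
def cellpt (n : ℤ) (x u : ℝ) : ℝ := (2:ℝ) ^ (-n) * (⌊(2:ℝ) ^ n * x⌋ + u)

theorem two_zpow_mul_cellpt (n : ℤ) (x u : ℝ) :
    (2:ℝ) ^ n * cellpt n x u = ⌊(2:ℝ) ^ n * x⌋ + u := by
  rw [cellpt, ← mul_assoc, ← zpow_add₀ two_ne_zero]; simp

theorem floor_cellpt (n : ℤ) (x : ℝ) {u : ℝ} (hu : u ∈ Ico (0:ℝ) 1) :
    ⌊(2:ℝ) ^ n * cellpt n x u⌋ = ⌊(2:ℝ) ^ n * x⌋ := by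
  rw [two_zpow_mul_cellpt, Int.floor_eq_iff]
  exact ⟨by linarith [hu.1], by linarith [hu.2]⟩

theorem abs_sub_lt_of_floor_eq {n : ℤ} {x y : ℝ} (h : ⌊(2:ℝ) ^ n * x⌋ = ⌊(2:ℝ) ^ n * y⌋) :
    |x - y| < (2:ℝ) ^ (-n) := by
  have h1 := Int.abs_sub_lt_one_of_floor_eq_floor h
  have h2 : (0:ℝ) < 2 ^ n := by positivity
  rw [← mul_sub, abs_mul, abs_of_pos h2] at h1
  rw [zpow_neg, ← one_div, lt_div_iff₀ h2]; linarith

theorem abs_cellpt_sub (n : ℤ) (x : ℝ) {u : ℝ} (hu : u ∈ Ico (0:ℝ) 1) :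
    |cellpt n x u - x| < (2:ℝ) ^ (-n) := abs_sub_lt_of_floor_eq (floor_cellpt n x hu)

theorem measurable_cellpt (n : ℤ) : Measurable (Function.uncurry (cellpt n)) := by
  unfold cellpt Function.uncurry
  have : Measurable fun p : ℝ × ℝ => (⌊(2:ℝ) ^ n * p.1⌋ : ℤ) :=
    Int.measurable_floor.comp (measurable_fst.const_mul _)
  have h2 : Measurable fun p : ℝ × ℝ => ((⌊(2:ℝ) ^ n * p.1⌋ : ℤ) : ℝ) :=
    (measurable_of_countable fun k : ℤ => (k : ℝ)).comp this
  exact (h2.add measurable_snd).const_mul _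

theorem niceFam_cellpt (n : ℤ) : NiceFam unitMeas (cellpt n) := by
  refine ⟨measurable_cellpt n, ⟨(2:ℝ) ^ (-n), fun x => ?_⟩⟩
  filter_upwards [unitMeas_ae] with u hu
  have := abs_cellpt_sub n x hu
  have h2 := norm_sub_norm_le x (cellpt n x u)
  rw [norm_sub_rev, Real.norm_eq_abs (_ - _)] at h2
  linarith

variable {E : Type*} [NormedAddCommGroup E] [NormedSpace ℝ E] [CompleteSpace E]

/-- Conditional expectation on the dyadic intervals of length `2^{-n}`. -/
def cexp (n : ℤ) (f : ℝ → E) : ℝ → E := avg unitMeas (cellpt n) f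

/-- Functions constant on the dyadic intervals of length `2^{-n}`. -/
def Lev {F : Type*} (n : ℤ) (f : ℝ → F) : Prop :=
  ∀ x y, ⌊(2:ℝ) ^ n * x⌋ = ⌊(2:ℝ) ^ n * y⌋ → f x = f y

theorem cexp_nice (n : ℤ) {f : ℝ → E} (hf : Nice f) : Nice (cexp n f) :=
  avg_nice (niceFam_cellpt n) hf

theorem lev_cexp (n : ℤ) (f : ℝ → E) : Lev n (cexp n f) := by
  intro x y h
  simp only [cexp, avg, cellpt, h]

theorem cexp_congr_cell (n : ℤ) {f g : ℝ → E} (x : ℝ)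
    (h : ∀ y, ⌊(2:ℝ) ^ n * y⌋ = ⌊(2:ℝ) ^ n * x⌋ → f y = g y) : cexp n f x = cexp n g x := by
  apply integral_congr_ae
  filter_upwards [unitMeas_ae] with u hu
  exact h _ (floor_cellpt n x hu)

theorem cexp_const (n : ℤ) (c : E) (x : ℝ) : cexp n (fun _ => c) x = c := by
  simp [cexp, avg]

theorem Lev.cexp_eq {n : ℤ} {f : ℝ → E} (hf : Lev n f) : cexp n f = f := by
  funext x
  rw [cexp_congr_cell n (g := fun _ => f x) x fun y hy => hf y x hy, cexp_const]

theorem cexp_mul_left {n : ℤ} {u : ℝ → ℝ} (hu : Lev n u) (f : ℝ → ℝ) (x : ℝ) :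
    cexp n (fun x => u x * f x) x = u x * cexp n f x := by
  rw [cexp_congr_cell n (g := fun y => u x * f y) x fun y hy => by rw [hu y x hy]]
  exact avg_const_mul _ _ _

theorem floor_succ_div (n : ℤ) (x : ℝ) : ⌊(2:ℝ) ^ n * x⌋ = ⌊(2:ℝ) ^ (n + 1) * x⌋ / 2 := by
  have h := Int.floor_div_natCast ((2:ℝ) ^ (n + 1) * x) 2
  rw [← Nat.cast_two (R := ℤ), ← h, zpow_add_one₀ two_ne_zero]
  congr 1; push_cast; ring

theorem Lev.succ {F : Type*} {n : ℤ} {f : ℝ → F} (hf : Lev n f) : Lev (n + 1) f := by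
  intro x y h
  exact hf x y (by rw [floor_succ_div, floor_succ_div n y, h])

theorem Lev.mono {F : Type*} {m n : ℤ} {f : ℝ → F} (hf : Lev m f) (h : m ≤ n) : Lev n f := by
  induction n, h using Int.leInduction with
  | base => exact hf
  | succ n _ ih => exact ih.succ

/-- Reflection exchanging the two halves of each dyadic interval of length `2^{1-m}`. -/
def sib (m : ℤ) (x : ℝ) : ℝ :=
  if Even ⌊(2:ℝ) ^ m * x⌋ then x + (2:ℝ) ^ (-m) else x - (2:ℝ) ^ (-m)

theorem floor_sib (m : ℤ) (x : ℝ) : ⌊(2:ℝ) ^ m * sib m x⌋ =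
    if Even ⌊(2:ℝ) ^ m * x⌋ then ⌊(2:ℝ) ^ m * x⌋ + 1 else ⌊(2:ℝ) ^ m * x⌋ - 1 := by
  have h : (2:ℝ) ^ m * (2:ℝ) ^ (-m) = 1 := by rw [← zpow_add₀ two_ne_zero]; simp
  unfold sib
  split_ifs with he
  · rw [mul_add, h, Int.floor_add_one]
  · rw [mul_sub, h, Int.floor_sub_one]

theorem measurable_sib (m : ℤ) : Measurable (sib m) := by
  unfold sib
  refine Measurable.ite ?_ (measurable_id.add_const _) (measurable_id.sub_const _)
  have : Measurable fun x : ℝ => (⌊(2:ℝ) ^ m * x⌋ : ℤ) :=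
    Int.measurable_floor.comp (measurable_id.const_mul _)
  exact this (MeasurableSet.of_discrete (s := {k : ℤ | Even k}))

theorem Nice.comp_sib {m : ℤ} {f : ℝ → E} (hf : Nice f) : Nice (fun x => f (sib m x)) := by
  refine hf.comp_of_norm (measurable_sib m) (D := (2:ℝ) ^ (-m)) fun x => ?_
  have h2 := norm_sub_norm_le x (sib m x)
  have : ‖x - sib m x‖ ≤ (2:ℝ) ^ (-m) := by
    unfold sib; split_ifs <;> simp
  linarith

theorem integral_unitMeas_comp (f : ℝ → E) (a : ℝ) (c : ℝ) (hc : 0 < c) :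
    ∫ u, f (c * (a + u)) ∂unitMeas = c⁻¹ • ∫ y in c * a..c * (a + 1), f y := by
  rw [unitMeas, integral_Ico_eq_integral_Ioc, ← intervalIntegral.integral_of_le zero_le_one]
  have := intervalIntegral.integral_comp_mul_add (a := 0) (b := 1) f hc.ne' (c * a)
  rw [show (fun u => f (c * (a + u))) = fun u => f (c * u + c * a) by funext u; ring_nf, this]
  ring_nf

theorem cexp_eq_interval (n : ℤ) {f : ℝ → E} (hf : Nice f) (x : ℝ) :
    cexp n f x = (2:ℝ) ^ n • ∫ y in (2:ℝ) ^ (-n) * ⌊(2:ℝ) ^ n * x⌋..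
      (2:ℝ) ^ (-n) * (⌊(2:ℝ) ^ n * x⌋ + 1), f y := by
  have := integral_unitMeas_comp f (⌊(2:ℝ) ^ n * x⌋ : ℝ) ((2:ℝ) ^ (-n)) (by positivity)
  rw [← zpow_neg, neg_neg] at this
  exact this

theorem zpow_neg_succ (n : ℤ) : (2:ℝ) ^ (-n) = 2 * (2:ℝ) ^ (-(n + 1)) := by
  rw [show -n = -(n + 1) + 1 by ring, zpow_add_one₀ two_ne_zero]; ring_nf

theorem cexp_parent (n : ℤ) {f : ℝ → E} (hf : Nice f) (x : ℝ) :
    cexp n f x = (1/2 : ℝ) • (cexp (n + 1) f x + cexp (n + 1) f (sib (n + 1) x)) := by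
  have hi := fun a b : ℝ => (hf.integrable (μ := volume)).intervalIntegrable (a := a) (b := b)
  have key : cexp n f x = (1/2 : ℝ) • ((2:ℝ) ^ (n + 1) •
      (∫ y in (2:ℝ) ^ (-(n+1)) * (2 * ⌊(2:ℝ) ^ n * x⌋ : ℤ)..
        (2:ℝ) ^ (-(n+1)) * ((2 * ⌊(2:ℝ) ^ n * x⌋ : ℤ) + 1), f y) + (2:ℝ) ^ (n + 1) •
      (∫ y in (2:ℝ) ^ (-(n+1)) * (2 * ⌊(2:ℝ) ^ n * x⌋ + 1 : ℤ)..
        (2:ℝ) ^ (-(n+1)) * ((2 * ⌊(2:ℝ) ^ n * x⌋ + 1 : ℤ) + 1), f y)) := by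
    rw [← smul_add]
    push_cast
    rw [intervalIntegral.integral_add_adjacent_intervals (hi _ _) (hi _ _), smul_smul,
      cexp_eq_interval n hf, zpow_neg_succ, zpow_add_one₀ two_ne_zero]
    congr 1
    · ring
    · congr 1 <;> ring
  have hx : ⌊(2:ℝ) ^ n * x⌋ = ⌊(2:ℝ) ^ (n + 1) * x⌋ / 2 := floor_succ_div n x
  rw [key, cexp_eq_interval (n + 1) hf x, cexp_eq_interval (n + 1) hf (sib (n + 1) x), floor_sib]
  split_ifs with he
  · have h1 : 2 * ⌊(2:ℝ) ^ n * x⌋ = ⌊(2:ℝ) ^ (n + 1) * x⌋ := by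
      obtain ⟨k, hk⟩ := he; omega
    rw [h1]
  · have h1 : 2 * ⌊(2:ℝ) ^ n * x⌋ = ⌊(2:ℝ) ^ (n + 1) * x⌋ - 1 := by
      rw [Int.not_even_iff_odd] at he
      obtain ⟨k, hk⟩ := he; omega
    rw [h1, add_comm]
    simp only [sub_add_cancel]

theorem sib_parent (n : ℤ) (x : ℝ) : ⌊(2:ℝ) ^ n * sib (n + 1) x⌋ = ⌊(2:ℝ) ^ n * x⌋ := by
  rw [floor_succ_div, floor_succ_div n x, floor_sib]
  split_ifs with he
  · obtain ⟨k, hk⟩ := he; omega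
  · rw [Int.not_even_iff_odd] at he
    obtain ⟨k, hk⟩ := he; omega

/-- A function of level `n+1` that is invariant under `sib (n+1)` is of level `n`. -/
theorem lev_of_sib {F : Type*} {n : ℤ} {f : ℝ → F} (hf : Lev (n + 1) f)
    (h : ∀ x, f (sib (n + 1) x) = f x) : Lev n f := by
  intro x y hxy
  rw [floor_succ_div, floor_succ_div n y] at hxy
  by_cases hf2 : ⌊(2:ℝ) ^ (n + 1) * x⌋ = ⌊(2:ℝ) ^ (n + 1) * y⌋
  · exact hf x y hf2
  · rw [← h x]
    apply hf
    rw [floor_sib]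
    split_ifs with he
    · obtain ⟨k, hk⟩ := he; omega
    · rw [Int.not_even_iff_odd] at he
      obtain ⟨k, hk⟩ := he; omega

theorem cexp_lev_parent (n : ℤ) {f : ℝ → E} (hf : Nice f) (hl : Lev (n + 1) f) (x : ℝ) :
    cexp n f x = (1/2 : ℝ) • (f x + f (sib (n + 1) x)) := by
  rw [cexp_parent n hf, hl.cexp_eq]

theorem cexp_cexp_succ (n : ℤ) {f : ℝ → E} (hf : Nice f) :
    cexp n (cexp (n + 1) f) = cexp n f := by
  funext x
  rw [cexp_lev_parent n (cexp_nice _ hf) (lev_cexp _ _), cexp_parent n hf]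

theorem cexp_cexp_of_le {m n : ℤ} (h : m ≤ n) {f : ℝ → E} (hf : Nice f) :
    cexp m (cexp n f) = cexp m f := by
  induction n, h using Int.leInduction with
  | base => exact (lev_cexp m f).cexp_eq
  | succ n hn ih =>
    rw [← ih, ← cexp_cexp_succ n hf]
    have key : ∀ k : ℤ, m ≤ k → ∀ g : ℝ → E, Nice g → cexp m (cexp k g) = cexp m g := by
      intro k hk
      induction k, hk using Int.leInduction with
      | base => exact fun g _ => (lev_cexp m g).cexp_eq
      | succ k hk ihk =>
        intro g hg
        rw [← ihk _ (cexp_nice _ hg), cexp_cexp_succ k hg, ihk g hg]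
    rw [key n hn _ (cexp_nice _ hf)]

theorem cexp_cexp_of_ge {m n : ℤ} (h : m ≤ n) (f : ℝ → E) :
    cexp n (cexp m f) = cexp m f := ((lev_cexp m f).mono h).cexp_eq

theorem integral_cexp (n : ℤ) {f : ℝ → E} (hf : Nice f) :
    ∫ x, cexp n f x = ∫ x, f x := by
  have hs : ∀ g : ℝ → E, ∫ x, g ((2:ℝ) ^ (-n) * x) = (2:ℝ) ^ n • ∫ x, g x := by
    intro g
    have := Measure.integral_comp_mul_left g ((2:ℝ) ^ (-n))
    rwa [← zpow_neg, neg_neg, abs_of_pos (by positivity)] at this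
  have hne : (2:ℝ) ^ n ≠ 0 := by positivity
  rw [← (smul_right_injective E hne).eq_iff]
  simp only [← hs]
  have hn2 : ∀ {g : ℝ → E}, Nice g → Integrable (fun x => g ((2:ℝ) ^ (-n) * x)) := fun hg =>
    hg.integrable.comp_mul_left' (by positivity)
  have h1 := (hn2 (cexp_nice n hf)).hasSum_intervalIntegral 0
  have h2 := (hn2 hf).hasSum_intervalIntegral 0
  have he : ∀ k : ℤ, (∫ x in (0:ℝ) + k..0 + k + 1, cexp n f ((2:ℝ) ^ (-n) * x)) =
      ∫ x in (0:ℝ) + k..0 + k + 1, f ((2:ℝ) ^ (-n) * x) := by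
    intro k
    have : ∀ᵐ x : ℝ, x ∈ Set.uIoc ((0:ℝ) + k) (0 + k + 1) →
        cexp n f ((2:ℝ) ^ (-n) * x) = ∫ x in (0:ℝ) + k..0 + k + 1, f ((2:ℝ) ^ (-n) * x) := by
      have hae : ∀ᵐ x : ℝ, x ≠ k + 1 := Measure.ae_ne volume _
      filter_upwards [hae] with x hx hxI
      rw [uIoc_of_le (by linarith), zero_add] at hxI
      have hfl : ⌊(2:ℝ) ^ n * ((2:ℝ) ^ (-n) * x)⌋ = k := by
        rw [← mul_assoc, ← zpow_add₀ two_ne_zero]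
        simp only [add_neg_cancel, zpow_zero, one_mul]
        rw [Int.floor_eq_iff]
        exact ⟨hxI.1.le, lt_of_le_of_ne hxI.2 hx⟩
      rw [cexp_eq_interval n hf, hfl, intervalIntegral.integral_comp_mul_left _ (by positivity)]
      simp [zpow_neg]
    rw [intervalIntegral.integral_congr_ae this]
    simp
  simp only [he] at h1
  exact h1.unique h2

theorem integral_mul_cexp (n : ℤ) {f g : ℝ → ℝ} (hf : Nice f) (hg : Nice g) :
    ∫ x, g x * cexp n f x = ∫ x, cexp n g x * cexp n f x := by
  rw [← integral_cexp n (hg.mul (cexp_nice n hf))]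
  congr 1; funext x
  have := cexp_mul_left (lev_cexp n f) g x
  simp only [mul_comm (cexp n f _)] at this
  rw [this]

theorem integral_cexp_adjoint (n : ℤ) {f g : ℝ → ℝ} (hf : Nice f) (hg : Nice g) :
    ∫ x, g x * cexp n f x = ∫ x, cexp n g x * f x := by
  rw [integral_mul_cexp n hf hg]
  have := integral_mul_cexp n hg hf
  simp only [mul_comm (f _), mul_comm (cexp n f _)] at this
  rw [this]

theorem integral_lev_mul_cexp {n : ℤ} {f g : ℝ → ℝ} (hf : Nice f) (hg : Nice g) (hl : Lev n g) :
    ∫ x, g x * cexp n f x = ∫ x, g x * f x := by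
  rw [integral_cexp_adjoint n hf hg, hl.cexp_eq]

/-- The dyadic martingale difference operator. -/
def mdiff (n : ℤ) (f : ℝ → E) (x : ℝ) : E := cexp n f x - cexp (n - 1) f x

theorem mdiff_nice (n : ℤ) {f : ℝ → E} (hf : Nice f) : Nice (mdiff n f) :=
  (cexp_nice n hf).sub (cexp_nice _ hf)

theorem lev_mdiff (n : ℤ) (f : ℝ → E) : Lev n (mdiff n f) := by
  intro x y h
  rw [mdiff, mdiff, lev_cexp n f x y h, (lev_cexp (n-1) f).mono (by omega : n - 1 ≤ n) x y h]

theorem cexp_sub (n : ℤ) {f g : ℝ → E} (hf : Nice f) (hg : Nice g) :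
    cexp n (fun x => f x - g x) = fun x => cexp n f x - cexp n g x := by
  funext x; exact avg_sub (niceFam_cellpt n) hf hg x

theorem cexp_add (n : ℤ) {f g : ℝ → E} (hf : Nice f) (hg : Nice g) :
    cexp n (fun x => f x + g x) = fun x => cexp n f x + cexp n g x := by
  funext x; exact avg_add (niceFam_cellpt n) hf hg x

theorem cexp_mdiff {m n : ℤ} (h : m < n) {f : ℝ → E} (hf : Nice f) :
    cexp m (mdiff n f) = fun _ => 0 := by
  change cexp m (fun x => cexp n f x - cexp (n - 1) f x) = _
  rw [cexp_sub m (cexp_nice _ hf) (cexp_nice _ hf), cexp_cexp_of_le h.le hf,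
    cexp_cexp_of_le (by omega) hf]
  simp

theorem mdiff_mdiff (n : ℤ) {f : ℝ → E} (hf : Nice f) : mdiff n (mdiff n f) = mdiff n f := by
  funext x
  rw [mdiff, (lev_mdiff n f).cexp_eq, cexp_mdiff (by omega) hf, sub_zero]

theorem cexp_mdiff_of_ge {m n : ℤ} (h : n ≤ m) (f : ℝ → E) :
    cexp m (mdiff n f) = mdiff n f := ((lev_mdiff n f).mono h).cexp_eq

theorem mdiff_sib (n : ℤ) {f : ℝ → E} (hf : Nice f) (x : ℝ) :
    mdiff n f (sib n x) = - mdiff n f x := by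
  have h := cexp_lev_parent (n - 1) (mdiff_nice n hf) (by simpa using lev_mdiff n f) x
  rw [cexp_mdiff (by omega) hf] at h
  simp only [sub_add_cancel] at h
  have h2 := (smul_eq_zero.1 h.symm).resolve_left (by norm_num)
  exact eq_neg_of_add_eq_zero_right h2

theorem cexp_mono (n : ℤ) {f g : ℝ → ℝ} (hf : Nice f) (hg : Nice g) (h : ∀ x, f x ≤ g x)
    (x : ℝ) : cexp n f x ≤ cexp n g x := avg_mono (niceFam_cellpt n) hf hg h x

theorem norm_mdiff_sq_le (n : ℤ) {f : ℝ → E} (hf : Nice f) (x : ℝ) :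
    ‖mdiff n f x‖ ^ 2 ≤ 4 * cexp (n - 1) (fun x => ‖f x‖ ^ 2) x := by
  have hsq : Nice fun x => ‖f x‖ ^ 2 := hf.norm.sq
  have hnl : Lev (n - 1) fun x => ‖mdiff n f x‖ ^ 2 := by
    apply lev_of_sib
    · intro x y h
      simp only [sub_add_cancel] at h
      simp only [lev_mdiff n f x y h]
    · intro x
      simp only [sub_add_cancel, mdiff_sib n hf, norm_neg]
  have h1 : ∀ x, ‖mdiff n f x‖ ^ 2 ≤ 2 * cexp n (fun x => ‖f x‖ ^ 2) x
      + 2 * cexp (n - 1) (fun x => ‖f x‖ ^ 2) x := by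
    intro x
    have ha := norm_avg_sq_le (niceFam_cellpt n) hf x
    have hb := norm_avg_sq_le (niceFam_cellpt (n - 1)) hf x
    have hc := norm_sub_le (cexp n f x) (cexp (n - 1) f x)
    have hd : ‖mdiff n f x‖ ^ 2 ≤ (‖cexp n f x‖ + ‖cexp (n-1) f x‖) ^ 2 :=
      pow_le_pow_left₀ (norm_nonneg _) hc 2
    have he := sq_nonneg (‖cexp n f x‖ - ‖cexp (n-1) f x‖)
    change ‖cexp n f x‖ ^ 2 ≤ cexp n _ x at ha
    change ‖cexp (n-1) f x‖ ^ 2 ≤ cexp (n-1) _ x at hb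
    nlinarith
  have h2 := cexp_mono (n - 1) (mdiff_nice n hf).norm.sq
    (((cexp_nice n hsq).const_mul 2).add ((cexp_nice (n-1) hsq).const_mul 2)) h1 x
  rw [hnl.cexp_eq, cexp_add _ ((cexp_nice n hsq).const_mul 2)
    ((cexp_nice (n-1) hsq).const_mul 2)] at h2
  have e1 : cexp (n-1) (fun x => 2 * cexp n (fun x => ‖f x‖ ^ 2) x) x
      = 2 * cexp (n-1) (fun x => ‖f x‖ ^ 2) x := by
    rw [← cexp_cexp_of_le (by omega : n - 1 ≤ n) hsq]; exact avg_const_mul _ _ _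
  have e2 : cexp (n-1) (fun x => 2 * cexp (n-1) (fun x => ‖f x‖ ^ 2) x) x
      = 2 * cexp (n-1) (fun x => ‖f x‖ ^ 2) x := by
    conv_rhs => rw [← cexp_cexp_of_le le_rfl hsq]
    exact avg_const_mul _ _ _
  simp only [e1, e2] at h2
  linarith

end Dyadic

section Doob

/-- The dyadic maximal function over the levels `m, …, m + n`. -/
def dmax (m : ℤ) (f : ℝ → ℝ) : ℕ → ℝ → ℝ
  | 0 => cexp m f
  | n + 1 => fun x => max (dmax m f n x) (cexp (m + (n + 1 : ℕ)) f x)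

theorem dmax_nice (m : ℤ) {f : ℝ → ℝ} (hf : Nice f) (n : ℕ) : Nice (dmax m f n) := by
  induction n with
  | zero => exact cexp_nice m hf
  | succ n ih => exact ih.max (cexp_nice _ hf)

theorem lev_dmax (m : ℤ) (f : ℝ → ℝ) (n : ℕ) : Lev (m + n) (dmax m f n) := by
  induction n with
  | zero => simpa [dmax] using lev_cexp m f
  | succ n ih =>
    intro x y h
    have h1 := lev_cexp (m + (n + 1 : ℕ)) f x y h
    have h2 := ih.mono (by push_cast; omega : m + n ≤ m + (n + 1 : ℕ)) x y h
    simp only [dmax, h1, h2]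

theorem cexp_le_dmax (m : ℤ) (f : ℝ → ℝ) {i n : ℕ} (h : i ≤ n) (x : ℝ) :
    cexp (m + i) f x ≤ dmax m f n x := by
  induction n, h using Nat.le_induction with
  | base => cases i with
    | zero => simp [dmax]
    | succ i => exact le_max_right _ _
  | succ n _ ih => exact ih.trans (le_max_left _ _)

theorem integral_dmax_sq_le (m : ℤ) {f : ℝ → ℝ} (hf : Nice f) (n : ℕ) :
    ∫ x, dmax m f n x ^ 2 ≤ 4 * ∫ x, f x ^ 2 := by
  have hS := dmax_nice m hf
  have hX : ∀ k, Nice (cexp k f) := fun k => cexp_nice k hf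
  have key : ∀ n : ℕ, ∫ x, (dmax m f n x ^ 2 - 2 * (dmax m f n x * f x)) ≤ 0 := by
    intro n
    induction n with
    | zero =>
      have h1 : ∫ x, dmax m f 0 x * f x = ∫ x, dmax m f 0 x ^ 2 := by
        simp only [dmax]
        rw [← integral_lev_mul_cexp hf (hX m) (lev_cexp m f)]
        simp only [pow_two]
      rw [integral_sub (hS 0).sq.integrable (((hS 0).mul hf).const_mul 2).integrable,
        integral_const_mul, h1]
      have : 0 ≤ ∫ x, dmax m f 0 x ^ 2 := integral_nonneg fun _ => sq_nonneg _
      linarith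
    | succ n ih =>
      refine le_trans ?_ ih
      have e1 : ∫ x, (dmax m f (n+1) x ^ 2 - 2 * (dmax m f (n+1) x * f x)) =
          ∫ x, (dmax m f (n+1) x ^ 2 -
            2 * (dmax m f (n+1) x * cexp (m + (n+1 : ℕ)) f x)) := by
        rw [integral_sub (hS _).sq.integrable (((hS _).mul hf).const_mul 2).integrable,
          integral_sub (hS _).sq.integrable (((hS _).mul (hX _)).const_mul 2).integrable,
          integral_const_mul, integral_const_mul,
          integral_lev_mul_cexp hf (hS _) (lev_dmax m f (n+1))]
      have e2 : ∫ x, (dmax m f n x ^ 2 - 2 * (dmax m f n x * f x)) =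
          ∫ x, (dmax m f n x ^ 2 - 2 * (dmax m f n x * cexp (m + (n+1 : ℕ)) f x)) := by
        rw [integral_sub (hS _).sq.integrable (((hS _).mul hf).const_mul 2).integrable,
          integral_sub (hS _).sq.integrable (((hS _).mul (hX _)).const_mul 2).integrable,
          integral_const_mul, integral_const_mul,
          integral_lev_mul_cexp hf (hS _) ((lev_dmax m f n).mono (by push_cast; omega))]
      rw [e1, e2]
      refine integral_mono ((hS _).sq.sub (((hS _).mul (hX _)).const_mul 2)).integrable
        ((hS _).sq.sub (((hS _).mul (hX _)).const_mul 2)).integrable fun x => ?_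
      simp only [dmax]
      rcases le_total (dmax m f n x) (cexp (m + (n+1 : ℕ)) f x) with h | h
      · rw [max_eq_right h]
        nlinarith [sq_nonneg (dmax m f n x - cexp (m + (n+1 : ℕ)) f x)]
      · rw [max_eq_left h]
  have h1 := key n
  have h2 : 0 ≤ ∫ x, ((dmax m f n x) ^ 2 - 4 * (dmax m f n x * f x) + 4 * f x ^ 2) :=
    integral_nonneg fun x => by
      have := sq_nonneg (dmax m f n x - 2 * f x)
      show 0 ≤ (dmax m f n x) ^ 2 - 4 * (dmax m f n x * f x) + 4 * f x ^ 2
      nlinarith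
  rw [integral_sub (hS n).sq.integrable (((hS n).mul hf).const_mul 2).integrable,
    integral_const_mul] at h1
  rw [integral_add ((hS n).sq.sub (((hS n).mul hf).const_mul 4)).integrable
    (hf.sq.const_mul 4).integrable, integral_sub (hS n).sq.integrable
    (((hS n).mul hf).const_mul 4).integrable, integral_const_mul, integral_const_mul] at h2
  linarith

end Doob

section TwoPoint

theorem rpow_sub_rpow_le {σ A B : ℝ} (hσ : 1 ≤ σ) (hA : 0 ≤ A) (hB : 0 ≤ B) :
    A ^ σ - B ^ σ ≤ σ * (A - B) * A ^ (σ - 1) := by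
  rcases hA.eq_or_lt with rfl | hA
  · rw [Real.zero_rpow (by linarith)]
    have h1 : 0 ≤ B ^ σ := Real.rpow_nonneg hB _
    rcases hσ.eq_or_lt with rfl | h
    · simp
    · rw [Real.zero_rpow (by linarith)]; linarith
  · have h := one_add_mul_self_le_rpow_one_add (s := B / A - 1)
      (by have := div_nonneg hB hA.le; linarith) hσ
    rw [show 1 + (B / A - 1) = B / A by ring, Real.div_rpow hB hA.le,
      le_div_iff₀ (Real.rpow_pos_of_pos hA σ)] at h
    have e : A ^ σ = A * A ^ (σ - 1) := by
      rw [← Real.rpow_one_add' hA.le (by linarith)]; congr 1; ring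
    have e2 : (1 + σ * (B / A - 1)) * A ^ σ = A ^ σ + σ * (B - A) * A ^ (σ - 1) := by
      rw [e]; field_simp
    rw [e2] at h
    linarith

theorem rpow_sub_rpow_le' {τ P Q : ℝ} (hτ : 0 ≤ τ) (hQ : 0 ≤ Q) (hQP : Q ≤ P) :
    P ^ τ - Q ^ τ ≤ (τ + 1) * (P - Q) * P ^ (τ - 1) := by
  have hP := hQ.trans hQP
  have h0 : 0 ≤ (P - Q) * P ^ (τ - 1) := mul_nonneg (by linarith) (Real.rpow_nonneg hP _)
  rcases le_total 1 τ with h | h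
  · have := rpow_sub_rpow_le h hP hQ
    nlinarith
  · have h1 : P ^ τ - Q ^ τ ≤ (P - Q) * P ^ (τ - 1) := by
      rcases hP.eq_or_lt with rfl | hP
      · have : Q = 0 := le_antisymm hQP hQ
        simp [this]
      · have e : P ^ τ = P * P ^ (τ - 1) := by
          rw [Real.rpow_sub_one hP.ne']; field_simp
        have : Q * P ^ (τ - 1) ≤ Q ^ τ := by
          rcases hQ.eq_or_lt with rfl | hQ
          · rw [zero_mul]; exact Real.rpow_nonneg le_rfl _
          · have e' : Q ^ τ = Q * Q ^ (τ - 1) := by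
              rw [Real.rpow_sub_one hQ.ne']; field_simp
            rw [e']
            exact mul_le_mul_of_nonneg_left
              (Real.rpow_le_rpow_of_nonpos hQ hQP (by linarith)) hQ.le
        rw [e]; linarith
    nlinarith

theorem two_point_real {σ A D P Q : ℝ} (hσ : 1 ≤ σ) (hA : 0 ≤ A) (hD : 0 ≤ D) (hQ : 0 ≤ Q)
    (hQP : Q ≤ P) (hsum : P + Q = 2 * (A + D)) (hdiff : (P - Q) ^ 2 ≤ 16 * (A * D)) :
    P ^ σ + Q ^ σ ≤ 2 * A ^ σ + 10 * σ ^ 2 * (P ^ (σ - 1) * D) := by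
  have hP := hQ.trans hQP
  set m := A + D with hm
  have hmP : m ≤ P := by linarith
  have hm0 : 0 ≤ m := by linarith
  have hPr : 0 ≤ P ^ (σ - 1) := Real.rpow_nonneg hP _
  have h1 := rpow_sub_rpow_le hσ hm0 hA
  have h1' : m ^ (σ - 1) ≤ P ^ (σ - 1) := Real.rpow_le_rpow hm0 hmP (by linarith)
  have h2 := rpow_sub_rpow_le hσ hP hm0
  have h3 := rpow_sub_rpow_le hσ hQ hm0
  have h4 := rpow_sub_rpow_le' (τ := σ - 1) (by linarith) hQ hQP
  have h5 : (P - Q) ^ 2 * P ^ (σ - 1 - 1) ≤ 16 * (P ^ (σ - 1) * D) := by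
    rcases hP.eq_or_lt with hP0 | hP0
    · have hPQ : P - Q = 0 := by linarith
      rw [hPQ]
      simp only [ne_eq, OfNat.ofNat_ne_zero, not_false_eq_true, zero_pow, zero_mul]
      positivity
    · have e : P ^ (σ - 1) = P * P ^ (σ - 1 - 1) := by
        rw [Real.rpow_sub_one hP0.ne' (σ - 1)]; field_simp
      have h6 : 0 ≤ P ^ (σ - 1 - 1) := Real.rpow_nonneg hP _
      have h7 : (P - Q) ^ 2 ≤ 16 * (P * D) :=
        hdiff.trans (by gcongr; linarith)
      calc (P - Q) ^ 2 * P ^ (σ - 1 - 1) ≤ 16 * (P * D) * P ^ (σ - 1 - 1) := by gcongr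
        _ = _ := by rw [e]; ring
  have hPm : P - m = (P - Q) / 2 := by linarith
  have hQm : Q - m = -((P - Q) / 2) := by linarith
  rw [hPm] at h2
  rw [hQm] at h3
  have hmA : m - A = D := by rw [hm]; ring
  rw [hmA] at h1
  have h8 : P ^ σ + Q ^ σ - 2 * m ^ σ ≤ σ * ((P - Q) / 2) * (P ^ (σ-1) - Q ^ (σ-1)) := by
    nlinarith
  have h9 : σ * ((P - Q) / 2) * (P ^ (σ-1) - Q ^ (σ-1)) ≤
      σ * ((P - Q) / 2) * ((σ - 1 + 1) * (P - Q) * P ^ (σ - 1 - 1)) :=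
    mul_le_mul_of_nonneg_left h4 (mul_nonneg (by linarith) (by linarith))
  have h10 : σ * ((P - Q) / 2) * ((σ - 1 + 1) * (P - Q) * P ^ (σ - 1 - 1)) =
      σ ^ 2 / 2 * ((P - Q) ^ 2 * P ^ (σ - 1 - 1)) := by ring
  have h11 : σ ^ 2 / 2 * ((P - Q) ^ 2 * P ^ (σ - 1 - 1)) ≤
      σ ^ 2 / 2 * (16 * (P ^ (σ - 1) * D)) := mul_le_mul_of_nonneg_left h5 (by positivity)
  have h12 : σ * D * m ^ (σ - 1) ≤ σ ^ 2 * (P ^ (σ - 1) * D) := by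
    calc σ * D * m ^ (σ - 1) ≤ σ * D * P ^ (σ - 1) := by gcongr
      _ = σ * (P ^ (σ - 1) * D) := by ring
      _ ≤ σ ^ 2 * (P ^ (σ - 1) * D) := by
        have : σ ≤ σ ^ 2 := by nlinarith
        exact mul_le_mul_of_nonneg_right this (by positivity)
  nlinarith

variable {H : Type*} [NormedAddCommGroup H] [InnerProductSpace ℝ H]

theorem sq_rpow_half (x s : ℝ) (hx : 0 ≤ x) : (x ^ 2) ^ (s / 2) = x ^ s := by
  rw [← Real.rpow_natCast_mul hx]; norm_num; ring_nf

theorem two_point {s : ℝ} (hs : 2 ≤ s) (a d : H) :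
    ‖a + d‖ ^ s + ‖a - d‖ ^ s ≤
      2 * ‖a‖ ^ s + 4 * s ^ 2 * (max ‖a + d‖ ‖a - d‖ ^ (s - 2) * ‖d‖ ^ 2) := by
  wlog h : ‖a - d‖ ≤ ‖a + d‖ generalizing d
  · have := this (-d) (by simpa [sub_eq_add_neg] using (not_le.1 h).le)
    simp only [sub_neg_eq_add, norm_neg, ← sub_eq_add_neg] at this
    rw [add_comm, max_comm]; exact this
  rw [max_eq_left h]
  have h1 := two_point_real (σ := s / 2) (A := ‖a‖ ^ 2) (D := ‖d‖ ^ 2) (P := ‖a + d‖ ^ 2)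
    (Q := ‖a - d‖ ^ 2) (by linarith) (by positivity) (by positivity) (by positivity)
    (pow_le_pow_left₀ (norm_nonneg _) h 2) (by
      have := parallelogram_law_with_norm ℝ a d
      nlinarith) (by
      have e : ‖a + d‖ ^ 2 - ‖a - d‖ ^ 2 = 4 * inner ℝ a d := by
        rw [norm_add_sq_real, norm_sub_sq_real]; ring
      have hi := abs_real_inner_le_norm a d
      have : (inner ℝ a d) ^ 2 ≤ (‖a‖ * ‖d‖) ^ 2 := by
        rw [← sq_abs (inner ℝ a d)]
        exact pow_le_pow_left₀ (abs_nonneg _) hi 2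
      rw [e]; nlinarith)
  have e2 : (‖a + d‖ ^ 2) ^ (s / 2 - 1) = ‖a + d‖ ^ (s - 2) := by
    rw [← sq_rpow_half _ (s - 2) (norm_nonneg _)]; congr 1; ring
  rw [sq_rpow_half _ _ (norm_nonneg _), sq_rpow_half _ _ (norm_nonneg _),
    sq_rpow_half _ _ (norm_nonneg _), e2] at h1
  have h0 : 0 ≤ ‖a + d‖ ^ (s - 2) * ‖d‖ ^ 2 := by positivity
  nlinarith [sq_nonneg s]

/-- A form of Young's inequality, with `a = y ^ (1/σ)`. -/
theorem young_weighted {σ y q ε : ℝ} (hσ : 1 ≤ σ) (hy : 0 ≤ y) (hq : 0 ≤ q) (hε : 0 < ε) :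
    (y ^ (1 / σ)) ^ (2 * σ - 2) * q ≤ ε * y ^ 2 + (ε⁻¹) ^ (σ - 1) * q ^ σ := by
  set a := y ^ (1 / σ) with ha
  have ha0 : 0 ≤ a := Real.rpow_nonneg hy _
  have hy2 : y ^ 2 = a ^ (2 * σ - 2) * a ^ 2 := by
    have h1 : a ^ σ = y := by
      rw [ha, ← Real.rpow_mul hy, one_div_mul_cancel (by linarith), Real.rpow_one]
    rw [← h1, ← Real.rpow_mul_natCast ha0, ← Real.rpow_natCast a 2,
      ← Real.rpow_add_of_nonneg ha0 (by linarith) (by norm_num)]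
    congr 1; push_cast; ring
  have e : a ^ (2 * σ - 2) = (a ^ 2) ^ (σ - 1) := by
    rw [← sq_rpow_half _ _ ha0]; congr 1; ring
  have hn1 : 0 ≤ (ε⁻¹) ^ (σ - 1) * q ^ σ := by positivity
  have hn2 : 0 ≤ ε * y ^ 2 := by positivity
  rcases le_total q (ε * a ^ 2) with h | h
  · have : a ^ (2 * σ - 2) * q ≤ a ^ (2 * σ - 2) * (ε * a ^ 2) :=
      mul_le_mul_of_nonneg_left h (Real.rpow_nonneg ha0 _)
    nlinarith
  · have h2 : a ^ 2 ≤ ε⁻¹ * q := by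
      rw [inv_mul_eq_div, le_div_iff₀ hε]; linarith
    have h3 : (a ^ 2) ^ (σ - 1) ≤ (ε⁻¹) ^ (σ - 1) * q ^ (σ - 1) := by
      rw [← Real.mul_rpow (by positivity) hq]
      exact Real.rpow_le_rpow (by positivity) h2 (by linarith)
    have h4 : q ^ (σ - 1) * q = q ^ σ := by
      rw [← Real.rpow_add_one' hq (by linarith)]; ring_nf
    rw [e]
    have h5 := mul_le_mul_of_nonneg_right h3 hq
    rw [mul_assoc, h4] at h5
    linarith

end TwoPoint

section BDG

variable {H : Type*} [NormedAddCommGroup H] [InnerProductSpace ℝ H] [CompleteSpace H]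

/-- Partial sums of `∑ i, D_{m+i} h_i`. -/
def msum (m : ℤ) (h : ℕ → ℝ → H) (n : ℕ) (x : ℝ) : H :=
  ∑ i ∈ Finset.range n, mdiff (m + i) (h i) x

theorem msum_nice (m : ℤ) {h : ℕ → ℝ → H} (hh : ∀ i, Nice (h i)) (n : ℕ) :
    Nice (msum m h n) := Nice.sum _ fun i _ => mdiff_nice _ (hh i)

theorem lev_msum (m : ℤ) (h : ℕ → ℝ → H) (n : ℕ) : Lev (m + n - 1) (msum m h n) := by
  intro x y hxy
  refine Finset.sum_congr rfl fun i hi => ?_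
  rw [Finset.mem_range] at hi
  exact (lev_mdiff (m + i) (h i)).mono (by omega : m + i ≤ m + n - 1) x y hxy

theorem cexp_sum (n : ℤ) {ι : Type*} (s : Finset ι) {f : ι → ℝ → H}
    (hf : ∀ i ∈ s, Nice (f i)) :
    cexp n (fun x => ∑ i ∈ s, f i x) = fun x => ∑ i ∈ s, cexp n (f i) x := by
  funext x; exact avg_sum (niceFam_cellpt n) s hf x

theorem cexp_msum (m : ℤ) {h : ℕ → ℝ → H} (hh : ∀ i, Nice (h i)) {k n : ℕ} (hk : k ≤ n) :
    cexp (m + k - 1) (msum m h n) = msum m h k := by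
  change cexp _ (fun x => ∑ i ∈ Finset.range n, mdiff (m + i) (h i) x) = _
  rw [cexp_sum _ _ fun i _ => mdiff_nice _ (hh i)]
  funext x
  rw [msum, ← Finset.sum_range_add_sum_Ico _ hk]
  have h0 : ∑ i ∈ Finset.Ico k n, cexp (m + k - 1) (mdiff (m + i) (h i)) x = 0 := by
    refine Finset.sum_eq_zero fun i hi => ?_
    rw [Finset.mem_Ico] at hi
    rw [cexp_mdiff (by omega) (hh i)]
  rw [h0, add_zero]
  refine Finset.sum_congr rfl fun i hi => ?_
  rw [Finset.mem_range] at hi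
  rw [cexp_mdiff_of_ge (by omega)]

theorem integral_norm_rpow_sib {m : ℤ} {G : ℝ → ℝ} (hG : Nice G) (hl : Lev m G) :
    ∫ x, G x = ∫ x, (1/2 : ℝ) * (G x + G (sib m x)) := by
  rw [← integral_cexp (m - 1) hG]
  congr 1; funext x
  have := cexp_lev_parent (m - 1) hG (by simpa using hl) x
  rwa [sub_add_cancel] at this

theorem bdg_step (m : ℤ) {h F : ℝ → H} (hh : Nice h) (hF : Nice F) (hl : Lev (m - 1) F)
    {s : ℝ} (hs : 2 ≤ s) :
    ∫ x, ‖F x + mdiff m h x‖ ^ s ≤ ∫ x, ‖F x‖ ^ s + 8 * s ^ 2 *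
      (max ‖F x + mdiff m h x‖ ‖F x - mdiff m h x‖ ^ (s - 2) * ‖h x‖ ^ 2) := by
  have hd := mdiff_nice m hh
  have hs0 : 0 < s := by linarith
  have hG : Nice fun x => ‖F x + mdiff m h x‖ ^ s :=
    (hF.add hd).norm.rpow (fun _ => norm_nonneg _) hs0
  have hlF : Lev m F := hl.mono (by omega)
  have hsibF : ∀ x, F (sib m x) = F x := fun x => hl _ _ (by
    have := sib_parent (m - 1) x
    rwa [sub_add_cancel] at this)
  have hlG : Lev m fun x => ‖F x + mdiff m h x‖ ^ s := by
    intro x y hxy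
    simp only [hlF x y hxy, lev_mdiff m h x y hxy]
  rw [integral_norm_rpow_sib hG hlG]
  set w : ℝ → ℝ := fun x => max ‖F x + mdiff m h x‖ ‖F x - mdiff m h x‖ with hw
  have hwn : Nice w := (hF.add hd).norm.max (hF.sub hd).norm
  have hw0 : ∀ x, 0 ≤ w x := fun x => le_max_of_le_left (norm_nonneg _)
  have hlw : Lev (m - 1) w := by
    apply lev_of_sib
    · rw [sub_add_cancel]
      intro x y hxy
      simp only [hw, hlF x y hxy, lev_mdiff m h x y hxy]
    · intro x
      rw [sub_add_cancel]
      simp only [hw, hsibF, mdiff_sib m hh]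
      rw [max_comm, sub_neg_eq_add, ← sub_eq_add_neg]
  have hwm : StronglyMeasurable fun x => w x ^ (s - 2) :=
    (hwn.meas.measurable.pow_const _).stronglyMeasurable
  have hwb : ∃ C, ∀ x, ‖w x ^ (s - 2)‖ ≤ C := by
    obtain ⟨C, hC⟩ := hwn.bdd
    refine ⟨C ^ (s - 2), fun x => ?_⟩
    rw [Real.norm_of_nonneg (Real.rpow_nonneg (hw0 x) _)]
    exact Real.rpow_le_rpow (hw0 x) ((le_abs_self _).trans (hC x)) (by linarith)
  have hprod : ∀ {g : ℝ → ℝ}, Nice g → Nice fun x => w x ^ (s - 2) * g x := by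
    intro g hg
    simpa only [mul_comm] using hg.mul_bdd hwm hwb
  have hFs : Nice fun x => ‖F x‖ ^ s := hF.norm.rpow (fun _ => norm_nonneg _) hs0
  have e1 : ∫ x, w x ^ (s - 2) * cexp (m - 1) (fun x => ‖h x‖ ^ 2) x
      = ∫ x, w x ^ (s - 2) * ‖h x‖ ^ 2 := by
    rw [← integral_cexp (m - 1) (hprod hh.norm.sq)]
    congr 1; funext x
    rw [cexp_mul_left]
    intro x y hxy
    simp only [hlw x y hxy]
  have e2 : ∫ x, (1/2 : ℝ) * (‖F x + mdiff m h x‖ ^ s + ‖F (sib m x) + mdiff m h (sib m x)‖ ^ s)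
      ≤ ∫ x, (‖F x‖ ^ s + 8 * s ^ 2 *
        (w x ^ (s - 2) * cexp (m - 1) (fun x => ‖h x‖ ^ 2) x)) := by
    refine integral_mono ((hG.add (hG.comp_sib (m := m))).const_mul _).integrable
      (hFs.add ((hprod (cexp_nice _ hh.norm.sq)).const_mul _)).integrable fun x => ?_
    simp only [hsibF, mdiff_sib m hh, ← sub_eq_add_neg]
    have h1 := two_point hs (F x) (mdiff m h x)
    have h2 := mul_le_mul_of_nonneg_left (norm_mdiff_sq_le m hh x)
      (Real.rpow_nonneg (hw0 x) (s - 2))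
    have h3 := mul_le_mul_of_nonneg_left h2 (by positivity : 0 ≤ 2 * s ^ 2)
    simp only [hw] at h3 ⊢
    nlinarith
  refine e2.trans_eq ?_
  rw [integral_add hFs.integrable ((hprod (cexp_nice _ hh.norm.sq)).const_mul _).integrable,
    integral_add hFs.integrable ((hprod hh.norm.sq).const_mul _).integrable,
    integral_const_mul, integral_const_mul, e1]

theorem bdg (m : ℤ) {h : ℕ → ℝ → H} (hh : ∀ i, Nice (h i)) (N : ℕ) {s : ℝ} (hs : 2 ≤ s) :
    ∫ x, ‖msum m h N x‖ ^ s ≤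
      (16 * s) ^ s * ∫ x, (∑ i ∈ Finset.range N, ‖h i x‖ ^ 2) ^ (s / 2) := by
  have hs0 : 0 < s := by linarith
  have hF := msum_nice m hh
  have hd := fun n : ℕ => mdiff_nice (m + n) (hh n)
  set Φ : ℝ → ℝ := fun x => ‖msum m h N x‖ ^ (s / 2) with hΦ
  have hΦn : Nice Φ := (hF N).norm.rpow (fun _ => norm_nonneg _) (by linarith)
  set S := dmax (m - 1) Φ N with hS
  have hSn : Nice S := dmax_nice _ hΦn N
  have hS0 : ∀ x, 0 ≤ S x := fun x =>
    (avg_nonneg (fun _ => Real.rpow_nonneg (norm_nonneg _) _) x).trans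
      (cexp_le_dmax (m - 1) Φ (Nat.zero_le N) x)
  set Q : ℝ → ℝ := fun x => ∑ i ∈ Finset.range N, ‖h i x‖ ^ 2 with hQ
  have hQn : Nice Q := Nice.sum _ fun i _ => (hh i).norm.sq
  have hQ0 : ∀ x, 0 ≤ Q x := fun x => Finset.sum_nonneg fun i _ => sq_nonneg _
  let w : ℕ → ℝ → ℝ := fun n x =>
    max ‖msum m h n x + mdiff (m + n) (h n) x‖ ‖msum m h n x - mdiff (m + n) (h n) x‖
  have hwn : ∀ n, Nice (w n) := fun n => ((hF n).add (hd n)).norm.max ((hF n).sub (hd n)).norm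
  have hw0 : ∀ n x, 0 ≤ w n x := fun n x => le_max_of_le_left (norm_nonneg _)
  -- pointwise control of `w n` by the maximal function
  have hwS : ∀ n < N, ∀ x, w n x ≤ (2 * S x) ^ (1 / (s / 2)) := by
    intro n hn x
    have hl := lev_msum m h n
    have hG : Nice fun x => ‖msum m h (n + 1) x‖ ^ (s / 2) :=
      (hF (n + 1)).norm.rpow (fun _ => norm_nonneg _) (by linarith)
    have h1 : ∀ x, ‖msum m h (n + 1) x‖ ^ (s / 2) ≤ cexp (m + n) Φ x := by
      intro x
      have e := cexp_msum m hh (k := n + 1) (n := N) (by omega)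
      rw [← e]
      have := norm_avg_rpow_le (niceFam_cellpt (m + (n + 1 : ℕ) - 1)) (hF N)
        (r := s / 2) (by linarith) x
      have e2 : m + ((n + 1 : ℕ) : ℤ) - 1 = m + n := by push_cast; ring
      rw [e2] at this ⊢
      exact this
    have h2 := cexp_mono (m + n - 1) hG (cexp_nice (m + n) hΦn) h1 x
    rw [cexp_cexp_of_le (by omega) hΦn] at h2
    have hlG : Lev (m + n - 1 + 1) fun x => ‖msum m h (n + 1) x‖ ^ (s / 2) := by
      intro x y hxy
      have := lev_msum m h (n + 1) x y (by
        convert hxy using 4 <;> push_cast <;> ring)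
      simp only [this]
    rw [cexp_lev_parent (m + n - 1) hG hlG, sub_add_cancel] at h2
    have h3 : cexp (m + n - 1) Φ x ≤ S x := by
      have := cexp_le_dmax (m - 1) Φ hn.le x
      rwa [show m - 1 + (n : ℤ) = m + n - 1 by ring] at this
    have e3 : ∀ x, msum m h (n + 1) x = msum m h n x + mdiff (m + n) (h n) x := fun x =>
      Finset.sum_range_succ _ _
    have e4 : msum m h (n + 1) (sib (m + n) x) = msum m h n x - mdiff (m + n) (h n) x := by
      rw [e3, mdiff_sib _ (hh n), ← sub_eq_add_neg]
      congr 1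
      apply hl
      have := sib_parent (m + n - 1) x
      rwa [sub_add_cancel] at this
    rw [e3, e4] at h2
    have h5 : w n x ^ (s / 2) ≤ 2 * S x := by
      have ha : 0 ≤ ‖msum m h n x + mdiff (m + n) (h n) x‖ ^ (s / 2) := by positivity
      have hb : 0 ≤ ‖msum m h n x - mdiff (m + n) (h n) x‖ ^ (s / 2) := by positivity
      simp only [smul_eq_mul] at h2
      rcases max_choice ‖msum m h n x + mdiff (m + n) (h n) x‖
        ‖msum m h n x - mdiff (m + n) (h n) x‖ with hc | hc <;>
      · simp only [w, hc]; linarith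
    have h6 := Real.rpow_le_rpow (Real.rpow_nonneg (hw0 n x) _) h5
      (by positivity : 0 ≤ 1 / (s / 2))
    rwa [← Real.rpow_mul (hw0 n x), mul_one_div_cancel (by positivity), Real.rpow_one] at h6
  have hwb : ∀ n, StronglyMeasurable (fun x => w n x ^ (s - 2)) ∧
      ∃ C, ∀ x, ‖w n x ^ (s - 2)‖ ≤ C := by
    intro n
    refine ⟨((hwn n).meas.measurable.pow_const _).stronglyMeasurable, ?_⟩
    obtain ⟨C, hC⟩ := (hwn n).bdd
    refine ⟨C ^ (s - 2), fun x => ?_⟩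
    rw [Real.norm_of_nonneg (Real.rpow_nonneg (hw0 n x) _)]
    exact Real.rpow_le_rpow (hw0 n x) ((le_abs_self _).trans (hC x)) (by linarith)
  have hprod : ∀ n, Nice fun x => w n x ^ (s - 2) * ‖h n x‖ ^ 2 := fun n => by
    simpa only [mul_comm] using (hh n).norm.sq.mul_bdd (hwb n).1 (hwb n).2
  have hFs : ∀ n, Nice fun x => ‖msum m h n x‖ ^ s := fun n =>
    (hF n).norm.rpow (fun _ => norm_nonneg _) hs0
  have htel : ∀ n, ∫ x, ‖msum m h n x‖ ^ s ≤
      8 * s ^ 2 * ∫ x, ∑ i ∈ Finset.range n, w i x ^ (s - 2) * ‖h i x‖ ^ 2 := by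
    intro n
    induction n with
    | zero => simp [msum, Real.zero_rpow hs0.ne']
    | succ n ih =>
      have h1 := bdg_step (m + n) (hh n) (hF n) (lev_msum m h n) hs
      have e3 : ∀ x, msum m h (n + 1) x = msum m h n x + mdiff (m + n) (h n) x := fun x =>
        Finset.sum_range_succ _ _
      simp only [e3, Finset.sum_range_succ]
      rw [integral_add (hFs n).integrable ((hprod n).const_mul _).integrable,
        integral_const_mul] at h1
      rw [integral_add (Nice.sum _ fun i _ => hprod i).integrable (hprod n).integrable]
      change _ ≤ _ + 8 * s ^ 2 * ∫ x, w n x ^ (s - 2) * ‖h n x‖ ^ 2 at h1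
      linarith
  set ε : ℝ := (256 * s ^ 2)⁻¹ with hε
  have hε0 : 0 < ε := by positivity
  have hSQ : Nice fun x => ε * (2 * S x) ^ 2 := (hSn.const_mul 2).sq.const_mul ε
  have hQs : Nice fun x => ε⁻¹ ^ (s / 2 - 1) * Q x ^ (s / 2) :=
    (hQn.rpow hQ0 (by linarith)).const_mul _
  have hpt : ∫ x, ∑ i ∈ Finset.range N, w i x ^ (s - 2) * ‖h i x‖ ^ 2 ≤
      ∫ x, (ε * (2 * S x) ^ 2 + ε⁻¹ ^ (s / 2 - 1) * Q x ^ (s / 2)) := by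
    refine integral_mono (Nice.sum _ fun i _ => hprod i).integrable
      (hSQ.add hQs).integrable fun x => ?_
    refine le_trans ?_ (young_weighted (by linarith) (by linarith [hS0 x]) (hQ0 x) hε0)
    rw [hQ, Finset.mul_sum]
    refine Finset.sum_le_sum fun i hi => ?_
    refine mul_le_mul_of_nonneg_right ?_ (sq_nonneg _)
    rw [show 2 * (s / 2) - 2 = s - 2 by ring]
    exact Real.rpow_le_rpow (hw0 i x) (hwS i (Finset.mem_range.1 hi) x) (by linarith)
  have hmain := (htel N).trans (mul_le_mul_of_nonneg_left hpt (by positivity))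
  rw [integral_add hSQ.integrable hQs.integrable, integral_const_mul, integral_const_mul] at hmain
  have hdoob := integral_dmax_sq_le (m - 1) hΦn N
  have e5 : ∫ x, Φ x ^ 2 = ∫ x, ‖msum m h N x‖ ^ s := by
    congr 1; funext x
    rw [hΦ, ← Real.rpow_mul_natCast (norm_nonneg _)]
    congr 1; push_cast; ring
  have e6 : ∫ x, (2 * S x) ^ 2 = 4 * ∫ x, S x ^ 2 := by
    rw [← integral_const_mul]; congr 1; funext x; ring
  rw [e5] at hdoob
  rw [e6] at hmain
  have hεs : 8 * s ^ 2 * ε = 1 / 32 := by rw [hε]; field_simp; norm_num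
  have hI : ∫ x, ‖msum m h N x‖ ^ s ≤
      16 * s ^ 2 * (ε⁻¹ ^ (s / 2 - 1) * ∫ x, Q x ^ (s / 2)) := by
    have hcalc : 8 * s ^ 2 * (ε * (4 * ∫ x, S x ^ 2)) ≤ (1/2) * ∫ x, ‖msum m h N x‖ ^ s := by
      calc 8 * s ^ 2 * (ε * (4 * ∫ x, S x ^ 2)) = (8 * s ^ 2 * ε) * 4 * ∫ x, S x ^ 2 := by ring
        _ ≤ _ := by rw [hεs]; linarith
    rw [mul_add] at hmain
    change _ ≤ 4 * ∫ x, ‖msum m h N x‖ ^ s at hdoob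
    linarith
  refine hI.trans ?_
  have hQI : 0 ≤ ∫ x, Q x ^ (s / 2) := integral_nonneg fun x => Real.rpow_nonneg (hQ0 x) _
  rw [← mul_assoc]
  refine mul_le_mul_of_nonneg_right ?_ hQI
  have e7 : ε⁻¹ = (16 * s) ^ 2 := by rw [hε, inv_inv]; ring
  calc 16 * s ^ 2 * ε⁻¹ ^ (s / 2 - 1) ≤ ε⁻¹ * ε⁻¹ ^ (s / 2 - 1) := by
        refine mul_le_mul_of_nonneg_right ?_ (by positivity)
        rw [e7]; nlinarith [sq_nonneg s]
    _ = ε⁻¹ ^ (s / 2) := by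
        rw [← Real.rpow_one_add' (by positivity) (by linarith)]; ring_nf
    _ = (16 * s) ^ s := by rw [e7, sq_rpow_half _ _ (by positivity)]

end BDG

section AvgComm

variable {X : Type*} [NormedAddCommGroup X] [MeasurableSpace X]
  {ν ν' : Measure ℝ} [IsProbabilityMeasure ν] [IsProbabilityMeasure ν'] {Φ Φ' : X → ℝ → X}

theorem avg_comm (h : NiceFam ν Φ) (h' : NiceFam ν' Φ')
    (hc : ∀ x u v, Φ' (Φ x u) v = Φ (Φ' x v) u) {f : X → ℝ} (hf : Nice f) :
    avg ν Φ (avg ν' Φ' f) = avg ν' Φ' (avg ν Φ f) := by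
  funext x
  obtain ⟨C, hC⟩ := hf.bdd
  have hm : Measurable fun q : ℝ × ℝ => Φ' (Φ x q.1) q.2 :=
    h'.meas.comp (((h.meas_right x).comp measurable_fst).prodMk measurable_snd)
  have hi : Integrable (Function.uncurry fun u v => f (Φ' (Φ x u) v)) (ν.prod ν') :=
    Integrable.of_bound (hf.meas.comp_measurable hm).aestronglyMeasurable C
      (Eventually.of_forall fun q => hC _)
  have := integral_integral_swap hi
  simpa only [avg, hc] using this

end AvgComm

section TwoDim

/-- Conditional expectation in the first variable. -/
def E1 (n : ℤ) (f : ℝ × ℝ → ℝ) : ℝ × ℝ → ℝ :=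
  avg unitMeas (fun p u => (cellpt n p.1 u, p.2)) f

/-- Conditional expectation in the second variable. -/
def E2 (n : ℤ) (f : ℝ × ℝ → ℝ) : ℝ × ℝ → ℝ :=
  avg unitMeas (fun p u => (p.1, cellpt n p.2 u)) f

theorem niceFam_E1 (n : ℤ) :
    NiceFam unitMeas (fun (p : ℝ × ℝ) u => (cellpt n p.1 u, p.2)) := by
  obtain ⟨D, hD⟩ := (niceFam_cellpt n).disp
  refine ⟨?_, max D 0, fun p => ?_⟩
  · exact ((measurable_cellpt n).comp ((measurable_fst.comp measurable_fst).prodMk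
      measurable_snd)).prodMk (measurable_snd.comp measurable_fst)
  · filter_upwards [hD p.1] with u hu
    rw [Prod.norm_def, Prod.norm_def]
    have h1 := le_max_left ‖cellpt n p.1 u‖ ‖p.2‖
    have h2 := le_max_right ‖cellpt n p.1 u‖ ‖p.2‖
    have h3 := le_max_left D 0
    have h4 := le_max_right D 0
    refine max_le ?_ ?_ <;> dsimp only <;> linarith

theorem niceFam_E2 (n : ℤ) :
    NiceFam unitMeas (fun (p : ℝ × ℝ) u => (p.1, cellpt n p.2 u)) := by
  obtain ⟨D, hD⟩ := (niceFam_cellpt n).disp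
  refine ⟨?_, max D 0, fun p => ?_⟩
  · have hk : Measurable fun q : (ℝ × ℝ) × ℝ => (q.1.2, q.2) :=
      (measurable_snd.comp measurable_fst).prodMk measurable_snd
    have h := (measurable_cellpt n).comp hk
    have h1 : Measurable fun q : (ℝ × ℝ) × ℝ => q.1.1 := measurable_fst.comp measurable_fst
    exact h1.prodMk h
  · filter_upwards [hD p.2] with u hu
    rw [Prod.norm_def, Prod.norm_def]
    have h1 := le_max_left ‖p.1‖ ‖cellpt n p.2 u‖
    have h2 := le_max_right ‖p.1‖ ‖cellpt n p.2 u‖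
    have h3 := le_max_left D 0
    have h4 := le_max_right D 0
    refine max_le ?_ ?_ <;> dsimp only <;> linarith

variable {f g : ℝ × ℝ → ℝ}

theorem E1_nice (n : ℤ) (hf : Nice f) : Nice (E1 n f) := avg_nice (niceFam_E1 n) hf
theorem E2_nice (n : ℤ) (hf : Nice f) : Nice (E2 n f) := avg_nice (niceFam_E2 n) hf

theorem E1_apply (n : ℤ) (f : ℝ × ℝ → ℝ) (x y : ℝ) :
    E1 n f (x, y) = cexp n (fun x => f (x, y)) x := rfl
theorem E2_apply (n : ℤ) (f : ℝ × ℝ → ℝ) (x y : ℝ) :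
    E2 n f (x, y) = cexp n (fun y => f (x, y)) y := rfl

theorem E1_E2_comm (m n : ℤ) (hf : Nice f) : E1 m (E2 n f) = E2 n (E1 m f) :=
  avg_comm (niceFam_E1 m) (niceFam_E2 n) (fun _ _ _ => rfl) hf

theorem E1_E1_of_le {m n : ℤ} (h : m ≤ n) (hf : Nice f) : E1 m (E1 n f) = E1 m f := by
  funext ⟨x, y⟩
  exact congrFun (cexp_cexp_of_le h (hf.fst_slice y)) x

theorem E2_E2_of_le {m n : ℤ} (h : m ≤ n) (hf : Nice f) : E2 m (E2 n f) = E2 m f := by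
  funext ⟨x, y⟩
  exact congrFun (cexp_cexp_of_le h (hf.snd_slice x)) y

theorem E1_E1_of_ge {m n : ℤ} (h : m ≤ n) (f : ℝ × ℝ → ℝ) : E1 n (E1 m f) = E1 m f := by
  funext ⟨x, y⟩
  exact congrFun (cexp_cexp_of_ge h fun x => f (x, y)) x

theorem E2_E2_of_ge {m n : ℤ} (h : m ≤ n) (f : ℝ × ℝ → ℝ) : E2 n (E2 m f) = E2 m f := by
  funext ⟨x, y⟩
  exact congrFun (cexp_cexp_of_ge h fun y => f (x, y)) y

theorem E1_comm (m n : ℤ) (hf : Nice f) : E1 m (E1 n f) = E1 n (E1 m f) := by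
  rcases le_total m n with h | h
  · rw [E1_E1_of_le h hf, E1_E1_of_ge h]
  · rw [E1_E1_of_le h hf, E1_E1_of_ge h]

theorem E2_comm (m n : ℤ) (hf : Nice f) : E2 m (E2 n f) = E2 n (E2 m f) := by
  rcases le_total m n with h | h
  · rw [E2_E2_of_le h hf, E2_E2_of_ge h]
  · rw [E2_E2_of_le h hf, E2_E2_of_ge h]

theorem integral_E1 (n : ℤ) (hf : Nice f) : ∫ p, E1 n f p = ∫ p, f p := by
  rw [(E1_nice n hf).integral_prod_symm, hf.integral_prod_symm]
  congr 1; funext y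
  exact integral_cexp n (hf.fst_slice y)

theorem integral_E2 (n : ℤ) (hf : Nice f) : ∫ p, E2 n f p = ∫ p, f p := by
  rw [(E2_nice n hf).integral_prod, hf.integral_prod]
  congr 1; funext x
  exact integral_cexp n (hf.snd_slice x)

theorem integral_E1_adjoint (n : ℤ) (hf : Nice f) (hg : Nice g) :
    ∫ p, g p * E1 n f p = ∫ p, E1 n g p * f p := by
  rw [(hg.mul (E1_nice n hf)).integral_prod_symm, ((E1_nice n hg).mul hf).integral_prod_symm]
  congr 1; funext y
  exact integral_cexp_adjoint n (hf.fst_slice y) (hg.fst_slice y)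

theorem integral_E2_adjoint (n : ℤ) (hf : Nice f) (hg : Nice g) :
    ∫ p, g p * E2 n f p = ∫ p, E2 n g p * f p := by
  rw [(hg.mul (E2_nice n hf)).integral_prod, ((E2_nice n hg).mul hf).integral_prod]
  congr 1; funext x
  exact integral_cexp_adjoint n (hf.snd_slice x) (hg.snd_slice x)

/-- Martingale difference in the first variable. -/
def D1 (n : ℤ) (f : ℝ × ℝ → ℝ) (p : ℝ × ℝ) : ℝ := E1 n f p - E1 (n - 1) f p

/-- Martingale difference in the second variable. -/
def D2 (n : ℤ) (f : ℝ × ℝ → ℝ) (p : ℝ × ℝ) : ℝ := E2 n f p - E2 (n - 1) f p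

theorem D1_apply (n : ℤ) (f : ℝ × ℝ → ℝ) (x y : ℝ) :
    D1 n f (x, y) = mdiff n (fun x => f (x, y)) x := rfl

theorem D1_nice (n : ℤ) (hf : Nice f) : Nice (D1 n f) := (E1_nice n hf).sub (E1_nice _ hf)
theorem D2_nice (n : ℤ) (hf : Nice f) : Nice (D2 n f) := (E2_nice n hf).sub (E2_nice _ hf)

theorem E1_sub (n : ℤ) (hf : Nice f) (hg : Nice g) :
    E1 n (fun p => f p - g p) = fun p => E1 n f p - E1 n g p :=
  funext fun p => avg_sub (niceFam_E1 n) hf hg p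

theorem E2_sub (n : ℤ) (hf : Nice f) (hg : Nice g) :
    E2 n (fun p => f p - g p) = fun p => E2 n f p - E2 n g p :=
  funext fun p => avg_sub (niceFam_E2 n) hf hg p

theorem E1_D1 (m n : ℤ) (hf : Nice f) : E1 m (D1 n f) = D1 n (E1 m f) := by
  change E1 m (fun p => E1 n f p - E1 (n - 1) f p) = _
  rw [E1_sub m (E1_nice _ hf) (E1_nice _ hf), E1_comm m n hf, E1_comm m (n - 1) hf]; rfl

theorem E2_D2 (m n : ℤ) (hf : Nice f) : E2 m (D2 n f) = D2 n (E2 m f) := by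
  change E2 m (fun p => E2 n f p - E2 (n - 1) f p) = _
  rw [E2_sub m (E2_nice _ hf) (E2_nice _ hf), E2_comm m n hf, E2_comm m (n - 1) hf]; rfl

theorem E2_D1 (m n : ℤ) (hf : Nice f) : E2 m (D1 n f) = D1 n (E2 m f) := by
  change E2 m (fun p => E1 n f p - E1 (n - 1) f p) = _
  rw [E2_sub m (E1_nice _ hf) (E1_nice _ hf), ← E1_E2_comm n m hf, ← E1_E2_comm (n - 1) m hf]; rfl

theorem E1_D2 (m n : ℤ) (hf : Nice f) : E1 m (D2 n f) = D2 n (E1 m f) := by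
  change E1 m (fun p => E2 n f p - E2 (n - 1) f p) = _
  rw [E1_sub m (E2_nice _ hf) (E2_nice _ hf), E1_E2_comm m n hf, E1_E2_comm m (n - 1) hf]; rfl

theorem D1_D2_comm (m n : ℤ) (hf : Nice f) : D1 m (D2 n f) = D2 n (D1 m f) := by
  funext p
  change E1 m (D2 n f) p - E1 (m - 1) (D2 n f) p = E2 n (D1 m f) p - E2 (n - 1) (D1 m f) p
  rw [E1_D2 _ _ hf, E1_D2 _ _ hf, E2_D1 _ _ hf, E2_D1 _ _ hf]
  simp only [D1, D2, E1_E2_comm _ _ hf]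
  ring

theorem D1_D1 (n : ℤ) (hf : Nice f) : D1 n (D1 n f) = D1 n f := by
  funext ⟨x, y⟩
  exact congrFun (mdiff_mdiff n (hf.fst_slice y)) x

theorem D2_D2 (n : ℤ) (hf : Nice f) : D2 n (D2 n f) = D2 n f := by
  funext ⟨x, y⟩
  exact congrFun (mdiff_mdiff n (hf.snd_slice x)) y

theorem integral_D1_adjoint (n : ℤ) (hf : Nice f) (hg : Nice g) :
    ∫ p, g p * D1 n f p = ∫ p, D1 n g p * f p := by
  simp only [D1, mul_sub, sub_mul]
  rw [integral_sub (hg.mul (E1_nice _ hf)).integrable (hg.mul (E1_nice _ hf)).integrable,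
    integral_sub ((E1_nice _ hg).mul hf).integrable ((E1_nice _ hg).mul hf).integrable,
    integral_E1_adjoint _ hf hg, integral_E1_adjoint _ hf hg]

theorem integral_D2_adjoint (n : ℤ) (hf : Nice f) (hg : Nice g) :
    ∫ p, g p * D2 n f p = ∫ p, D2 n g p * f p := by
  simp only [D2, mul_sub, sub_mul]
  rw [integral_sub (hg.mul (E2_nice _ hf)).integrable (hg.mul (E2_nice _ hf)).integrable,
    integral_sub ((E2_nice _ hg).mul hf).integrable ((E2_nice _ hg).mul hf).integrable,
    integral_E2_adjoint _ hf hg, integral_E2_adjoint _ hf hg]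

theorem E1_sub_telescope (m : ℤ) (N : ℕ) (f : ℝ × ℝ → ℝ) (p : ℝ × ℝ) :
    ∑ a ∈ Finset.range N, D1 (m + (a + 1)) f p = E1 (m + N) f p - E1 m f p := by
  induction N with
  | zero => simp
  | succ n ih =>
    rw [Finset.sum_range_succ, ih, D1]
    rw [show m + ((n : ℤ) + 1) - 1 = m + n by ring]
    push_cast; ring

theorem E2_sub_telescope (m : ℤ) (N : ℕ) (f : ℝ × ℝ → ℝ) (p : ℝ × ℝ) :
    ∑ a ∈ Finset.range N, D2 (m + (a + 1)) f p = E2 (m + N) f p - E2 m f p := by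
  induction N with
  | zero => simp
  | succ n ih =>
    rw [Finset.sum_range_succ, ih, D2]
    rw [show m + ((n : ℤ) + 1) - 1 = m + n by ring]
    push_cast; ring

theorem avg_coord {N : ℕ} {n : ℤ} {f : ℝ → EuclideanSpace ℝ (Fin N)} (hf : Nice f) (i : Fin N)
    (x : ℝ) : (cexp n f x) i = cexp n (fun x => f x i) x :=
  ((EuclideanSpace.proj i : EuclideanSpace ℝ (Fin N) →L[ℝ] ℝ).integral_comp_comm
    ((niceFam_cellpt n).integrable hf x)).symm

/-- Two-parameter square function estimate. -/
theorem bdg_two (m m' : ℤ) {h : ℕ → ℕ → ℝ × ℝ → ℝ} (hh : ∀ i l, Nice (h i l)) (N : ℕ) {s : ℝ}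
    (hs : 2 ≤ s) :
    ∫ p, |∑ i ∈ Finset.range N, ∑ l ∈ Finset.range N, D1 (m + i) (D2 (m' + l) (h i l)) p| ^ s ≤
      ((16 * s) ^ s) ^ 2 *
        ∫ p, (∑ i ∈ Finset.range N, ∑ l ∈ Finset.range N, (h i l p) ^ 2) ^ (s / 2) := by
  have hs0 : 0 < s := by linarith
  set φ : ℕ → ℝ × ℝ → ℝ := fun i p => ∑ l ∈ Finset.range N, D2 (m' + l) (h i l) p with hφ
  have hφn : ∀ i, Nice (φ i) := fun i => Nice.sum _ fun l _ => D2_nice _ (hh i l)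
  have e1 : ∀ p, ∑ i ∈ Finset.range N, ∑ l ∈ Finset.range N, D1 (m + i) (D2 (m' + l) (h i l)) p
      = ∑ i ∈ Finset.range N, D1 (m + i) (φ i) p := by
    intro p
    refine Finset.sum_congr rfl fun i _ => ?_
    simp only [D1, E1]
    rw [avg_sum (niceFam_E1 _) _ fun l _ => D2_nice _ (hh i l),
      avg_sum (niceFam_E1 _) _ fun l _ => D2_nice _ (hh i l), Finset.sum_sub_distrib]
  simp only [e1]
  have hFn : Nice fun p => |∑ i ∈ Finset.range N, D1 (m + i) (φ i) p| ^ s :=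
    (Nice.sum _ fun i _ => D1_nice _ (hφn i)).abs.rpow (fun _ => abs_nonneg _) hs0
  have hφs : Nice fun p => (∑ i ∈ Finset.range N, φ i p ^ 2) ^ (s / 2) :=
    (Nice.sum _ fun i _ => (hφn i).sq).rpow (fun _ => Finset.sum_nonneg fun i _ => sq_nonneg _)
      (by linarith)
  have hhs : Nice fun p =>
      (∑ i ∈ Finset.range N, ∑ l ∈ Finset.range N, (h i l p) ^ 2) ^ (s / 2) :=
    (Nice.sum _ fun i _ => Nice.sum _ fun l _ => (hh i l).sq).rpow
      (fun _ => Finset.sum_nonneg fun i _ => Finset.sum_nonneg fun l _ => sq_nonneg _)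
      (by linarith)
  have h1 : ∫ p, |∑ i ∈ Finset.range N, D1 (m + i) (φ i) p| ^ s ≤
      (16 * s) ^ s * ∫ p, (∑ i ∈ Finset.range N, φ i p ^ 2) ^ (s / 2) := by
    rw [hFn.integral_prod_symm, hφs.integral_prod_symm, ← integral_const_mul]
    refine integral_mono hFn.slice_integral_fst (hφs.slice_integral_fst.const_mul _) fun y => ?_
    have := bdg m (h := fun i x => φ i (x, y)) (fun i => (hφn i).fst_slice y) N hs
    simpa only [Real.norm_eq_abs, sq_abs, msum, D1_apply] using this
  have h2 : ∫ p, (∑ i ∈ Finset.range N, φ i p ^ 2) ^ (s / 2) ≤ (16 * s) ^ s *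
      ∫ p, (∑ i ∈ Finset.range N, ∑ l ∈ Finset.range N, (h i l p) ^ 2) ^ (s / 2) := by
    rw [hhs.integral_prod, hφs.integral_prod, ← integral_const_mul]
    refine integral_mono hφs.slice_integral_snd (hhs.slice_integral_snd.const_mul _) fun x => ?_
    let H : ℕ → ℝ → EuclideanSpace ℝ (Fin N) := fun l y =>
      ∑ i : Fin N, EuclideanSpace.single i (h i l (x, y))
    have hH : ∀ l, Nice (H l) := fun l => Nice.sum _ fun i _ => by
      have hs := (hh i l).snd_slice x
      have hc : Continuous fun c : ℝ => (EuclideanSpace.single i c : EuclideanSpace ℝ (Fin N)) := by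
        have e : (fun c : ℝ => (EuclideanSpace.single i c : EuclideanSpace ℝ (Fin N)))
            = fun c => c • EuclideanSpace.single i 1 := by
          funext c; ext j; simp
        rw [e]; fun_prop
      exact Nice.comp hs (fun c => (EuclideanSpace.single i c : EuclideanSpace ℝ (Fin N)))
        (by simp) (hc.comp_stronglyMeasurable hs.meas) fun C => ⟨C, fun v hv => by simpa using hv⟩
    have hHi : ∀ l y (i : Fin N), H l y i = h i l (x, y) := by
      intro l y i
      simp [H, Finset.sum_apply]
    have hHn : ∀ l y, ‖H l y‖ ^ 2 = ∑ i ∈ Finset.range N, h i l (x, y) ^ 2 := by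
      intro l y
      rw [EuclideanSpace.norm_sq_eq, ← Fin.sum_univ_eq_sum_range (fun i => h i l (x, y) ^ 2)]
      simp only [hHi, Real.norm_eq_abs, sq_abs]
    have hM : ∀ y, ‖msum m' H N y‖ ^ 2 = ∑ i ∈ Finset.range N, φ i (x, y) ^ 2 := by
      intro y
      rw [EuclideanSpace.norm_sq_eq, ← Fin.sum_univ_eq_sum_range (fun i => φ i (x, y) ^ 2)]
      refine Finset.sum_congr rfl fun i _ => ?_
      rw [Real.norm_eq_abs, sq_abs]
      congr 1
      simp only [msum, mdiff, φ, WithLp.ofLp_sum, Finset.sum_apply, PiLp.sub_apply,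
        avg_coord (hH _), hHi]
      rfl
    have := bdg m' hH N hs
    calc ∫ y, (∑ i ∈ Finset.range N, φ i (x, y) ^ 2) ^ (s / 2)
        = ∫ y, ‖msum m' H N y‖ ^ s := by
          congr 1; funext y
          rw [← hM, sq_rpow_half _ _ (norm_nonneg _)]
      _ ≤ _ := this
      _ = _ := by
          congr 2; funext y
          simp only [hHn]
          rw [Finset.sum_comm]
  calc _ ≤ _ := h1
    _ ≤ _ := mul_le_mul_of_nonneg_left h2 (by positivity)
    _ = _ := by ring

end TwoDim

section Oscillation

theorem continuousAt_of_lev {m : ℤ} {q : ℝ → ℝ} (hl : Lev m q) {z : ℝ}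
    (hz : ∀ k : ℤ, z ≠ (2:ℝ) ^ (-m) * k) : ContinuousAt q z := by
  have hk : ∀ k : ℤ, (2:ℝ) ^ m * z ≠ k := by
    intro k h
    apply hz k
    rw [← h, ← mul_assoc, ← zpow_add₀ two_ne_zero]; simp
  have h1 : (⌊(2:ℝ) ^ m * z⌋ : ℝ) < (2:ℝ) ^ m * z :=
    lt_of_le_of_ne (Int.floor_le _) (hk _).symm
  have h2 := Int.lt_floor_add_one ((2:ℝ) ^ m * z)
  have hc : ContinuousAt (fun w : ℝ => (2:ℝ) ^ m * w) z := by fun_prop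
  have he : q =ᶠ[𝓝 z] fun _ => q z := by
    filter_upwards [hc.eventually_lt_const h2, hc.eventually_const_lt h1] with w hw1 hw2
    apply hl
    rw [Int.floor_eq_iff]
    exact ⟨hw2.le, hw1⟩
  exact (continuousAt_const).congr he.symm

theorem Nice.intervalIntegrable {q : ℝ → ℝ} (hq : Nice q) (a b : ℝ) :
    IntervalIntegrable q volume a b := hq.integrable.intervalIntegrable

theorem primitive_grid {m : ℤ} {q : ℝ → ℝ} (hq : Nice q) (h0 : cexp m q = 0) (k : ℤ) :
    ∫ w in (0:ℝ)..(2:ℝ) ^ (-m) * k, q w = 0 := by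
  have hstep : ∀ k : ℤ, ∫ w in (2:ℝ) ^ (-m) * k..(2:ℝ) ^ (-m) * (k + 1), q w = 0 := by
    intro k
    have := cexp_eq_interval m hq ((2:ℝ) ^ (-m) * k)
    have hf : ⌊(2:ℝ) ^ m * ((2:ℝ) ^ (-m) * k)⌋ = k := by
      rw [← mul_assoc, ← zpow_add₀ two_ne_zero]; simp
    rw [hf, h0, Pi.zero_apply] at this
    exact ((smul_eq_zero.1 this.symm).resolve_left (by positivity))
  induction k using Int.induction_on with
  | zero => simp
  | succ i ih =>
    rw [← intervalIntegral.integral_add_adjacent_intervals (hq.intervalIntegrable _ _)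
      (hq.intervalIntegrable _ _), ih, zero_add]
    have := hstep i
    push_cast at this ⊢
    exact this
  | pred i ih =>
    have h := hstep (-i - 1)
    have h2 := intervalIntegral.integral_add_adjacent_intervals
      (hq.intervalIntegrable 0 ((2:ℝ) ^ (-m) * ((-i - 1 : ℤ) : ℝ)))
      (hq.intervalIntegrable _ ((2:ℝ) ^ (-m) * (((-i - 1 : ℤ) : ℝ) + 1)))
    rw [h, add_zero] at h2
    rw [h2]
    convert ih using 3
    push_cast; ring

theorem primitive_le {m : ℤ} {q : ℝ → ℝ} (hq : Nice q) (h0 : cexp m q = 0) (z : ℝ) :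
    |∫ w in (0:ℝ)..z, q w| ≤ (2:ℝ) ^ (-m) * cexp m (fun w => |q w|) z := by
  rw [cexp_eq_interval m hq.abs z, smul_eq_mul, ← mul_assoc, ← zpow_add₀ two_ne_zero,
    neg_add_cancel, zpow_zero, one_mul]
  set k := ⌊(2:ℝ) ^ m * z⌋
  have hz : z = (2:ℝ) ^ (-m) * ((2:ℝ) ^ m * z) := by
    rw [← mul_assoc, ← zpow_add₀ two_ne_zero]; simp
  have h1 : (2:ℝ) ^ (-m) * k ≤ z := by
    conv_rhs => rw [hz]
    exact mul_le_mul_of_nonneg_left (Int.floor_le _) (by positivity)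
  have h2 : z ≤ (2:ℝ) ^ (-m) * (k + 1) := by
    conv_lhs => rw [hz]
    exact mul_le_mul_of_nonneg_left (Int.lt_floor_add_one _).le (by positivity)
  rw [← intervalIntegral.integral_add_adjacent_intervals
    (hq.intervalIntegrable 0 ((2:ℝ) ^ (-m) * k)) (hq.intervalIntegrable _ z),
    primitive_grid hq h0, zero_add]
  refine (intervalIntegral.abs_integral_le_integral_abs h1).trans ?_
  have e := intervalIntegral.integral_add_adjacent_intervals
    (hq.abs.intervalIntegrable ((2:ℝ) ^ (-m) * k) z)
    (hq.abs.intervalIntegrable z ((2:ℝ) ^ (-m) * (k + 1)))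
  have := intervalIntegral.integral_nonneg (μ := volume) h2 fun w _ => abs_nonneg (q w)
  linarith

/-- Integration by parts against a step function with vanishing means. -/
theorem abs_integral_oscillation_le {m : ℤ} {q : ℝ → ℝ} (hq : Nice q) (hl : Lev m q) (h0 : cexp (m - 1) q = 0)
    {a b : ℝ} (hab : a ≤ b) {v v1 W W1 : ℝ → ℝ} {μ κ : ℝ} (hμ : μ ≠ 0) (y : ℝ)
    (hv : ∀ t ∈ Icc a b, HasDerivAt v (v1 t) t) (hv1 : ContinuousOn v1 (Icc a b))
    (hv0 : ∀ t ∈ Icc a b, v1 t ≠ 0)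
    (hW : ∀ t ∈ Icc a b, HasDerivAt W (W1 t) t) (hW1 : ContinuousOn W1 (Icc a b))
    (hWk : ∀ t ∈ Icc a b, |W t| ≤ κ) (hW1k : ∀ t ∈ Icc a b, |W1 t| ≤ κ) :
    |∫ t in a..b, W t * v1 t * q (y + μ * v t)| ≤
      κ * (2:ℝ) ^ (-(m - 1)) / |μ| * (cexp (m - 1) (fun w => |q w|) (y + μ * v b) +
        cexp (m - 1) (fun w => |q w|) (y + μ * v a) +
        ∫ t in a..b, cexp (m - 1) (fun w => |q w|) (y + μ * v t)) := by
  set U := cexp (m - 1) (fun w => |q w|) with hU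
  set F : ℝ → ℝ := fun z => ∫ w in (0:ℝ)..z, q w with hF
  set ℓ := (2:ℝ) ^ (-(m - 1)) with hℓ
  have hUn : Nice U := cexp_nice _ hq.abs
  have hU0 : ∀ z, 0 ≤ U z := fun z => avg_nonneg (fun _ => abs_nonneg _) z
  have hFb : ∀ z, |F z| ≤ ℓ * U z := primitive_le hq h0
  have hFc : Continuous F := intervalIntegral.continuous_primitive hq.intervalIntegrable 0
  have hvc : ContinuousOn v (Icc a b) := fun t ht => (hv t ht).continuousAt.continuousWithinAt
  have hWc : ContinuousOn W (Icc a b) := fun t ht => (hW t ht).continuousAt.continuousWithinAt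
  have hyv : ContinuousOn (fun t => y + μ * v t) (Icc a b) := by fun_prop
  have hFv : ContinuousOn (fun t => F (y + μ * v t)) (Icc a b) := hFc.comp_continuousOn hyv
  have hinj : InjOn v (Icc a b) := by
    have key : ∀ s ∈ Icc a b, ∀ t ∈ Icc a b, s < t → v s ≠ v t := by
      intro s hs t ht hst hE
      have hsub : Icc s t ⊆ Icc a b := Icc_subset_Icc hs.1 ht.2
      obtain ⟨c, hc, hc0⟩ := exists_hasDerivAt_eq_zero hst (hvc.mono hsub) hE
        (fun x hx => hv x (hsub (Ioo_subset_Icc_self hx)))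
      exact hv0 c (hsub (Ioo_subset_Icc_self hc)) hc0
    intro s hs t ht hE
    rcases lt_trichotomy s t with h | h | h
    · exact absurd hE (key s hs t ht h)
    · exact h
    · exact absurd hE.symm (key t ht s hs h)
  set S : Set ℝ := {t ∈ Icc a b | ∃ k : ℤ, y + μ * v t = (2:ℝ) ^ (-m) * k} with hS
  have hSc : S.Countable := by
    have hg : (range fun k : ℤ => ((2:ℝ) ^ (-m) * k - y) / μ).Countable := countable_range _
    refine MapsTo.countable_of_injOn (f := v) (t := range fun k : ℤ => ((2:ℝ) ^ (-m) * k - y) / μ)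
      ?_ (hinj.mono fun t ht => ht.1) hg
    rintro t ⟨_, k, hk⟩
    exact ⟨k, by simp only [← hk]; field_simp; ring⟩
  -- integrability
  have hmeasv : AEStronglyMeasurable (fun t => q (y + μ * v t)) (volume.restrict (Icc a b)) :=
    (hq.meas.measurable.comp_aemeasurable
      (hyv.aemeasurable measurableSet_Icc)).aestronglyMeasurable
  obtain ⟨Cq, hCq⟩ := hq.bdd
  obtain ⟨CU, hCU⟩ := hUn.bdd
  have hqI : IntegrableOn (fun t => q (y + μ * v t)) (Icc a b) := by
    refine Integrable.of_bound hmeasv Cq (Eventually.of_forall fun t => hCq _)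
  have hUI : IntegrableOn (fun t => U (y + μ * v t)) (Icc a b) := by
    refine Integrable.of_bound (hUn.meas.measurable.comp_aemeasurable
      (hyv.aemeasurable measurableSet_Icc)).aestronglyMeasurable CU
      (Eventually.of_forall fun t => hCU _)
  have hWvq : IntegrableOn (fun t => W t * v1 t * q (y + μ * v t)) (Icc a b) :=
    hqI.continuousOn_mul (hWc.mul hv1) isCompact_Icc
  have hWF : IntegrableOn (fun t => W1 t * F (y + μ * v t)) (Icc a b) :=
    (hW1.mul hFv).integrableOn_Icc
  have toI : ∀ {g : ℝ → ℝ}, IntegrableOn g (Icc a b) → IntervalIntegrable g volume a b :=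
    fun h => (intervalIntegrable_iff_integrableOn_Icc_of_le hab).2 h
  have hparts := MeasureTheory.integral_eq_of_hasDerivAt_off_countable_of_le
    (fun t => W t * F (y + μ * v t))
    (fun t => W1 t * F (y + μ * v t) + μ * (W t * v1 t * q (y + μ * v t))) hab hSc
    (hWc.mul hFv) (by
      rintro t ⟨ht, htS⟩
      have ht' := Ioo_subset_Icc_self ht
      have hq' : HasDerivAt F (q (y + μ * v t)) (y + μ * v t) :=
        intervalIntegral.integral_hasDerivAt_right (hq.intervalIntegrable _ _)
          hq.meas.stronglyMeasurableAtFilter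
          (continuousAt_of_lev hl fun k hk => htS ⟨ht', k, hk⟩)
      have h1 : HasDerivAt (fun t => y + μ * v t) (μ * v1 t) t :=
        ((hv t ht').const_mul μ).const_add y
      have h3 : HasDerivAt (fun t => F (y + μ * v t)) (q (y + μ * v t) * (μ * v1 t)) t :=
        HasDerivAt.comp (h := fun t => y + μ * v t) (h₂ := F) t hq' h1
      have h2 : HasDerivAt (fun t => W t * F (y + μ * v t))
          (W1 t * F (y + μ * v t) + W t * (q (y + μ * v t) * (μ * v1 t))) t :=
        (hW t ht').mul h3
      exact h2.congr_deriv (by ring))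
    ((toI hWF).add ((toI hWvq).const_mul μ))
  rw [intervalIntegral.integral_add (toI hWF) ((toI hWvq).const_mul μ),
    intervalIntegral.integral_const_mul] at hparts
  have hκ : 0 ≤ κ := (abs_nonneg _).trans (hWk a (left_mem_Icc.2 hab))
  have bnd : ∀ t ∈ Icc a b, |W t * F (y + μ * v t)| ≤ κ * ℓ * U (y + μ * v t) := by
    intro t ht
    rw [abs_mul, mul_assoc]
    exact mul_le_mul (hWk t ht) (hFb _) (abs_nonneg _) hκ
  have bnd2 : |∫ t in a..b, W1 t * F (y + μ * v t)| ≤ κ * ℓ * ∫ t in a..b, U (y + μ * v t) := by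
    refine (intervalIntegral.abs_integral_le_integral_abs hab).trans ?_
    rw [← intervalIntegral.integral_const_mul]
    refine intervalIntegral.integral_mono_on hab (toI hWF).abs ((toI hUI).const_mul _) ?_
    intro t ht
    rw [abs_mul, mul_assoc]
    exact mul_le_mul (hW1k t ht) (hFb _) (abs_nonneg _) hκ
  have hmul : |μ| * |∫ t in a..b, W t * v1 t * q (y + μ * v t)| ≤
      κ * ℓ * (U (y + μ * v b) + U (y + μ * v a) + ∫ t in a..b, U (y + μ * v t)) := by
    rw [← abs_mul]
    have e : μ * ∫ t in a..b, W t * v1 t * q (y + μ * v t) =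
        W b * F (y + μ * v b) - W a * F (y + μ * v a) - ∫ t in a..b, W1 t * F (y + μ * v t) := by
      linarith
    rw [e]
    have h1 := bnd b (right_mem_Icc.2 hab)
    have h2 := bnd a (left_mem_Icc.2 hab)
    have h3 := abs_sub (W b * F (y + μ * v b) - W a * F (y + μ * v a))
      (∫ t in a..b, W1 t * F (y + μ * v t))
    have h4 := abs_sub (W b * F (y + μ * v b)) (W a * F (y + μ * v a))
    nlinarith
  have hμ' : 0 < |μ| := abs_pos.2 hμ
  rw [div_mul_eq_mul_div, le_div_iff₀ hμ', mul_comm]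
  exact hmul

end Oscillation

section Decay

/-- Smooth phases with strictly monotone derivative, together with a smooth amplitude. -/
structure PhaseAmp (α β M m₀ : ℝ) (φ φ1 φ2 ψ ψ1 : ℝ → ℝ) : Prop where
  lt : α < β
  dφ : ∀ t ∈ Icc α β, HasDerivAt φ (φ1 t) t
  dφ1 : ∀ t ∈ Icc α β, HasDerivAt φ1 (φ2 t) t
  dψ : ∀ t ∈ Icc α β, HasDerivAt ψ (ψ1 t) t
  cφ2 : ContinuousOn φ2 (Icc α β)
  cψ1 : ContinuousOn ψ1 (Icc α β)
  bφ : ∀ t ∈ Icc α β, |φ t| ≤ M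
  bφ2 : ∀ t ∈ Icc α β, |φ2 t| ≤ M
  bψ : ∀ t ∈ Icc α β, |ψ t| ≤ M
  bψ1 : ∀ t ∈ Icc α β, |ψ1 t| ≤ M
  pos : 0 < m₀
  sep : ∀ t ∈ Icc α β, ∀ s ∈ Icc α β, m₀ * |t - s| ≤ |φ1 t - φ1 s|
  mφ : Measurable φ
  mψ : Measurable ψ

variable {α β M m₀ : ℝ} {φ φ1 φ2 ψ ψ1 : ℝ → ℝ}

theorem Nice.mul_shift {Ψ : ℝ → ℝ} (hΨ : Nice Ψ) {f g : ℝ × ℝ → ℝ} (hf : Nice f)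
    (hg : Nice g) {γ : ℝ → ℝ × ℝ} (hγ : Measurable γ) :
    Nice (fun z : (ℝ × ℝ) × ℝ => f z.1 * (Ψ z.2 * g (z.1 + γ z.2))) := by
  obtain ⟨C, hC⟩ := hf.bdd
  obtain ⟨D, hD⟩ := hg.bdd
  obtain ⟨E, hE⟩ := hΨ.bdd
  obtain ⟨R, hR⟩ := hf.supp
  obtain ⟨S, hS⟩ := hΨ.supp
  refine ⟨?_, ⟨C * (E * D), fun z => ?_⟩, ⟨Max.max R S, fun z hz => ?_⟩⟩
  · refine Measurable.stronglyMeasurable ?_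
    exact (hf.meas.measurable.comp measurable_fst).mul
      ((hΨ.meas.measurable.comp measurable_snd).mul
      (hg.meas.measurable.comp (measurable_fst.add (hγ.comp measurable_snd))))
  · rw [norm_mul, norm_mul]
    have hC0 := (norm_nonneg _).trans (hC 0)
    have hE0 := (norm_nonneg _).trans (hE 0)
    gcongr
    · exact hC _
    · exact hE _
    · exact hD _
  · have hz : R < ‖z.1‖ ∨ S < ‖z.2‖ := by
      by_contra! h
      exact absurd hz (not_lt.2 (max_le (h.1.trans (le_max_left _ _))
        (h.2.trans (le_max_right _ _))))
    rcases hz with h | h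
    · simp [hR _ h]
    · simp [hS _ h]

theorem integrable_mul_shift {Ψ : ℝ → ℝ} (hΨ : Nice Ψ) {f g : ℝ × ℝ → ℝ} (hf : Nice f)
    (hg : Nice g) {γ : ℝ → ℝ × ℝ} (hγ : Measurable γ) :
    Integrable fun p => f p * ∫ t, Ψ t * g (p + γ t) := by
  have hi := (hΨ.mul_shift hf hg hγ).integrable (μ := (volume : Measure ((ℝ × ℝ) × ℝ)))
  rw [Measure.volume_eq_prod] at hi
  simpa only [integral_const_mul] using hi.integral_prod_left

theorem integral_mul_shift_swap {Ψ : ℝ → ℝ} (hΨ : Nice Ψ) {f g : ℝ × ℝ → ℝ} (hf : Nice f)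
    (hg : Nice g) {γ : ℝ → ℝ × ℝ} (hγ : Measurable γ) :
    ∫ p, f p * ∫ t, Ψ t * g (p + γ t) = ∫ t, Ψ t * ∫ p, f p * g (p + γ t) := by
  have hi := (hΨ.mul_shift hf hg hγ).integrable (μ := (volume : Measure ((ℝ × ℝ) × ℝ)))
  rw [Measure.volume_eq_prod] at hi
  calc ∫ p, f p * ∫ t, Ψ t * g (p + γ t) = ∫ p, ∫ t, f p * (Ψ t * g (p + γ t)) := by
        simp only [integral_const_mul]
    _ = ∫ t, ∫ p, f p * (Ψ t * g (p + γ t)) := integral_integral_swap hi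
    _ = _ := by
        congr 1; funext t
        rw [← integral_const_mul]
        congr 1; funext p; ring

theorem abs_integral_mul_shift_le {f g : ℝ × ℝ → ℝ} (hf : Nice f) (hg : Nice g) (c : ℝ × ℝ) :
    |∫ p, f p * g (p + c)| ≤ ((∫ p, f p ^ 2) + ∫ p, g p ^ 2) / 2 := by
  have hgs : Integrable (fun p => g (p + c) ^ 2) := hg.sq.integrable.comp_add_right c
  have e : ∫ p, g (p + c) ^ 2 = ∫ p, g p ^ 2 := integral_add_right_eq_self (μ := volume) (fun p : ℝ × ℝ => g p ^ 2) c
  rw [← e, ← integral_add hf.sq.integrable hgs, ← integral_div]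
  refine norm_integral_le_of_norm_le (μ := volume) (f := fun p : ℝ × ℝ => f p * g (p + c))
    ((hf.sq.integrable.add hgs).div_const 2)
    (Eventually.of_forall fun p => ?_)
  rw [Real.norm_eq_abs, abs_le]
  constructor <;> nlinarith [sq_nonneg (f p + g (p + c)), sq_nonneg (f p - g (p + c))]

theorem PhaseAmp.amplitude_bounds (h : PhaseAmp α β M m₀ φ φ1 φ2 ψ ψ1) {ρ : ℝ} (hρ : ρ ≠ 0)
    (hρδ : |ρ| ≤ β - α) {t : ℝ} (ht : t ∈ Icc α β) (ht' : t + ρ ∈ Icc α β) :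
    φ1 (t + ρ) - φ1 t ≠ 0 ∧
    |ψ (t + ρ) * ψ t / (φ1 (t + ρ) - φ1 t)| ≤
      (2 * M ^ 2 * (β - α) / m₀ + 2 * M ^ 3 / m₀ ^ 2) / ρ ^ 2 ∧
    |((ψ1 (t + ρ) * ψ t + ψ (t + ρ) * ψ1 t) * (φ1 (t + ρ) - φ1 t) -
      ψ (t + ρ) * ψ t * (φ2 (t + ρ) - φ2 t)) / (φ1 (t + ρ) - φ1 t) ^ 2| ≤
      (2 * M ^ 2 * (β - α) / m₀ + 2 * M ^ 3 / m₀ ^ 2) / ρ ^ 2 := by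
  have hm := h.pos
  have hs := h.sep _ ht' _ ht
  rw [add_sub_cancel_left] at hs
  set Δ := φ1 (t + ρ) - φ1 t with hΔ
  have hρ0 : 0 < |ρ| := abs_pos.2 hρ
  have hlow : 0 < m₀ * |ρ| := by positivity
  have hΔ0 : 0 < |Δ| := hlow.trans_le hs
  have hΔne : Δ ≠ 0 := abs_pos.1 hΔ0
  have hM : 0 ≤ M := (abs_nonneg _).trans (h.bψ t ht)
  have e2 : ρ ^ 2 = |ρ| ^ 2 := (sq_abs ρ).symm
  have hδ : 0 < β - α := hρ0.trans_le hρδ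
  have p1 : |ψ (t + ρ) * ψ t| ≤ M ^ 2 := by
    rw [abs_mul, pow_two]
    exact mul_le_mul (h.bψ _ ht') (h.bψ _ ht) (abs_nonneg _) hM
  have p2 : |ψ1 (t + ρ) * ψ t + ψ (t + ρ) * ψ1 t| ≤ 2 * M ^ 2 := by
    refine (abs_add_le _ _).trans ?_
    rw [abs_mul, abs_mul]
    have := mul_le_mul (h.bψ1 _ ht') (h.bψ _ ht) (abs_nonneg _) hM
    have := mul_le_mul (h.bψ _ ht') (h.bψ1 _ ht) (abs_nonneg _) hM
    nlinarith
  have p3 : |φ2 (t + ρ) - φ2 t| ≤ 2 * M := by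
    refine (abs_sub _ _).trans ?_
    have := h.bφ2 _ ht'
    have := h.bφ2 _ ht
    linarith
  have q1 : 1 / |Δ| ≤ (β - α) / m₀ / ρ ^ 2 := by
    rw [e2, div_div, div_le_div_iff₀ hΔ0 (by positivity), one_mul]
    calc m₀ * |ρ| ^ 2 = (m₀ * |ρ|) * |ρ| := by ring
      _ ≤ |Δ| * (β - α) := by gcongr
      _ = _ := by ring
  have q2 : 1 / |Δ| ^ 2 ≤ 1 / m₀ ^ 2 / ρ ^ 2 := by
    rw [e2, div_div, ← mul_pow]
    gcongr
  refine ⟨hΔne, ?_, ?_⟩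
  · rw [abs_div, div_eq_mul_one_div]
    calc |ψ (t + ρ) * ψ t| * (1 / |Δ|) ≤ M ^ 2 * ((β - α) / m₀ / ρ ^ 2) := by gcongr
      _ = (M ^ 2 * (β - α) / m₀) / ρ ^ 2 := by ring
      _ ≤ _ := by
        gcongr
        have : 0 ≤ M ^ 2 * (β - α) / m₀ := by positivity
        have : 0 ≤ 2 * M ^ 3 / m₀ ^ 2 := by positivity
        have : 2 * M ^ 2 * (β - α) / m₀ = 2 * (M ^ 2 * (β - α) / m₀) := by ring
        linarith
  · have e : ((ψ1 (t + ρ) * ψ t + ψ (t + ρ) * ψ1 t) * Δ -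
      ψ (t + ρ) * ψ t * (φ2 (t + ρ) - φ2 t)) / Δ ^ 2 =
      (ψ1 (t + ρ) * ψ t + ψ (t + ρ) * ψ1 t) / Δ -
      ψ (t + ρ) * ψ t * (φ2 (t + ρ) - φ2 t) / Δ ^ 2 := by
      field_simp
    rw [e]
    refine (abs_sub _ _).trans ?_
    rw [abs_div, abs_div, abs_mul (ψ (t + ρ) * ψ t), abs_pow, div_eq_mul_one_div,
      div_eq_mul_one_div (|ψ (t + ρ) * ψ t| * _)]
    calc _ ≤ 2 * M ^ 2 * ((β - α) / m₀ / ρ ^ 2) + M ^ 2 * (2 * M) * (1 / m₀ ^ 2 / ρ ^ 2) := by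
          gcongr
      _ = _ := by ring

theorem PhaseAmp.abs_integral_piece_le (h : PhaseAmp α β M m₀ φ φ1 φ2 ψ ψ1) {ρ : ℝ} (hρ : ρ ≠ 0)
    (hρδ : |ρ| ≤ β - α) {m : ℤ} {q : ℝ → ℝ} (hq : Nice q) (hl : Lev m q)
    (h0 : cexp (m - 1) q = 0) {μ : ℝ} (hμ : μ ≠ 0) (y : ℝ) {a b : ℝ} (hab : a ≤ b)
    (hsub : ∀ t ∈ Icc a b, t ∈ Icc α β ∧ t + ρ ∈ Icc α β) :
    |∫ t in a..b, ψ t * ψ (t + ρ) * q (y + μ * (φ t - φ (t + ρ)))| ≤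
      (2 * M ^ 2 * (β - α) / m₀ + 2 * M ^ 3 / m₀ ^ 2) / ρ ^ 2 * (2:ℝ) ^ (-(m - 1)) / |μ| *
      (cexp (m - 1) (fun w => |q w|) (y + μ * (φ b - φ (b + ρ))) +
        cexp (m - 1) (fun w => |q w|) (y + μ * (φ a - φ (a + ρ))) +
        ∫ t in a..b, cexp (m - 1) (fun w => |q w|) (y + μ * (φ t - φ (t + ρ)))) := by
  have shift : ∀ {F F' : ℝ → ℝ} (_ : ∀ t ∈ Icc α β, HasDerivAt F (F' t) t),
      ∀ t ∈ Icc a b, HasDerivAt (fun t => F (t + ρ)) (F' (t + ρ)) t :=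
    fun hF t ht => (hF _ (hsub t ht).2).comp_add_const t ρ
  have hφ1c : ContinuousOn φ1 (Icc α β) := fun t ht => (h.dφ1 t ht).continuousAt.continuousWithinAt
  have hψc : ContinuousOn ψ (Icc α β) := fun t ht => (h.dψ t ht).continuousAt.continuousWithinAt
  have c1 : ∀ {F : ℝ → ℝ}, ContinuousOn F (Icc α β) → ContinuousOn F (Icc a b) :=
    fun hF => hF.mono fun t ht => (hsub t ht).1
  have c2 : ∀ {F : ℝ → ℝ}, ContinuousOn F (Icc α β) → ContinuousOn (fun t => F (t + ρ)) (Icc a b) :=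
    fun hF => hF.comp (by fun_prop) fun t ht => (hsub t ht).2
  have hne : ∀ t ∈ Icc a b, φ1 (t + ρ) - φ1 t ≠ 0 := fun t ht =>
    (h.amplitude_bounds hρ hρδ (hsub t ht).1 (hsub t ht).2).1
  have key := abs_integral_oscillation_le hq hl h0 hab (μ := -μ) (by simpa using hμ) y
    (v := fun t => φ (t + ρ) - φ t) (v1 := fun t => φ1 (t + ρ) - φ1 t)
    (W := fun t => ψ (t + ρ) * ψ t / (φ1 (t + ρ) - φ1 t))
    (W1 := fun t => ((ψ1 (t + ρ) * ψ t + ψ (t + ρ) * ψ1 t) * (φ1 (t + ρ) - φ1 t) -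
      ψ (t + ρ) * ψ t * (φ2 (t + ρ) - φ2 t)) / (φ1 (t + ρ) - φ1 t) ^ 2)
    (fun t ht => (shift h.dφ t ht).sub (h.dφ t (hsub t ht).1))
    ((c2 hφ1c).sub (c1 hφ1c)) hne
    (fun t ht => ((shift h.dψ t ht).mul (h.dψ t (hsub t ht).1)).div
      ((shift h.dφ1 t ht).sub (h.dφ1 t (hsub t ht).1)) (hne t ht))
    ((((((c2 h.cψ1).mul (c1 hψc)).add ((c2 hψc).mul (c1 h.cψ1))).mul ((c2 hφ1c).sub (c1 hφ1c))).sub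
      (((c2 hψc).mul (c1 hψc)).mul ((c2 h.cφ2).sub (c1 h.cφ2)))).div
      (((c2 hφ1c).sub (c1 hφ1c)).pow 2) fun t ht => pow_ne_zero 2 (hne t ht))
    (fun t ht => (h.amplitude_bounds hρ hρδ (hsub t ht).1 (hsub t ht).2).2.1)
    (fun t ht => (h.amplitude_bounds hρ hρδ (hsub t ht).1 (hsub t ht).2).2.2)
  have e : ∀ t, y + -μ * (φ (t + ρ) - φ t) = y + μ * (φ t - φ (t + ρ)) := fun t => by ring
  simp only [e, abs_neg] at key
  have e2 : ∫ t in a..b, ψ t * ψ (t + ρ) * q (y + μ * (φ t - φ (t + ρ))) =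
      ∫ t in a..b, ψ (t + ρ) * ψ t / (φ1 (t + ρ) - φ1 t) * (φ1 (t + ρ) - φ1 t) *
        q (y + μ * (φ t - φ (t + ρ))) := by
    refine intervalIntegral.integral_congr fun t ht => ?_
    rw [uIcc_of_le hab] at ht
    rw [div_mul_cancel₀ _ (hne t ht), mul_comm (ψ t)]
  rw [e2]
  exact key

end Decay

section Decay2

variable {α β M m₀ : ℝ} {φ φ1 φ2 ψ ψ1 : ℝ → ℝ}

theorem nice_indicator_of_bound {a b C : ℝ} {g : ℝ → ℝ} (hg : Measurable g)
    (hb : ∀ t ∈ Icc a b, |g t| ≤ C) : Nice ((Icc a b).indicator g) := by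
  refine ⟨(hg.indicator measurableSet_Icc).stronglyMeasurable, ⟨|C|, fun t => ?_⟩,
    ⟨max |a| |b|, fun t ht => ?_⟩⟩
  · by_cases h : t ∈ Icc a b
    · rw [indicator_of_mem h]; exact (hb t h).trans (le_abs_self C)
    · rw [indicator_of_notMem h]; simp
  · refine indicator_of_notMem (fun h => ?_) _
    exact absurd ht (not_lt.2 (abs_le_max_abs_abs h.1 h.2))

theorem integral_indicator_Icc_mul {a b : ℝ} (hab : a ≤ b) (g k : ℝ → ℝ) :
    ∫ t, (Icc a b).indicator g t * k t = ∫ t in a..b, g t * k t := by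
  rw [intervalIntegral.integral_of_le hab, ← integral_Icc_eq_integral_Ioc,
    ← integral_indicator measurableSet_Icc]
  congr 1; funext t
  by_cases h : t ∈ Icc a b <;> simp [h]

theorem E2_abs_sq_le (m : ℤ) {f : ℝ × ℝ → ℝ} (hf : Nice f) :
    ∫ p, E2 m (fun p => |f p|) p ^ 2 ≤ ∫ p, f p ^ 2 := by
  have e : ∫ p, f p ^ 2 = ∫ p, E2 m (fun p => |f p| ^ 2) p := by
    rw [integral_E2 m hf.abs.sq]; simp only [sq_abs]
  rw [e]
  exact integral_mono (E2_nice m hf.abs).sq.integrable (E2_nice m hf.abs.sq).integrable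
    fun p => avg_sq_le (niceFam_E2 m) hf.abs p

theorem PhaseAmp.far_bound (h : PhaseAmp α β M m₀ φ φ1 φ2 ψ ψ1) {ρ : ℝ} (hρ : ρ ≠ 0)
    (hρδ : |ρ| ≤ β - α) {m : ℤ} {f : ℝ × ℝ → ℝ} (hf : Nice f) (hl : ∀ x, Lev m fun y => f (x, y))
    (h0 : ∀ x, cexp (m - 1) (fun y => f (x, y)) = 0) (lam : ℝ) {μ : ℝ} (hμ : μ ≠ 0) :
    |∫ t, ((Icc α β).indicator ψ t * (Icc α β).indicator ψ (t + ρ)) *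
        ∫ p, f p * f (p + (-(lam * ρ), μ * (φ t - φ (t + ρ))))| ≤
      (2 * M ^ 2 * (β - α) / m₀ + 2 * M ^ 3 / m₀ ^ 2) / ρ ^ 2 * (2:ℝ) ^ (-(m - 1)) / |μ| *
      ((2 + (β - α)) * ∫ p, f p ^ 2) := by
  obtain ⟨hρ1, hρ2⟩ := abs_le.1 hρδ
  have hαβ := h.lt
  set a := max α (α - ρ) with ha
  set b := min β (β - ρ) with hb
  have hab : a ≤ b := by
    refine max_le (le_min ?_ ?_) (le_min ?_ ?_) <;> linarith
  have hba : b - a ≤ β - α := by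
    have := le_max_left α (α - ρ); have := min_le_left β (β - ρ); linarith
  have hmem : ∀ t, t ∈ Icc a b ↔ t ∈ Icc α β ∧ t + ρ ∈ Icc α β := by
    intro t
    simp only [mem_Icc, ha, hb, max_le_iff, le_min_iff]
    constructor
    · rintro ⟨⟨h1, h2⟩, h3, h4⟩
      refine ⟨⟨h1, h3⟩, ?_, ?_⟩ <;> linarith
    · rintro ⟨⟨h1, h2⟩, h3, h4⟩
      refine ⟨⟨h1, ?_⟩, h2, ?_⟩ <;> linarith
  have hsub : ∀ t ∈ Icc a b, t ∈ Icc α β ∧ t + ρ ∈ Icc α β := fun t ht => (hmem t).1 ht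
  have hΘe : ∀ t, (Icc α β).indicator ψ t * (Icc α β).indicator ψ (t + ρ) =
      (Icc a b).indicator (fun t => ψ t * ψ (t + ρ)) t := by
    intro t
    by_cases h1 : t ∈ Icc α β
    · by_cases h2 : t + ρ ∈ Icc α β
      · rw [indicator_of_mem h1, indicator_of_mem h2, indicator_of_mem ((hmem t).2 ⟨h1, h2⟩)]
      · rw [indicator_of_notMem h2, indicator_of_notMem fun h3 => h2 ((hmem t).1 h3).2, mul_zero]
    · rw [indicator_of_notMem h1, indicator_of_notMem fun h3 => h1 ((hmem t).1 h3).1, zero_mul]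
  have hshift : Measurable fun t : ℝ => t + ρ := by fun_prop
  have hmφ := h.mφ
  have hmψ := h.mψ
  have hΘ : Nice ((Icc a b).indicator (fun t => ψ t * ψ (t + ρ))) := by
    refine nice_indicator_of_bound (C := M * M) (hmψ.mul (hmψ.comp hshift)) fun t ht => ?_
    have := h.bψ t (hsub t ht).1
    rw [abs_mul]
    exact mul_le_mul this (h.bψ _ (hsub t ht).2) (abs_nonneg _) ((abs_nonneg _).trans this)
  have hΘ1 : Nice ((Icc a b).indicator (fun _ => (1:ℝ))) :=
    nice_indicator_of_bound (C := 1) measurable_const fun t ht => by simp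
  set c : ℝ → ℝ × ℝ := fun t => (-(lam * ρ), μ * (φ t - φ (t + ρ))) with hc
  have hcm : Measurable c :=
    measurable_const.prodMk (measurable_const.mul (hmφ.sub (hmφ.comp hshift)))
  simp only [hΘe]
  rw [← integral_mul_shift_swap hΘ hf hf hcm]
  set U := E2 (m - 1) (fun p => |f p|) with hU
  have hUn : Nice U := E2_nice _ hf.abs
  set K := (2 * M ^ 2 * (β - α) / m₀ + 2 * M ^ 3 / m₀ ^ 2) / ρ ^ 2 * (2:ℝ) ^ (-(m - 1)) / |μ| with hK
  have hM : 0 ≤ M := (abs_nonneg _).trans (h.bψ α (left_mem_Icc.2 hαβ.le))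
  have hK0 : 0 ≤ K := by
    have := h.pos
    have : 0 ≤ β - α := by linarith
    positivity
  have hJ : ∀ p, |∫ t, (Icc a b).indicator (fun t => ψ t * ψ (t + ρ)) t * f (p + c t)| ≤
      K * (U (p + c b) + U (p + c a) + ∫ t, (Icc a b).indicator (fun _ => (1:ℝ)) t * U (p + c t)) := by
    rintro ⟨x, y⟩
    have := h.abs_integral_piece_le hρ hρδ (hf.snd_slice (x + -(lam * ρ))) (hl _) (h0 _) hμ y hab hsub
    rw [integral_indicator_Icc_mul hab, integral_indicator_Icc_mul hab]
    simp only [one_mul]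
    exact this
  set S := ∫ p, f p ^ 2 with hS
  have hUS : ∫ p, U p ^ 2 ≤ S := E2_abs_sq_le _ hf
  have hfa : ∫ p, |f p| ^ 2 = S := by simp only [sq_abs, hS]
  have hpt : ∀ d : ℝ × ℝ, ∫ p, |f p| * U (p + d) ≤ S := by
    intro d
    have := (le_abs_self _).trans (abs_integral_mul_shift_le hf.abs hUn d)
    linarith
  have hIpt : ∀ d : ℝ × ℝ, Integrable fun p => |f p| * U (p + d) := by
    intro d
    obtain ⟨C, hC⟩ := hUn.bdd
    exact (hf.abs.mul_bdd (hUn.meas.comp_measurable (measurable_id.add_const d))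
      ⟨C, fun x => hC _⟩).integrable
  have hI3 := integrable_mul_shift hΘ1 hf.abs hUn hcm
  have h3 : ∫ p, |f p| * ∫ t, (Icc a b).indicator (fun _ => (1:ℝ)) t * U (p + c t) ≤
      (β - α) * S := by
    rw [integral_mul_shift_swap hΘ1 hf.abs hUn hcm, integral_indicator_Icc_mul hab]
    simp only [one_mul]
    have hS0 : 0 ≤ S := integral_nonneg fun p => sq_nonneg _
    refine (le_abs_self _).trans ((intervalIntegral.norm_integral_le_of_norm_le_const
      (f := fun t => ∫ p, |f p| * U (p + c t)) (C := S) fun t _ => ?_).trans ?_)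
    · refine (abs_integral_mul_shift_le hf.abs hUn (c t)).trans ?_
      linarith
    · rw [abs_of_nonneg (by linarith), mul_comm]
      gcongr
  have hI12 : Integrable fun p => |f p| * U (p + c b) + |f p| * U (p + c a) :=
    (hIpt _).add (hIpt _)
  calc |∫ p, f p * ∫ t, (Icc a b).indicator (fun t => ψ t * ψ (t + ρ)) t * f (p + c t)|
      ≤ ∫ p, K * (|f p| * U (p + c b) + |f p| * U (p + c a) +
        |f p| * ∫ t, (Icc a b).indicator (fun _ => (1:ℝ)) t * U (p + c t)) := by
        refine norm_integral_le_of_norm_le (μ := volume)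
          (f := fun p => f p * ∫ t, (Icc a b).indicator (fun t => ψ t * ψ (t + ρ)) t * f (p + c t))
          ((((hIpt _).add (hIpt _)).add hI3).const_mul K) (Eventually.of_forall fun p => ?_)
        rw [norm_mul]
        refine (mul_le_mul_of_nonneg_left (hJ p) (norm_nonneg _)).trans_eq ?_
        rw [Real.norm_eq_abs]; ring
    _ = K * ((∫ p, |f p| * U (p + c b)) + (∫ p, |f p| * U (p + c a)) +
        ∫ p, |f p| * ∫ t, (Icc a b).indicator (fun _ => (1:ℝ)) t * U (p + c t)) := by
        rw [integral_const_mul, integral_add hI12 hI3,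
          integral_add (hIpt _) (hIpt _)]
    _ ≤ K * ((2 + (β - α)) * S) := by
        have := hpt (c a); have := hpt (c b)
        gcongr
        linarith

theorem nice_sq_expand {Ψ : ℝ → ℝ} (hΨ : Nice Ψ) {f : ℝ × ℝ → ℝ} (hf : Nice f)
    {γ : ℝ → ℝ × ℝ} (hγ : Measurable γ) {D : ℝ} (hD : ∀ t, Ψ t ≠ 0 → ‖γ t‖ ≤ D) :
    Nice (fun z : (ℝ × ℝ) × (ℝ × ℝ) => (Ψ z.2.1 * Ψ (z.2.1 + z.2.2)) *
      (f (z.1 - γ z.2.1) * f (z.1 - γ (z.2.1 + z.2.2)))) := by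
  obtain ⟨C, hC⟩ := hf.bdd
  obtain ⟨E, hE⟩ := hΨ.bdd
  obtain ⟨R, hR⟩ := hf.supp
  obtain ⟨S, hS⟩ := hΨ.supp
  have hC0 := (norm_nonneg _).trans (hC 0)
  have hE0 := (norm_nonneg _).trans (hE 0)
  refine ⟨?_, ⟨(E * E) * (C * C), fun z => ?_⟩, ⟨Max.max (R + D) (2 * S), fun z hz => ?_⟩⟩
  · have m1 : Measurable fun z : (ℝ × ℝ) × (ℝ × ℝ) => z.2.1 := measurable_fst.comp measurable_snd
    have m2 : Measurable fun z : (ℝ × ℝ) × (ℝ × ℝ) => z.2.1 + z.2.2 :=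
      m1.add (measurable_snd.comp measurable_snd)
    refine Measurable.stronglyMeasurable ?_
    exact ((hΨ.meas.measurable.comp m1).mul (hΨ.meas.measurable.comp m2)).mul
      ((hf.meas.measurable.comp (measurable_fst.sub (hγ.comp m1))).mul
      (hf.meas.measurable.comp (measurable_fst.sub (hγ.comp m2))))
  · rw [norm_mul, norm_mul, norm_mul]
    gcongr <;> first | exact hE _ | exact hC _
  · by_contra hne
    have h1 : Ψ z.2.1 ≠ 0 := fun h => hne (by simp [h])
    have h2 : Ψ (z.2.1 + z.2.2) ≠ 0 := fun h => hne (by simp [h])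
    have h3 : f (z.1 - γ z.2.1) ≠ 0 := fun h => hne (by simp [h])
    have b1 : ‖z.2.1‖ ≤ S := not_lt.1 fun h => h1 (hS _ h)
    have b2 : ‖z.2.1 + z.2.2‖ ≤ S := not_lt.1 fun h => h2 (hS _ h)
    have b3 : ‖z.1 - γ z.2.1‖ ≤ R := not_lt.1 fun h => h3 (hR _ h)
    have b4 : ‖z.1‖ ≤ R + D := by
      have := norm_add_le (z.1 - γ z.2.1) (γ z.2.1)
      rw [sub_add_cancel] at this
      linarith [hD _ h1]
    have b5 : ‖z.2.2‖ ≤ 2 * S := by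
      have := norm_sub_le (z.2.1 + z.2.2) z.2.1
      rw [add_sub_cancel_left] at this
      linarith
    have b6 : ‖z.2.1‖ ≤ 2 * S := by linarith [norm_nonneg z.2.1]
    refine absurd hz (not_lt.2 (max_le (b4.trans (le_max_left _ _)) ((max_le b6 b5).trans
      (le_max_right _ _))))

theorem integral_sq_expand {Ψ : ℝ → ℝ} (hΨ : Nice Ψ) {f : ℝ × ℝ → ℝ} (hf : Nice f)
    {γ : ℝ → ℝ × ℝ} (hγ : Measurable γ) {D : ℝ} (hD : ∀ t, Ψ t ≠ 0 → ‖γ t‖ ≤ D) :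
    ∫ p, (∫ t, Ψ t * f (p - γ t)) ^ 2 = ∫ ρ, ∫ t, (Ψ t * Ψ (t + ρ)) *
      ∫ p, f p * f (p + (γ t - γ (t + ρ))) := by
  have hK := nice_sq_expand hΨ hf hγ hD
  have hi := hK.integrable (μ := (volume : Measure ((ℝ × ℝ) × (ℝ × ℝ))))
  rw [Measure.volume_eq_prod] at hi
  have hi2 := hi.integral_prod_right
  rw [Measure.volume_eq_prod] at hi2
  have hslice : ∀ p : ℝ × ℝ, Integrable (fun w : ℝ × ℝ => (Ψ w.1 * Ψ (w.1 + w.2)) *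
      (f (p - γ w.1) * f (p - γ (w.1 + w.2)))) := by
    intro p
    obtain ⟨C, hC⟩ := hK.bdd
    obtain ⟨R, hR⟩ := hK.supp
    exact (Nice.mk (hK.meas.comp_measurable measurable_prodMk_left) ⟨C, fun w => hC (p, w)⟩
      ⟨R, fun w hw => hR (p, w) (hw.trans_le (le_max_right _ _))⟩ :
      Nice fun w : ℝ × ℝ => _).integrable
  calc ∫ p, (∫ t, Ψ t * f (p - γ t)) ^ 2
      = ∫ p, ∫ w : ℝ × ℝ, (Ψ w.1 * Ψ (w.1 + w.2)) *
        (f (p - γ w.1) * f (p - γ (w.1 + w.2))) := by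
        refine integral_congr_ae (Eventually.of_forall fun p => ?_)
        have := hslice p
        rw [Measure.volume_eq_prod] at this
        simp only
        rw [Measure.volume_eq_prod ℝ ℝ, integral_prod _ this, pow_two, ← integral_mul_const]
        refine integral_congr_ae (Eventually.of_forall fun t => ?_)
        simp only
        rw [← integral_add_left_eq_self (μ := volume) (fun s => Ψ s * f (p - γ s)) t,
          ← integral_const_mul]
        refine integral_congr_ae (Eventually.of_forall fun ρ => ?_)
        simp only
        ring
    _ = ∫ w : ℝ × ℝ, ∫ p, (Ψ w.1 * Ψ (w.1 + w.2)) *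
        (f (p - γ w.1) * f (p - γ (w.1 + w.2))) := integral_integral_swap hi
    _ = ∫ ρ, ∫ t, ∫ p, (Ψ t * Ψ (t + ρ)) * (f (p - γ t) * f (p - γ (t + ρ))) := by
        rw [Measure.volume_eq_prod ℝ ℝ]
        exact integral_prod_symm _ hi2
    _ = _ := by
        refine integral_congr_ae (Eventually.of_forall fun ρ =>
          integral_congr_ae (Eventually.of_forall fun t => ?_))
        simp only
        rw [integral_const_mul, ← integral_sub_right_eq_self (μ := volume)
          (fun p => f p * f (p + (γ t - γ (t + ρ)))) (γ t)]
        congr 2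
        funext p
        congr 2
        abel

/-- Decay of averages over curves on functions oscillating in the second variable. -/
theorem PhaseAmp.decay (h : PhaseAmp α β M m₀ φ φ1 φ2 ψ ψ1) : ∃ C : ℝ, 0 ≤ C ∧
    ∀ {m : ℤ} {f : ℝ × ℝ → ℝ}, Nice f → (∀ x, Lev m fun y => f (x, y)) →
    (∀ x, cexp (m - 1) (fun y => f (x, y)) = 0) → ∀ (lam : ℝ) {μ : ℝ}, μ ≠ 0 →
    ∫ p : ℝ × ℝ, (∫ t, (Icc α β).indicator ψ t * f (p - (lam * t, μ * φ t))) ^ 2 ≤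
      C * ((2:ℝ) ^ (-m) / |μ|) ^ (1 / 3 : ℝ) * ∫ p, f p ^ 2 := by
  have hαβ := h.lt
  have hm := h.pos
  have hM : 0 ≤ M := (abs_nonneg _).trans (h.bψ α (left_mem_Icc.2 hαβ.le))
  set δ := β - α with hδ
  have hδ0 : 0 < δ := by linarith
  set Q := 2 * M ^ 2 * δ / m₀ + 2 * M ^ 3 / m₀ ^ 2 with hQ
  have hQ0 : 0 ≤ Q := by positivity
  refine ⟨2 * (M ^ 2 * δ) + 2 * δ * (2 * Q * (2 + δ)), by positivity, ?_⟩
  intro m f hf hl h0 lam μ hμ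
  set Ψ := (Icc α β).indicator ψ with hΨdef
  have hΨ : Nice Ψ := nice_indicator_of_bound h.mψ h.bψ
  set γ : ℝ → ℝ × ℝ := fun t => (lam * t, μ * φ t) with hγdef
  have hγ : Measurable γ :=
    (measurable_const.mul measurable_id).prodMk (measurable_const.mul h.mφ)
  have hD : ∀ t, Ψ t ≠ 0 → ‖γ t‖ ≤ Max.max (|lam| * Max.max |α| |β|) (|μ| * M) := by
    intro t ht
    have ht' : t ∈ Icc α β := by
      by_contra hc; exact ht (indicator_of_notMem hc _)
    refine max_le_max ?_ ?_
    · rw [Real.norm_eq_abs, abs_mul]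
      exact mul_le_mul_of_nonneg_left (abs_le_max_abs_abs ht'.1 ht'.2) (abs_nonneg _)
    · rw [Real.norm_eq_abs, abs_mul]
      exact mul_le_mul_of_nonneg_left (h.bφ t ht') (abs_nonneg _)
  rw [integral_sq_expand hΨ hf hγ hD]
  set S := ∫ p, f p ^ 2 with hS
  have hS0 : 0 ≤ S := integral_nonneg fun p => sq_nonneg _
  have hμ0 : 0 < |μ| := abs_pos.2 hμ
  set θ := (2:ℝ) ^ (-m) / |μ| with hθ
  have hθ0 : 0 < θ := by positivity
  set η := θ ^ (1 / 3 : ℝ) with hη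
  have hη0 : 0 < η := Real.rpow_pos_of_pos hθ0 _
  have hη3 : η ^ 3 = θ := by
    rw [hη, ← Real.rpow_natCast, ← Real.rpow_mul hθ0.le]; norm_num
  have hγe : ∀ t ρ, γ t - γ (t + ρ) = (-(lam * ρ), μ * (φ t - φ (t + ρ))) := by
    intro t ρ
    simp only [hγdef, Prod.mk_sub_mk, Prod.mk.injEq]
    constructor <;> ring
  simp only [hγe]
  set H : ℝ → ℝ := fun ρ => ∫ t, (Ψ t * Ψ (t + ρ)) *
    ∫ p, f p * f (p + (-(lam * ρ), μ * (φ t - φ (t + ρ)))) with hH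
  have hΨb : ∀ t, |Ψ t| ≤ M := by
    intro t
    by_cases ht : t ∈ Icc α β
    · simp only [hΨdef, indicator_of_mem ht]; exact h.bψ t ht
    · simp only [hΨdef, indicator_of_notMem ht, abs_zero]; exact hM
  have hnear : ∀ ρ, |H ρ| ≤ M ^ 2 * δ * S := by
    intro ρ
    have hint : Integrable ((Icc α β).indicator fun _ => M ^ 2 * S) :=
      (integrable_indicator_iff measurableSet_Icc).2 (integrableOn_const (by simp))
    refine (norm_integral_le_of_norm_le (f := fun t => (Ψ t * Ψ (t + ρ)) *
      ∫ p, f p * f (p + (-(lam * ρ), μ * (φ t - φ (t + ρ))))) hint (Eventually.of_forall fun t => ?_)).trans_eq ?_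
    · by_cases ht : t ∈ Icc α β
      · rw [indicator_of_mem ht, norm_mul, norm_mul, pow_two]
        have h2 := abs_integral_mul_shift_le hf hf (-(lam * ρ), μ * (φ t - φ (t + ρ)))
        have h1 := mul_le_mul (hΨb t) (hΨb (t + ρ)) (abs_nonneg _) hM
        refine mul_le_mul h1 (h2.trans_eq (by ring)) (abs_nonneg _) (by positivity)
      · have : Ψ t = 0 := indicator_of_notMem ht _
        rw [indicator_of_notMem ht, this]; simp
    · rw [integral_indicator measurableSet_Icc]
      simp only [integral_const, MeasurableSet.univ, measureReal_restrict_apply, univ_inter,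
        Real.volume_real_Icc_of_le hαβ.le, smul_eq_mul]
      ring
  have hzero : ∀ ρ, δ < |ρ| → H ρ = 0 := by
    intro ρ hρ
    refine integral_eq_zero_of_ae (Eventually.of_forall fun t => ?_)
    have : Ψ t * Ψ (t + ρ) = 0 := by
      by_contra hne
      have h1 : t ∈ Icc α β := by
        by_contra hc; exact hne (by simp only [hΨdef, indicator_of_notMem hc, zero_mul])
      have h2 : t + ρ ∈ Icc α β := by
        by_contra hc; exact hne (by simp only [hΨdef, indicator_of_notMem hc, mul_zero])
      have : |ρ| ≤ δ := abs_le.2 ⟨by linarith [h1.2, h2.1], by linarith [h1.1, h2.2]⟩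
      linarith
    simp only [this, zero_mul, Pi.zero_apply]
  have hfar : ∀ ρ, η < |ρ| → |ρ| ≤ δ → |H ρ| ≤ 2 * Q * (2 + δ) * η * S := by
    intro ρ hρ hρδ
    have hρ0 : ρ ≠ 0 := abs_pos.1 (hη0.trans hρ)
    refine (h.far_bound hρ0 hρδ hf hl h0 lam hμ).trans ?_
    have e1 : (2:ℝ) ^ (-(m - 1)) = 2 * 2 ^ (-m) := by
      rw [show -(m - 1) = 1 + -m by ring, zpow_add₀ two_ne_zero, zpow_one]
    have e2 : Q / ρ ^ 2 * (2:ℝ) ^ (-(m - 1)) / |μ| = 2 * Q * θ / |ρ| ^ 2 := by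
      rw [e1, hθ, sq_abs]; ring
    rw [e2]
    have e3 : 2 * Q * θ / |ρ| ^ 2 ≤ 2 * Q * η := by
      rw [div_le_iff₀ (pow_pos (abs_pos.2 hρ0) 2), ← hη3]
      calc 2 * Q * η ^ 3 = 2 * Q * η * η ^ 2 := by ring
        _ ≤ 2 * Q * η * |ρ| ^ 2 := by gcongr
    calc _ ≤ 2 * Q * η * ((2 + δ) * S) := by gcongr
      _ = _ := by ring
  have hi1 : Integrable ((Icc (-η) η).indicator fun _ => M ^ 2 * δ * S) :=
    (integrable_indicator_iff measurableSet_Icc).2 (integrableOn_const (by simp))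
  have hi2 : Integrable ((Icc (-δ) δ).indicator fun _ => 2 * Q * (2 + δ) * η * S) :=
    (integrable_indicator_iff measurableSet_Icc).2 (integrableOn_const (by simp))
  refine (le_abs_self _).trans ((norm_integral_le_of_norm_le (f := H) (hi1.add hi2)
    (Eventually.of_forall fun ρ => ?_)).trans_eq ?_)
  · have n1 : 0 ≤ (Icc (-η) η).indicator (fun _ => M ^ 2 * δ * S) ρ :=
      indicator_nonneg (fun _ _ => by positivity) _
    have n2 : 0 ≤ (Icc (-δ) δ).indicator (fun _ => 2 * Q * (2 + δ) * η * S) ρ :=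
      indicator_nonneg (fun _ _ => by positivity) _
    rw [Pi.add_apply, Real.norm_eq_abs]
    by_cases c1 : |ρ| ≤ η
    · rw [indicator_of_mem (show ρ ∈ Icc (-η) η from abs_le.1 c1)]
      linarith [hnear ρ]
    · by_cases c2 : |ρ| ≤ δ
      · rw [indicator_of_mem (show ρ ∈ Icc (-δ) δ from abs_le.1 c2)]
        linarith [hfar ρ (not_le.1 c1) c2]
      · rw [hzero ρ (not_le.1 c2), abs_zero]
        linarith
  · simp only [Pi.add_apply]
    rw [integral_add hi1 hi2, integral_indicator measurableSet_Icc,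
      integral_indicator measurableSet_Icc]
    simp only [integral_const, MeasurableSet.univ, measureReal_restrict_apply, univ_inter,
      Real.volume_real_Icc_of_le (show -η ≤ η by linarith),
      Real.volume_real_Icc_of_le (show -δ ≤ δ by linarith), smul_eq_mul]
    ring

end Decay2

section CurveAverage

theorem exists_phaseAmp_rpow {α β c : ℝ} (d w : ℝ) (hα : 0 < α) (hαβ : α < β) (hc : c ≠ 0)
    (hc1 : c ≠ 1) : ∃ (M m₀ : ℝ) (φ1 φ2 ψ1 : ℝ → ℝ),
    PhaseAmp α β M m₀ (fun t => t ^ c) φ1 φ2 (fun t => w * t ^ d) ψ1 := by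
  have hpos : ∀ t ∈ Icc α β, 0 < t := fun t ht => hα.trans_le ht.1
  have hcont : ∀ e : ℝ, ContinuousOn (fun t : ℝ => t ^ e) (Icc α β) := fun e t ht =>
    (Real.continuousAt_rpow_const t e (Or.inl (hpos t ht).ne')).continuousWithinAt
  have hder : ∀ e : ℝ, ∀ t ∈ Icc α β, HasDerivAt (fun t : ℝ => t ^ e) (e * t ^ (e - 1)) t :=
    fun e t ht => Real.hasDerivAt_rpow_const (Or.inl (hpos t ht).ne')
  set φ2 : ℝ → ℝ := fun t => c * ((c - 1) * t ^ (c - 1 - 1)) with hφ2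
  have cφ2 : ContinuousOn φ2 (Icc α β) := (((hcont _).const_mul _).const_mul _)
  have cψ : ContinuousOn (fun t : ℝ => w * t ^ d) (Icc α β) := (hcont _).const_mul _
  have cψ1 : ContinuousOn (fun t : ℝ => w * (d * t ^ (d - 1))) (Icc α β) :=
    ((hcont _).const_mul _).const_mul _
  obtain ⟨M1, h1⟩ := isCompact_Icc.exists_bound_of_continuousOn (hcont c)
  obtain ⟨M2, h2⟩ := isCompact_Icc.exists_bound_of_continuousOn cφ2
  obtain ⟨M3, h3⟩ := isCompact_Icc.exists_bound_of_continuousOn cψ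
  obtain ⟨M4, h4⟩ := isCompact_Icc.exists_bound_of_continuousOn cψ1
  obtain ⟨t₀, ht₀, hmin⟩ := isCompact_Icc.exists_isMinOn (nonempty_Icc.2 hαβ.le) cφ2.abs
  have hM := le_max_left (max M1 M2) (max M3 M4)
  have hM' := le_max_right (max M1 M2) (max M3 M4)
  have hm : 0 < |φ2 t₀| := abs_pos.2 (mul_ne_zero hc (mul_ne_zero (sub_ne_zero.2 hc1)
    (Real.rpow_pos_of_pos (hpos _ ht₀) _).ne'))
  have dφ1 : ∀ t ∈ Icc α β, HasDerivAt (fun t => c * t ^ (c - 1)) (φ2 t) t :=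
    fun t ht => (hder (c - 1) t ht).const_mul c
  refine ⟨max (max M1 M2) (max M3 M4), |φ2 t₀|, fun t => c * t ^ (c - 1), φ2,
    fun t => w * (d * t ^ (d - 1)), hαβ, hder c, dφ1, fun t ht => (hder d t ht).const_mul w, cφ2,
    cψ1, fun t ht => ((h1 t ht).trans (le_max_left _ _)).trans hM,
    fun t ht => ((h2 t ht).trans (le_max_right _ _)).trans hM,
    fun t ht => ((h3 t ht).trans (le_max_left _ _)).trans hM',
    fun t ht => ((h4 t ht).trans (le_max_right _ _)).trans hM', hm, ?_, by fun_prop, by fun_prop⟩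
  have key : ∀ t ∈ Icc α β, ∀ s ∈ Icc α β, s < t →
      |φ2 t₀| * |t - s| ≤ |c * t ^ (c - 1) - c * s ^ (c - 1)| := by
    intro t ht s hs hst
    have hsub : Icc s t ⊆ Icc α β := Icc_subset_Icc hs.1 ht.2
    obtain ⟨x, hx, hx'⟩ := exists_hasDerivAt_eq_slope (fun t => c * t ^ (c - 1)) φ2 hst
      (((hcont _).const_mul _).mono hsub) fun y hy => dφ1 y (hsub (Ioo_subset_Icc_self hy))
    have : c * t ^ (c - 1) - c * s ^ (c - 1) = φ2 x * (t - s) := by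
      rw [hx', div_mul_cancel₀ _ (by linarith : t - s ≠ 0)]
    rw [this, abs_mul (φ2 x)]
    exact mul_le_mul_of_nonneg_right (isMinOn_iff.1 hmin x (hsub (Ioo_subset_Icc_self hx)))
      (abs_nonneg _)
  intro t ht s hs
  rcases lt_trichotomy s t with h | h | h
  · exact key t ht s hs h
  · simp [h]
  · rw [abs_sub_comm t, abs_sub_comm (c * t ^ (c - 1))]
    exact key s hs t ht h

/-- Normalized Lebesgue measure on `[1/2, 2]`. -/
def cmeas : Measure ℝ := ENNReal.ofReal (2 / 3) • volume.restrict (Icc (1 / 2) 2)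

instance : IsProbabilityMeasure cmeas := ⟨by
  rw [cmeas, Measure.smul_apply, Measure.restrict_apply_univ, Real.volume_Icc, smul_eq_mul,
    ← ENNReal.ofReal_mul (by norm_num)]
  norm_num⟩

theorem cmeas_ae : ∀ᵐ t ∂cmeas, t ∈ Icc (1 / 2 : ℝ) 2 :=
  Measure.ae_smul_measure (ae_restrict_mem measurableSet_Icc) _

/-- The average of `f` over the curve `p - (lam t, mu t ^ b)`, `1/2 ≤ t ≤ 2`. -/
def cavg (b lam mu : ℝ) (f : ℝ × ℝ → ℝ) : ℝ × ℝ → ℝ :=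
  avg cmeas (fun p t => p - (lam * t, mu * t ^ b)) f

variable {b : ℝ}

theorem niceFam_cavg (hb : 0 ≤ b) (lam mu : ℝ) :
    NiceFam cmeas (fun (p : ℝ × ℝ) t => p - (lam * t, mu * t ^ b)) := by
  refine ⟨?_, max (|lam| * 2) (|mu| * 2 ^ b), fun p => ?_⟩
  · refine measurable_fst.sub (Measurable.prodMk ?_ ?_)
    · exact measurable_const.mul measurable_snd
    · exact measurable_const.mul (measurable_snd.pow_const b)
  · filter_upwards [cmeas_ae] with t ht
    have h0 : 0 ≤ t := by linarith [ht.1]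
    have h1 : ‖(lam * t, mu * t ^ b)‖ ≤ max (|lam| * 2) (|mu| * 2 ^ b) := by
      refine max_le_max ?_ ?_
      · rw [Real.norm_eq_abs, abs_mul, abs_of_nonneg h0]
        exact mul_le_mul_of_nonneg_left ht.2 (abs_nonneg _)
      · rw [Real.norm_eq_abs, abs_mul, abs_of_nonneg (Real.rpow_nonneg h0 b)]
        exact mul_le_mul_of_nonneg_left (Real.rpow_le_rpow h0 ht.2 hb) (abs_nonneg _)
    have := norm_add_le (p - (lam * t, mu * t ^ b)) (lam * t, mu * t ^ b)
    rw [sub_add_cancel] at this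
    linarith

theorem cavg_nice (hb : 0 ≤ b) (lam mu : ℝ) {f : ℝ × ℝ → ℝ} (hf : Nice f) :
    Nice (cavg b lam mu f) := avg_nice (niceFam_cavg hb lam mu) hf

theorem cavg_eq (lam mu : ℝ) (f : ℝ × ℝ → ℝ) (p : ℝ × ℝ) : cavg b lam mu f p =
    2 / 3 * ∫ t in Icc (1 / 2 : ℝ) 2, f (p - (lam * t, mu * t ^ b)) := by
  rw [cavg, avg, cmeas, integral_smul_measure, ENNReal.toReal_ofReal (by norm_num), smul_eq_mul]

theorem integral_indicator_mul' {s : Set ℝ} (hs : MeasurableSet s) (g k : ℝ → ℝ) :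
    ∫ t, s.indicator g t * k t = ∫ t in s, g t * k t := by
  rw [← integral_indicator hs]
  congr 1; funext t
  by_cases h : t ∈ s <;> simp [h]

theorem cavg_decay_snd (hb : 1 < b) : ∃ C : ℝ, 0 ≤ C ∧
    ∀ {m : ℤ} {f : ℝ × ℝ → ℝ}, Nice f → (∀ x, Lev m fun y => f (x, y)) →
    (∀ x, cexp (m - 1) (fun y => f (x, y)) = 0) → ∀ (lam : ℝ) {mu : ℝ}, mu ≠ 0 →
    ∫ p, cavg b lam mu f p ^ 2 ≤ C * ((2:ℝ) ^ (-m) / |mu|) ^ (1 / 3 : ℝ) * ∫ p, f p ^ 2 := by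
  obtain ⟨M, m₀, φ1, φ2, ψ1, h⟩ := exists_phaseAmp_rpow (α := 1 / 2) (β := 2) (c := b) 0 1
    (by norm_num) (by norm_num) (by linarith) hb.ne'
  obtain ⟨C, hC, H⟩ := h.decay
  refine ⟨(2 / 3) ^ 2 * C, by positivity, fun {m f} hf hl h0 lam mu hmu => ?_⟩
  have := H hf hl h0 lam hmu
  simp only [integral_indicator_mul' measurableSet_Icc, Real.rpow_zero, mul_one, one_mul] at this
  simp only [cavg_eq, mul_pow]
  rw [integral_const_mul, mul_assoc ((2 / 3 : ℝ) ^ 2), mul_assoc ((2 / 3 : ℝ) ^ 2)]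
  exact mul_le_mul_of_nonneg_left this (by positivity)

theorem integral_Icc_rpow_inv (hb : 1 < b) (g : ℝ → ℝ) :
    ∫ t in Icc (1 / 2 : ℝ) 2, g t =
    ∫ σ in Icc ((1 / 2 : ℝ) ^ b) (2 ^ b), b⁻¹ * σ ^ (b⁻¹ - 1) * g (σ ^ b⁻¹) := by
  have hb0 : 0 < b := by linarith
  have hpos : ∀ σ ∈ Icc ((1 / 2 : ℝ) ^ b) (2 ^ b), 0 < σ := fun σ h =>
    (Real.rpow_pos_of_pos (by norm_num) b).trans_le h.1
  have himg : (fun σ : ℝ => σ ^ b⁻¹) '' Icc ((1 / 2 : ℝ) ^ b) (2 ^ b) = Icc (1 / 2) 2 := by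
    ext t
    constructor
    · rintro ⟨σ, hσ, rfl⟩
      have h0 := (hpos σ hσ).le
      constructor
      · have := Real.rpow_le_rpow (by positivity) hσ.1 (inv_pos.2 hb0).le
        rwa [Real.rpow_rpow_inv (by norm_num) hb0.ne'] at this
      · have := Real.rpow_le_rpow h0 hσ.2 (inv_pos.2 hb0).le
        rwa [Real.rpow_rpow_inv (by norm_num) hb0.ne'] at this
    · intro ht
      have h0 : 0 ≤ t := by linarith [ht.1]
      exact ⟨t ^ b, ⟨Real.rpow_le_rpow (by norm_num) ht.1 hb0.le, Real.rpow_le_rpow h0 ht.2 hb0.le⟩,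
        Real.rpow_rpow_inv h0 hb0.ne'⟩
  rw [← himg, integral_image_eq_integral_abs_deriv_smul measurableSet_Icc
    (f' := fun σ => b⁻¹ * σ ^ (b⁻¹ - 1))
    (fun σ hσ => (Real.hasDerivAt_rpow_const (Or.inl (hpos σ hσ).ne')).hasDerivWithinAt)
    (fun σ hσ τ hτ he => (Real.rpow_left_inj (hpos σ hσ).le (hpos τ hτ).le
      (inv_pos.2 hb0).ne').1 he)]
  refine setIntegral_congr_fun measurableSet_Icc fun σ hσ => ?_
  have : 0 ≤ b⁻¹ * σ ^ (b⁻¹ - 1) := mul_nonneg (inv_pos.2 hb0).le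
    (Real.rpow_nonneg (hpos σ hσ).le _)
  simp only [abs_of_nonneg this, smul_eq_mul]

theorem cavg_decay_fst (hb : 1 < b) : ∃ C : ℝ, 0 ≤ C ∧
    ∀ {m : ℤ} {f : ℝ × ℝ → ℝ}, Nice f → (∀ y, Lev m fun x => f (x, y)) →
    (∀ y, cexp (m - 1) (fun x => f (x, y)) = 0) → ∀ {lam : ℝ} (mu : ℝ), lam ≠ 0 →
    ∫ p, cavg b lam mu f p ^ 2 ≤ C * ((2:ℝ) ^ (-m) / |lam|) ^ (1 / 3 : ℝ) * ∫ p, f p ^ 2 := by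
  have hb0 : 0 < b := by linarith
  obtain ⟨M, m₀, φ1, φ2, ψ1, h⟩ := exists_phaseAmp_rpow (α := (1 / 2) ^ b) (β := 2 ^ b) (c := b⁻¹)
    (b⁻¹ - 1) b⁻¹ (Real.rpow_pos_of_pos (by norm_num) b)
    (Real.rpow_lt_rpow (by norm_num) (by norm_num) hb0) (inv_pos.2 hb0).ne' (inv_lt_one_of_one_lt₀ hb).ne
  obtain ⟨C, hC, H⟩ := h.decay
  refine ⟨(2 / 3) ^ 2 * C, by positivity, fun {m f} hf hl h0 lam mu hlam => ?_⟩
  have hf' : Nice fun p : ℝ × ℝ => f p.swap := by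
    obtain ⟨E, hE⟩ := hf.bdd
    obtain ⟨R, hR⟩ := hf.supp
    exact ⟨hf.meas.comp_measurable measurable_swap, ⟨E, fun p => hE _⟩,
      ⟨R, fun p hp => hR _ (hp.trans_eq (max_comm _ _))⟩⟩
  have := H hf' hl h0 mu hlam
  have e1 : ∫ p : ℝ × ℝ, f p.swap ^ 2 = ∫ p, f p ^ 2 := by
    rw [Measure.volume_eq_prod]; exact integral_prod_swap fun p => f p ^ 2
  have e2 : ∫ p, cavg b lam mu f p ^ 2 = ∫ p : ℝ × ℝ, cavg b lam mu f p.swap ^ 2 := by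
    rw [Measure.volume_eq_prod]; exact (integral_prod_swap fun p => cavg b lam mu f p ^ 2).symm
  have e3 : ∀ p : ℝ × ℝ, cavg b lam mu f p.swap = 2 / 3 *
      ∫ σ, (Icc ((1 / 2 : ℝ) ^ b) (2 ^ b)).indicator (fun t => b⁻¹ * t ^ (b⁻¹ - 1)) σ *
        f (p - (mu * σ, lam * σ ^ b⁻¹)).swap := by
    intro p
    rw [cavg_eq, integral_indicator_mul' measurableSet_Icc, integral_Icc_rpow_inv hb]
    congr 1
    refine setIntegral_congr_fun measurableSet_Icc fun σ hσ => ?_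
    have h0 : 0 ≤ σ := (Real.rpow_nonneg (by norm_num) b).trans hσ.1
    simp only [Real.rpow_inv_rpow h0 hb0.ne']
    rfl
  rw [e2]
  simp only [e3, mul_pow]
  rw [integral_const_mul, mul_assoc ((2 / 3 : ℝ) ^ 2), mul_assoc ((2 / 3 : ℝ) ^ 2), ← e1]
  exact mul_le_mul_of_nonneg_left this (by positivity)

end CurveAverage

section Holder

variable {f g : ℝ × ℝ → ℝ}

/-- The `L^q` norm of a nonnegative function. -/
def Ln (q : ℝ) (f : ℝ × ℝ → ℝ) : ℝ := (∫ p, f p ^ q) ^ (1 / q)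

theorem Ln_nonneg {q : ℝ} (h0 : ∀ x, 0 ≤ f x) : 0 ≤ Ln q f :=
  Real.rpow_nonneg (integral_nonneg fun x => Real.rpow_nonneg (h0 x) q) _

theorem Ln_rpow {q : ℝ} (hq : 0 < q) (h0 : ∀ x, 0 ≤ f x) : Ln q f ^ q = ∫ p, f p ^ q := by
  rw [Ln, ← Real.rpow_mul (integral_nonneg fun x => Real.rpow_nonneg (h0 x) q),
    one_div_mul_cancel hq.ne', Real.rpow_one]

theorem Ln_le_of_integral_le {q c : ℝ} (hq : 0 < q) (hc : 0 ≤ c) (hf : ∀ x, 0 ≤ f x)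
    (hg : ∀ x, 0 ≤ g x) (h : ∫ p, f p ^ q ≤ c ^ q * ∫ p, g p ^ q) : Ln q f ≤ c * Ln q g := by
  rw [← Ln_rpow hq hf, ← Ln_rpow hq hg, ← Real.mul_rpow hc (Ln_nonneg hg)] at h
  exact (Real.rpow_le_rpow_iff (Ln_nonneg hf) (mul_nonneg hc (Ln_nonneg hg)) hq).1 h

theorem Nice.memLp_ofReal (hf : Nice f) {q : ℝ} : MemLp f (ENNReal.ofReal q) volume := by
  obtain ⟨C, hC⟩ := hf.bdd
  obtain ⟨R, hR⟩ := hf.supp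
  have : HasCompactSupport f := HasCompactSupport.intro (isCompact_closedBall (0 : ℝ × ℝ) R)
    fun x hx => hR x (by simpa using hx)
  exact this.memLp_of_bound hf.meas.aestronglyMeasurable C (Eventually.of_forall hC)

theorem integral_mul_le_Ln {p r : ℝ} (h : r.HolderConjugate p) (hf : Nice f) (hg : Nice g)
    (f0 : ∀ x, 0 ≤ f x) (g0 : ∀ x, 0 ≤ g x) :
    ∫ x, f x * g x ≤ Ln r f * Ln p g :=
  integral_mul_le_Lp_mul_Lq_of_nonneg h (Eventually.of_forall f0) (Eventually.of_forall g0)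
    hf.memLp_ofReal hg.memLp_ofReal

end Holder

section Doob

/-- Running maximum of a sequence of functions. -/
def runMax {X : Type*} (F : ℕ → X → ℝ) : ℕ → X → ℝ
  | 0 => F 0
  | n + 1 => fun x => max (runMax F n x) (F (n + 1) x)

theorem le_runMax {X : Type*} (F : ℕ → X → ℝ) {k n : ℕ} (h : k ≤ n) (x : X) :
    F k x ≤ runMax F n x := by
  induction n, h using Nat.le_induction with
  | base => cases k with
    | zero => exact le_rfl
    | succ k => exact le_max_right _ _
  | succ n _ ih => exact ih.trans (le_max_left _ _)

theorem runMax_nonneg {X : Type*} {F : ℕ → X → ℝ} (h : ∀ n x, 0 ≤ F n x) (n : ℕ) (x : X) :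
    0 ≤ runMax F n x := (h 0 x).trans (le_runMax F (Nat.zero_le n) x)

theorem runMax_nice {F : ℕ → ℝ × ℝ → ℝ} (h : ∀ n, Nice (F n)) (n : ℕ) : Nice (runMax F n) := by
  induction n with
  | zero => exact h 0
  | succ n ih => exact ih.max (h (n + 1))

theorem doob_pointwise {p S X : ℝ} (hp : 1 < p) (hS : 0 ≤ S) (hX : 0 ≤ X) :
    max S X ^ p - p / (p - 1) * (max S X ^ (p - 1) * X) ≤
      S ^ p - p / (p - 1) * (S ^ (p - 1) * X) := by
  rcases le_total X S with h | h
  · rw [max_eq_left h]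
  · rw [max_eq_right h]
    have hp1 : 0 < p - 1 := by linarith
    have e : X ^ (p - 1) * X = X ^ p := by
      rcases hX.eq_or_lt with h0 | h0
      · rw [← h0, Real.zero_rpow (by linarith : p ≠ 0), mul_zero]
      · rw [← Real.rpow_add_one h0.ne', sub_add_cancel]
    have hc : (p / (p - 1)).HolderConjugate p :=
      (Real.HolderConjugate.conjExponent hp).symm
    have hy := Real.young_inequality_of_nonneg (Real.rpow_nonneg hS (p - 1)) hX hc
    rw [← Real.rpow_mul hS, show (p - 1) * (p / (p - 1)) = p by field_simp] at hy
    rw [e]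
    have h2 := mul_le_mul_of_nonneg_left hy (show 0 ≤ p / (p - 1) by positivity)
    have h3 : p / (p - 1) * (S ^ p / (p / (p - 1)) + X ^ p / p) = S ^ p + X ^ p / (p - 1) := by
      field_simp
    have h4 : X ^ p - p / (p - 1) * X ^ p = - (X ^ p / (p - 1)) := by field_simp; ring
    rw [h3] at h2
    linarith

theorem doob_abstract {p : ℝ} (hp : 1 < p) {F : ℕ → ℝ × ℝ → ℝ} {f : ℝ × ℝ → ℝ}
    (hF : ∀ n, Nice (F n)) (hF0 : ∀ n x, 0 ≤ F n x) (hf : Nice f) (hf0 : ∀ x, 0 ≤ f x)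
    (h1 : ∀ n, ∫ x, runMax F n x ^ (p - 1) * F n x = ∫ x, runMax F n x ^ (p - 1) * f x)
    (h2 : ∀ n, ∫ x, runMax F n x ^ (p - 1) * F (n + 1) x = ∫ x, runMax F n x ^ (p - 1) * f x)
    (n : ℕ) :
    ∫ x, runMax F n x ^ p ≤ (p / (p - 1)) ^ p * ∫ x, f x ^ p := by
  have hp1 : 0 < p - 1 := by linarith
  have hp0 : 0 < p := by linarith
  have hr0 : 0 < p / (p - 1) := by positivity
  have hn := fun n => runMax_nice hF n
  have h0 := fun n => runMax_nonneg hF0 n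
  have hm : ∀ n, Nice fun x => runMax F n x ^ (p - 1) := fun n => (hn n).rpow (h0 n) hp1
  have hmp : ∀ n, Nice fun x => runMax F n x ^ p := fun n => (hn n).rpow (h0 n) hp0
  have key : ∀ n, ∫ x, runMax F n x ^ p ≤ p / (p - 1) * ∫ x, runMax F n x ^ (p - 1) * f x := by
    intro n
    induction n with
    | zero =>
      rw [← h1 0]
      have e : ∀ x, runMax F 0 x ^ (p - 1) * F 0 x = runMax F 0 x ^ p := by
        intro x
        change F 0 x ^ (p - 1) * F 0 x = F 0 x ^ p
        rcases (hF0 0 x).eq_or_lt with h0 | h0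
        · rw [← h0, Real.zero_rpow (by linarith : p ≠ 0), mul_zero]
        · rw [← Real.rpow_add_one h0.ne', sub_add_cancel]
      simp only [e]
      refine le_mul_of_one_le_left (integral_nonneg fun x => Real.rpow_nonneg (h0 0 x) _) ?_
      rw [le_div_iff₀ hp1]; linarith
    | succ n ih =>
      have hi1 : Integrable fun x => runMax F (n + 1) x ^ (p - 1) * F (n + 1) x :=
        ((hm _).mul (hF _)).integrable
      have hi2 : Integrable fun x => runMax F n x ^ (p - 1) * F (n + 1) x :=
        ((hm _).mul (hF _)).integrable
      have a : ∫ x, (runMax F (n + 1) x ^ p -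
          p / (p - 1) * (runMax F (n + 1) x ^ (p - 1) * F (n + 1) x)) ≤
          ∫ x, (runMax F n x ^ p - p / (p - 1) * (runMax F n x ^ (p - 1) * F (n + 1) x)) :=
        integral_mono ((hmp _).integrable.sub (hi1.const_mul _))
          ((hmp _).integrable.sub (hi2.const_mul _))
          fun x => doob_pointwise hp (h0 n x) (hF0 (n + 1) x)
      rw [integral_sub (hmp _).integrable (hi1.const_mul _),
        integral_sub (hmp _).integrable (hi2.const_mul _), integral_const_mul,
        integral_const_mul, h1, h2] at a
      linarith
  have hc : (p / (p - 1)).HolderConjugate p := (Real.HolderConjugate.conjExponent hp).symm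
  have hh := integral_mul_le_Ln hc (hm n) hf (fun x => Real.rpow_nonneg (h0 n x) _) hf0
  set T := ∫ x, runMax F n x ^ p with hT
  have hT0 : 0 ≤ T := integral_nonneg fun x => Real.rpow_nonneg (h0 n x) _
  have e1 : Ln (p / (p - 1)) (fun x => runMax F n x ^ (p - 1)) = T ^ ((p - 1) / p) := by
    have : ∀ x, (runMax F n x ^ (p - 1)) ^ (p / (p - 1)) = runMax F n x ^ p := fun x => by
      rw [← Real.rpow_mul (h0 n x), mul_div_cancel₀ _ hp1.ne']
    simp only [Ln, this, one_div_div, hT]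
  rw [e1] at hh
  rcases hT0.eq_or_lt with hz | hpos
  · rw [← hz]
    exact mul_nonneg (by positivity) (integral_nonneg fun x => Real.rpow_nonneg (hf0 x) _)
  have h3 : T ^ (1 / p) ≤ p / (p - 1) * Ln p f := by
    have h4 : T ≤ T ^ ((p - 1) / p) * (p / (p - 1) * Ln p f) :=
      (key n).trans ((mul_le_mul_of_nonneg_left hh hr0.le).trans_eq (by ring))
    have h5 : T = T ^ ((p - 1) / p) * T ^ (1 / p) := by
      rw [← Real.rpow_add hpos, ← add_div, sub_add_cancel, div_self hp0.ne', Real.rpow_one]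
    have h6 : 0 < T ^ ((p - 1) / p) := Real.rpow_pos_of_pos hpos _
    exact le_of_mul_le_mul_left (h5.symm.le.trans h4) h6
  calc T = (T ^ (1 / p)) ^ p := by
        rw [← Real.rpow_mul hT0, one_div_mul_cancel hp0.ne', Real.rpow_one]
    _ ≤ (p / (p - 1) * Ln p f) ^ p := Real.rpow_le_rpow (by positivity) h3 hp0.le
    _ = _ := by rw [Real.mul_rpow hr0.le (Ln_nonneg hf0), Ln_rpow hp0 hf0]

end Doob

section Maximal

variable {f : ℝ × ℝ → ℝ}

theorem E1_nonneg (n : ℤ) (h0 : ∀ x, 0 ≤ f x) (x : ℝ × ℝ) : 0 ≤ E1 n f x := avg_nonneg h0 x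
theorem E2_nonneg (n : ℤ) (h0 : ∀ x, 0 ≤ f x) (x : ℝ × ℝ) : 0 ≤ E2 n f x := avg_nonneg h0 x

theorem E1_eq_of_lev {n : ℤ} (h : ∀ y, Lev n fun x => f (x, y)) : E1 n f = f := by
  funext ⟨x, y⟩
  rw [E1_apply, (h y).cexp_eq]

theorem runMax_lev (m : ℤ) (f : ℝ × ℝ → ℝ) (n : ℕ) (y : ℝ) :
    Lev (m + n) fun x => runMax (fun k : ℕ => E1 (m + k) f) n (x, y) := by
  induction n with
  | zero => exact lev_cexp (E := ℝ) _ fun x => f (x, y)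
  | succ n ih =>
    intro x x' h
    have h1 := (ih.mono (show m + (n : ℤ) ≤ m + ((n + 1 : ℕ) : ℤ) by push_cast; linarith)) x x' h
    have h2 := lev_cexp (m + ((n + 1 : ℕ) : ℤ)) (fun x => f (x, y)) x x' h
    change Max.max _ _ = Max.max _ _
    exact congrArg₂ Max.max h1 h2

/-- Doob's maximal inequality for the dyadic filtration in the first variable. -/
theorem doob_E1 {p : ℝ} (hp : 1 < p) (m : ℤ) (hf : Nice f) (h0 : ∀ x, 0 ≤ f x) (n : ℕ) :
    ∫ x, runMax (fun k : ℕ => E1 (m + k) f) n x ^ p ≤ (p / (p - 1)) ^ p * ∫ x, f x ^ p := by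
  have hF : ∀ k : ℕ, Nice (E1 (m + k) f) := fun k => E1_nice _ hf
  have hF0 : ∀ (k : ℕ) x, 0 ≤ E1 (m + k) f x := fun k => E1_nonneg _ h0
  have key : ∀ n k : ℕ, n ≤ k →
      ∫ x, runMax (fun k : ℕ => E1 (m + k) f) n x ^ (p - 1) * E1 (m + k) f x =
        ∫ x, runMax (fun k : ℕ => E1 (m + k) f) n x ^ (p - 1) * f x := by
    intro n k hnk
    rw [integral_E1_adjoint _ hf ((runMax_nice hF n).rpow (runMax_nonneg hF0 n) (by linarith)),
      E1_eq_of_lev]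
    intro y x x' h
    have := (runMax_lev m f n y).mono (show m + (n : ℤ) ≤ m + k by
      have : (n : ℤ) ≤ k := by exact_mod_cast hnk
      linarith) x x' h
    exact congrArg (· ^ (p - 1)) this
  exact doob_abstract hp hF hF0 hf h0 (fun n => key n n le_rfl) (fun n => key n (n + 1) n.le_succ) n

/-- Translation in the first variable. -/
def shift1 (c : ℝ) (f : ℝ × ℝ → ℝ) (p : ℝ × ℝ) : ℝ := f (p.1 + c, p.2)

theorem shift1_nice (c : ℝ) (hf : Nice f) : Nice (shift1 c f) := by
  obtain ⟨C, hC⟩ := hf.bdd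
  obtain ⟨R, hR⟩ := hf.supp
  refine ⟨hf.meas.comp_measurable ((measurable_fst.add_const c).prodMk measurable_snd),
    ⟨C, fun x => hC _⟩, ⟨R + |c|, fun x hx => hR _ ?_⟩⟩
  have h1 : ‖x‖ ≤ ‖(x.1 + c, x.2)‖ + ‖((c, 0) : ℝ × ℝ)‖ := by
    have := norm_sub_le (x.1 + c, x.2) ((c, 0) : ℝ × ℝ)
    simpa using this
  have h2 : ‖((c, 0) : ℝ × ℝ)‖ = |c| := by simp [Prod.norm_def]
  linarith

theorem integral_shift1 (c : ℝ) (f : ℝ × ℝ → ℝ) : ∫ p, shift1 c f p = ∫ p, f p := by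
  have := integral_add_right_eq_self (μ := (volume : Measure (ℝ × ℝ))) f ((c, 0) : ℝ × ℝ)
  rw [← this]
  refine integral_congr_ae (Eventually.of_forall fun p => ?_)
  change f (p.1 + c, p.2) = f (p + (c, 0))
  congr 1
  ext <;> simp

/-- Dyadic maximal function in the first variable over two adjacent grids. -/
def maxOp1 (m : ℤ) (n : ℕ) (f : ℝ × ℝ → ℝ) (p : ℝ × ℝ) : ℝ :=
  runMax (fun k : ℕ => E1 (m + k) f) n p +
    shift1 (-((2:ℝ) ^ (-m) / 3)) (runMax (fun k : ℕ => E1 (m + k) (shift1 ((2:ℝ) ^ (-m) / 3) f)) n) p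

theorem maxOp1_nice (m : ℤ) (n : ℕ) (hf : Nice f) : Nice (maxOp1 m n f) :=
  (runMax_nice (fun _ => E1_nice _ hf) n).add
    (shift1_nice _ (runMax_nice (fun _ => E1_nice _ (shift1_nice _ hf)) n))

theorem maxOp1_nonneg (m : ℤ) (n : ℕ) (h0 : ∀ x, 0 ≤ f x) (x : ℝ × ℝ) : 0 ≤ maxOp1 m n f x :=
  add_nonneg (runMax_nonneg (fun _ => E1_nonneg _ h0) n x)
    (runMax_nonneg (fun _ => E1_nonneg _ fun x => h0 _) n _)

theorem Ln_maxOp1_le {p : ℝ} (hp : 1 < p) (m : ℤ) (n : ℕ) (hf : Nice f)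
    (h0 : ∀ x, 0 ≤ f x) : Ln p (maxOp1 m n f) ≤ 2 * (p / (p - 1)) * Ln p f := by
  have hp1 : 0 < p - 1 := by linarith
  have hp0 : 0 < p := by linarith
  set c := (2:ℝ) ^ (-m) / 3
  set S1 := runMax (fun k : ℕ => E1 (m + k) f) n
  set S2 := runMax (fun k : ℕ => E1 (m + k) (shift1 c f)) n
  have hS1 : Nice S1 := runMax_nice (fun _ => E1_nice _ hf) n
  have hS2 : Nice S2 := runMax_nice (fun _ => E1_nice _ (shift1_nice _ hf)) n
  have hS10 : ∀ x, 0 ≤ S1 x := runMax_nonneg (fun _ => E1_nonneg _ h0) n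
  have hS20 : ∀ x, 0 ≤ S2 x := runMax_nonneg (fun _ => E1_nonneg _ fun x => h0 _) n
  refine Ln_le_of_integral_le hp0 (by positivity) (maxOp1_nonneg m n h0) h0 ?_
  have d1 := doob_E1 hp m hf h0 n
  have d2 := doob_E1 hp m (shift1_nice c hf) (fun x => h0 _) n
  have e2 : ∫ x, shift1 c f x ^ p = ∫ x, f x ^ p := integral_shift1 c fun x => f x ^ p
  rw [e2] at d2
  have e3 : ∫ x, shift1 (-c) S2 x ^ p = ∫ x, S2 x ^ p := integral_shift1 (-c) fun x => S2 x ^ p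
  have i1 : Integrable fun x => S1 x ^ p := (hS1.rpow hS10 hp0).integrable
  have i2 : Integrable fun x => shift1 (-c) S2 x ^ p :=
    ((shift1_nice (-c) hS2).rpow (fun x => hS20 _) hp0).integrable
  calc ∫ x, maxOp1 m n f x ^ p
      ≤ ∫ x, (2:ℝ) ^ (p - 1) * (S1 x ^ p + shift1 (-c) S2 x ^ p) :=
        integral_mono ((maxOp1_nice m n hf).rpow (maxOp1_nonneg m n h0) hp0).integrable
          ((i1.add i2).const_mul _) fun x => by
            have := NNReal.rpow_add_le_mul_rpow_add_rpow ⟨_, hS10 x⟩ ⟨_, hS20 (x.1 + -c, x.2)⟩ hp.le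
            exact_mod_cast this
    _ = (2:ℝ) ^ (p - 1) * ((∫ x, S1 x ^ p) + ∫ x, S2 x ^ p) := by
        rw [integral_const_mul, integral_add i1 i2, e3]
    _ ≤ (2:ℝ) ^ (p - 1) * (2 * ((p / (p - 1)) ^ p * ∫ x, f x ^ p)) := by
        gcongr; linarith
    _ = _ := by
        rw [Real.mul_rpow (by norm_num) (by positivity), Real.rpow_sub_one (by norm_num)]
        ring

theorem floor_eq_or_floor_shift_eq {a b : ℝ} (h : a ≤ b) (hab : b - a < 1 / 3) (e : ℕ) :
    ⌊a⌋ = ⌊b⌋ ∨ ⌊a - 2 ^ e / 3⌋ = ⌊b - 2 ^ e / 3⌋ := by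
  by_contra! hc
  have h1 : ⌊a⌋ < ⌊b⌋ := lt_of_le_of_ne (Int.floor_mono h) hc.1
  have h2 : ⌊a - 2 ^ e / 3⌋ < ⌊b - 2 ^ e / 3⌋ :=
    lt_of_le_of_ne (Int.floor_mono (by linarith)) hc.2
  have a1 : a < ⌊b⌋ := Int.floor_lt.1 h1
  have a2 : a - 2 ^ e / 3 < ⌊b - 2 ^ e / 3⌋ := Int.floor_lt.1 h2
  have b1 := Int.floor_le b
  have b2 := Int.floor_le (b - 2 ^ e / 3)
  set u := ⌊b⌋
  set v := ⌊b - 2 ^ e / 3⌋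
  have c1 : (((3 * (u - v) - 2 ^ e : ℤ)) : ℝ) < 1 := by push_cast; linarith
  have c2 : (-1 : ℝ) < ((3 * (u - v) - 2 ^ e : ℤ) : ℝ) := by push_cast; linarith
  have c3 : 3 * (u - v) - 2 ^ e = (0 : ℤ) := by
    have d1 : 3 * (u - v) - 2 ^ e < (1 : ℤ) := by exact_mod_cast c1
    have d2 : (-1 : ℤ) < 3 * (u - v) - 2 ^ e := by exact_mod_cast c2
    omega
  have c4 : (3 : ℤ) ∣ 2 ^ e := ⟨u - v, by linarith⟩
  have := Int.prime_three.dvd_of_dvd_pow c4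
  omega

theorem integral_le_cexp {k : ℤ} {h : ℝ → ℝ} (hh : Nice h) (h0 : ∀ x, 0 ≤ h x) {x ρ : ℝ}
    (hρ : 0 ≤ ρ) (hfl : ⌊(2:ℝ) ^ k * (x - ρ)⌋ = ⌊(2:ℝ) ^ k * (x + ρ)⌋) :
    ∫ y in (x - ρ)..(x + ρ), h y ≤ (2:ℝ) ^ (-k) * cexp k h x := by
  have hk : (0 : ℝ) < 2 ^ k := by positivity
  have m1 : (2:ℝ) ^ k * (x - ρ) ≤ 2 ^ k * x := by gcongr; linarith
  have m2 : (2:ℝ) ^ k * x ≤ 2 ^ k * (x + ρ) := by gcongr; linarith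
  have hx : ⌊(2:ℝ) ^ k * x⌋ = ⌊(2:ℝ) ^ k * (x + ρ)⌋ :=
    le_antisymm (Int.floor_mono m2) (hfl ▸ Int.floor_mono m1)
  rw [cexp_eq_interval k hh, smul_eq_mul, ← mul_assoc, ← zpow_add₀ (by norm_num), neg_add_cancel,
    zpow_zero, one_mul]
  have l1 : (2:ℝ) ^ (-k) * ⌊(2:ℝ) ^ k * x⌋ ≤ x - ρ := by
    rw [hx, ← hfl, zpow_neg, inv_mul_le_iff₀ hk]; exact Int.floor_le _
  have l2 : x + ρ ≤ (2:ℝ) ^ (-k) * (⌊(2:ℝ) ^ k * x⌋ + 1) := by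
    rw [hx, zpow_neg, le_inv_mul_iff₀ hk]; exact (Int.lt_floor_add_one _).le
  exact intervalIntegral.integral_mono_interval l1 (by linarith) l2
    (Eventually.of_forall h0) (hh.intervalIntegrable _ _)

/-- The maximal function dominates averages over centred intervals. -/
theorem integral_le_maxOp1 {m k : ℤ} {n : ℕ} (hmk : m ≤ k) (hkn : k ≤ m + n) (hf : Nice f)
    (h0 : ∀ x, 0 ≤ f x) {ρ : ℝ} (hρ : 0 ≤ ρ) (h6 : 6 * ρ < (2:ℝ) ^ (-k)) (x y : ℝ) :
    ∫ x' in (x - ρ)..(x + ρ), f (x', y) ≤ (2:ℝ) ^ (-k) * maxOp1 m n f (x, y) := by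
  obtain ⟨e, rfl⟩ : ∃ e : ℕ, k = m + e := ⟨(k - m).toNat, by rw [Int.toNat_of_nonneg] <;> linarith⟩
  have hen : e ≤ n := by
    have : (e : ℤ) ≤ n := by linarith
    exact_mod_cast this
  have hk : (0 : ℝ) < 2 ^ (m + (e : ℤ)) := by positivity
  have hs0 := runMax_nonneg (fun k : ℕ => E1_nonneg (m + k) h0) n (x, y)
  set c := (2:ℝ) ^ (-m) / 3
  have hs1 := runMax_nonneg (fun k : ℕ => E1_nonneg (f := shift1 c f) (m + k) fun x => h0 _) n
    (x + -c, y)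
  have hkc : (2:ℝ) ^ (m + (e : ℤ)) * c = 2 ^ e / 3 := by
    simp only [c]
    rw [← mul_div_assoc, ← zpow_add₀ (by norm_num)]
    simp
  have hlen : (2:ℝ) ^ (m + (e : ℤ)) * (x + ρ) - 2 ^ (m + (e : ℤ)) * (x - ρ) < 1 / 3 := by
    have := mul_lt_mul_of_pos_left h6 hk
    rw [← zpow_add₀ (by norm_num), add_neg_cancel, zpow_zero] at this
    linarith
  have hle : (2:ℝ) ^ (m + (e : ℤ)) * (x - ρ) ≤ 2 ^ (m + (e : ℤ)) * (x + ρ) := by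
    gcongr; linarith
  rcases floor_eq_or_floor_shift_eq hle hlen e with h | h
  · refine (integral_le_cexp (hf.fst_slice y) (fun _ => h0 _) hρ h).trans ?_
    gcongr
    have := le_runMax (fun k : ℕ => E1 (m + k) f) hen (x, y)
    exact this.trans (le_add_of_nonneg_right hs1)
  · rw [← hkc, ← mul_sub, ← mul_sub, show x - ρ - c = (x + -c) - ρ by ring,
      show x + ρ - c = (x + -c) + ρ by ring] at h
    have h7 := integral_le_cexp ((shift1_nice c hf).fst_slice y) (fun _ => h0 _) hρ h
    have e1 : ∫ x' in (x + -c - ρ)..(x + -c + ρ), shift1 c f (x', y) =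
        ∫ x' in (x - ρ)..(x + ρ), f (x', y) := by
      have := intervalIntegral.integral_comp_add_right (a := x + -c - ρ) (b := x + -c + ρ)
        (fun x' => f (x', y)) c
      rw [show x + -c - ρ + c = x - ρ by ring, show x + -c + ρ + c = x + ρ by ring] at this
      exact this
    rw [e1] at h7
    refine h7.trans ?_
    gcongr
    have := le_runMax (fun k : ℕ => E1 (m + k) (shift1 c f)) hen (x + -c, y)
    exact this.trans (le_add_of_nonneg_left hs0)

/-- Dyadic maximal function in the second variable over two adjacent grids. -/
def maxOp2 (m : ℤ) (n : ℕ) (f : ℝ × ℝ → ℝ) (p : ℝ × ℝ) : ℝ :=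
  maxOp1 m n (fun q => f q.swap) p.swap

theorem Nice.swap (hf : Nice f) : Nice fun q : ℝ × ℝ => f q.swap := by
  obtain ⟨C, hC⟩ := hf.bdd
  obtain ⟨R, hR⟩ := hf.supp
  refine ⟨hf.meas.comp_measurable measurable_swap, ⟨C, fun x => hC _⟩, ⟨R, fun x hx => hR _ ?_⟩⟩
  rwa [Prod.norm_def, Prod.fst_swap, Prod.snd_swap, max_comm, ← Prod.norm_def]

theorem integral_swap_eq (f : ℝ × ℝ → ℝ) : ∫ p : ℝ × ℝ, f p.swap = ∫ p, f p :=
  integral_prod_swap (μ := (volume : Measure ℝ)) (ν := (volume : Measure ℝ)) f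

theorem Ln_swap (q : ℝ) (f : ℝ × ℝ → ℝ) : Ln q (fun p => f p.swap) = Ln q f := by
  rw [Ln, integral_swap_eq fun p => f p ^ q, Ln]

theorem maxOp2_nice (m : ℤ) (n : ℕ) (hf : Nice f) : Nice (maxOp2 m n f) :=
  (maxOp1_nice m n hf.swap).swap

theorem maxOp2_nonneg (m : ℤ) (n : ℕ) (h0 : ∀ x, 0 ≤ f x) (x : ℝ × ℝ) : 0 ≤ maxOp2 m n f x :=
  maxOp1_nonneg m n (fun _ => h0 _) _

theorem Ln_maxOp2_le {p : ℝ} (hp : 1 < p) (m : ℤ) (n : ℕ) (hf : Nice f)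
    (h0 : ∀ x, 0 ≤ f x) : Ln p (maxOp2 m n f) ≤ 2 * (p / (p - 1)) * Ln p f := by
  have := Ln_maxOp1_le hp m n hf.swap fun _ => h0 _
  rw [Ln_swap] at this
  exact (Ln_swap p (maxOp1 m n fun q => f q.swap)).trans_le this

theorem integral_le_maxOp2 {m k : ℤ} {n : ℕ} (hmk : m ≤ k) (hkn : k ≤ m + n) (hf : Nice f)
    (h0 : ∀ x, 0 ≤ f x) {ρ : ℝ} (hρ : 0 ≤ ρ) (h6 : 6 * ρ < (2:ℝ) ^ (-k)) (x y : ℝ) :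
    ∫ y' in (y - ρ)..(y + ρ), f (x, y') ≤ (2:ℝ) ^ (-k) * maxOp2 m n f (x, y) :=
  integral_le_maxOp1 hmk hkn hf.swap (fun _ => h0 _) hρ h6 y x

end Maximal

section CurveAverage

variable {f g : ℝ × ℝ → ℝ} {b : ℝ}

theorem cavg_nonneg (lam mu : ℝ) (h0 : ∀ x, 0 ≤ f x) (x : ℝ × ℝ) : 0 ≤ cavg b lam mu f x :=
  avg_nonneg h0 x

theorem integral_cavg_adjoint (hb : 0 ≤ b) (lam mu : ℝ) (hf : Nice f) (hg : Nice g) :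
    ∫ p, g p * cavg b lam mu f p = ∫ p, cavg b (-lam) (-mu) g p * f p := by
  set Ψ : ℝ → ℝ := (Icc (1 / 2 : ℝ) 2).indicator fun _ => 1 with hΨd
  have hΨ : Nice Ψ := nice_indicator_of_bound measurable_const (C := 1) (by simp)
  have hc : ∀ (l m : ℝ) (h : ℝ × ℝ → ℝ) p,
      cavg b l m h p = 2 / 3 * ∫ t, Ψ t * h (p + (-(l * t), -(m * t ^ b))) := by
    intro l m h p
    rw [cavg_eq, integral_indicator_mul' measurableSet_Icc]
    congr 2
    funext t
    rw [one_mul, sub_eq_add_neg]; rfl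
  have hm : ∀ l m : ℝ, Measurable fun t : ℝ => ((-(l * t), -(m * t ^ b)) : ℝ × ℝ) := fun l m => by
    refine Measurable.prodMk (by fun_prop) ?_
    exact (measurable_const.mul (measurable_id.pow_const b)).neg
  have e : ∀ (l m : ℝ) {h k : ℝ × ℝ → ℝ}, Nice h → Nice k → ∫ p, h p * cavg b l m k p =
      2 / 3 * ∫ t, Ψ t * ∫ p, h p * k (p + (-(l * t), -(m * t ^ b))) := by
    intro l m h k hh hk
    rw [← integral_mul_shift_swap hΨ hh hk (hm l m), ← integral_const_mul]
    congr 1; funext p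
    rw [hc]; ring
  have e2 : ∫ p, cavg b (-lam) (-mu) g p * f p = ∫ p, f p * cavg b (-lam) (-mu) g p := by
    congr 1; funext p; ring
  rw [e2, e _ _ hg hf, e _ _ hf hg]
  congr 2
  funext t
  congr 1
  rw [← integral_add_right_eq_self (μ := (volume : Measure (ℝ × ℝ)))
    (fun p => f p * g (p + (-(-lam * t), -(-mu * t ^ b)))) (-(lam * t), -(mu * t ^ b))]
  congr 1; funext p
  rw [mul_comm]
  congr 2
  ext <;> simp

theorem integral_cavg (hb : 0 ≤ b) (lam mu : ℝ) (hf : Nice f) :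
    ∫ p, cavg b lam mu f p = ∫ p, f p := by
  obtain ⟨R, hR⟩ := hf.supp
  obtain ⟨S, hS⟩ := (cavg_nice hb lam mu hf).supp
  set D := max (|lam| * 2) (|mu| * 2 ^ b)
  set χ : ℝ × ℝ → ℝ := (Metric.closedBall 0 (max (R + D) S)).indicator fun _ => 1
  have hχ : Nice χ := by
    refine ⟨stronglyMeasurable_const.indicator measurableSet_closedBall, ⟨1, fun x => ?_⟩,
      ⟨max (R + D) S, fun x hx => ?_⟩⟩
    · refine (norm_indicator_le_norm_self _ _).trans ?_; simp
    · exact indicator_of_notMem (by simpa using hx) _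
  have h1 : ∫ p, cavg b lam mu f p = ∫ p, χ p * cavg b lam mu f p := by
    congr 1; funext p
    by_cases hp : ‖p‖ ≤ max (R + D) S
    · rw [show χ p = 1 from indicator_of_mem (by simpa using hp) _, one_mul]
    · rw [hS p ((le_max_right _ _).trans_lt (not_le.1 hp)), mul_zero]
  rw [h1, integral_cavg_adjoint hb lam mu hf hχ]
  congr 1; funext p
  by_cases hp : ‖p‖ ≤ R
  · have : cavg b (-lam) (-mu) χ p = 1 := by
      have : ∀ᵐ t ∂cmeas, χ (p - (-lam * t, -mu * t ^ b)) = 1 := by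
        filter_upwards [cmeas_ae] with t ht
        refine indicator_of_mem ?_ _
        rw [mem_closedBall_zero_iff]
        have ht0 : 0 ≤ t := by linarith [ht.1]
        have h2 : ‖((-lam * t, -mu * t ^ b) : ℝ × ℝ)‖ ≤ D := by
          rw [Prod.norm_def]
          refine max_le_max ?_ ?_
          · simp only [Real.norm_eq_abs, abs_mul, abs_neg, abs_of_nonneg ht0]
            exact mul_le_mul_of_nonneg_left ht.2 (abs_nonneg _)
          · simp only [Real.norm_eq_abs, abs_mul, abs_neg, abs_of_nonneg (Real.rpow_nonneg ht0 b)]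
            exact mul_le_mul_of_nonneg_left (Real.rpow_le_rpow ht0 ht.2 hb) (abs_nonneg _)
        have := norm_sub_le p (-lam * t, -mu * t ^ b)
        have := le_max_left (R + D) S
        linarith
      rw [cavg, avg, integral_congr_ae this]; simp
    rw [this, one_mul]
  · rw [hR p (not_le.1 hp), mul_zero]

theorem cexp_le_integral {j : ℤ} {h : ℝ → ℝ} (hh : Nice h) (h0 : ∀ x, 0 ≤ h x) {x x' D : ℝ}
    (hx : |x' - x| ≤ D * 2 ^ (-j)) :
    cexp j h x' ≤ (2:ℝ) ^ j *
      ∫ y in (x - (D + 1) * 2 ^ (-j))..(x + (D + 1) * 2 ^ (-j)), h y := by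
  rw [cexp_eq_interval j hh, smul_eq_mul]
  have hk : (0 : ℝ) < 2 ^ j := by positivity
  have hk' : (0 : ℝ) < 2 ^ (-j) := by positivity
  have hkk : (2:ℝ) ^ (-j) * 2 ^ j = 1 := by
    rw [← zpow_add₀ (by norm_num), neg_add_cancel, zpow_zero]
  have f1 := mul_le_mul_of_nonneg_left (Int.floor_le ((2:ℝ) ^ j * x')) hk'.le
  have f2 := mul_le_mul_of_nonneg_left (Int.lt_floor_add_one ((2:ℝ) ^ j * x')).le hk'.le
  rw [← mul_assoc, hkk, one_mul] at f1 f2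
  have := abs_le.1 hx
  refine mul_le_mul_of_nonneg_left ?_ hk.le
  refine intervalIntegral.integral_mono_interval ?_ ?_ ?_ (Eventually.of_forall h0)
    (hh.intervalIntegrable _ _)
  · linarith
  · linarith
  · linarith

theorem integral_comp_line_le {h : ℝ → ℝ} (hh : Nice h) (h0 : ∀ x, 0 ≤ h x) {x c α β : ℝ}
    (hc : c ≠ 0) (hα : 0 ≤ α) (hαβ : α ≤ β) :
    ∫ t in Icc α β, h (x - c * t) ≤ |c|⁻¹ * ∫ y in (x - |c| * β)..(x + |c| * β), h y := by
  have e : ∀ c : ℝ, 0 < c → ∫ t in (-β)..β, h (x - c * t) =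
      c⁻¹ * ∫ y in (x - c * β)..(x + c * β), h y := by
    intro c hc
    rw [intervalIntegral.integral_comp_sub_mul (f := h) hc.ne', smul_eq_mul,
      show x - c * -β = x + c * β by ring]
  have e' : ∫ t in (-β)..β, h (x - c * t) = |c|⁻¹ * ∫ y in (x - |c| * β)..(x + |c| * β), h y := by
    rcases hc.lt_or_gt with h1 | h1
    · rw [abs_of_neg h1, ← e (-c) (by linarith)]
      have := ( intervalIntegral.integral_comp_neg (a := -β) (b := β)
        fun t => h (x - -c * t))
      simpa using this
    · rw [abs_of_pos h1, e c h1]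
  rw [← e', intervalIntegral.integral_of_le (by linarith), integral_Icc_eq_integral_Ioc]
  obtain ⟨C, hC⟩ := hh.bdd
  refine setIntegral_mono_set ?_ (Eventually.of_forall fun _ => h0 _)
    (Ioc_subset_Ioc (by linarith) le_rfl).eventuallyLE
  exact Integrable.of_bound (hh.meas.comp_measurable (by fun_prop)).aestronglyMeasurable C
    (Eventually.of_forall fun _ => hC _)

variable {K lam mu : ℝ} {s n : ℕ} {m j k : ℤ}

theorem cavg_E1_le (hb : 1 < b) (hs : 18 * (K * 2 ^ b + 1) < 2 ^ s) (hK : 1 ≤ K)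
    (hj : m + s ≤ j) (hjn : j ≤ m + n) (hk : m + s ≤ k) (hkn : k ≤ m + n)
    (hlam : |lam| = (2:ℝ) ^ (-j)) (hmu : (2:ℝ) ^ (-k) ≤ K * |mu|)
    (hmu' : |mu| ≤ K * 2 ^ (-k)) (hf : Nice f) (h0 : ∀ x, 0 ≤ f x) (p : ℝ × ℝ) :
    cavg b lam mu (E1 j f) p ≤
      4 ^ s * (K * 2 ^ b) * maxOp2 m n (maxOp1 m n f) p := by
  have hb0 : 0 < b := by linarith
  have h2b : (1:ℝ) ≤ 2 ^ b := Real.one_le_rpow (by norm_num) hb0.le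
  have hK2 : 1 ≤ K * 2 ^ b := one_le_mul_of_one_le_of_one_le hK h2b
  set F := maxOp1 m n f
  have hF : Nice F := maxOp1_nice m n hf
  have hF0 : ∀ x, 0 ≤ F x := maxOp1_nonneg m n h0
  have hmu0 : mu ≠ 0 := by
    rintro rfl
    have : (0:ℝ) < 2 ^ (-k) := by positivity
    rw [abs_zero, mul_zero] at hmu; linarith
  have hmupos : 0 < |mu| := abs_pos.2 hmu0
  have zs : ∀ i : ℤ, (2:ℝ) ^ (-(i - s)) = 2 ^ s * 2 ^ (-i) := fun i => by
    rw [neg_sub, sub_eq_add_neg, zpow_add₀ (by norm_num), zpow_natCast]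
  have zc : ∀ i : ℤ, (2:ℝ) ^ i * 2 ^ (-i) = 1 := fun i => by
    rw [← zpow_add₀ (by norm_num), add_neg_cancel, zpow_zero]
  have step1 : cavg b lam mu (E1 j f) p ≤ 2 ^ s * cavg b 0 mu F p := by
    rw [cavg, avg, cavg, avg, ← integral_const_mul]
    refine integral_mono_ae ((niceFam_cavg hb0.le lam mu).integrable (E1_nice j hf) p)
      (((niceFam_cavg hb0.le 0 mu).integrable hF p).const_mul _) ?_
    filter_upwards [cmeas_ae] with t ht
    have ht0 : 0 ≤ t := by linarith [ht.1]
    have hz : (0:ℝ) < 2 ^ (-j) := by positivity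
    change E1 j f (p.1 - lam * t, p.2 - mu * t ^ b) ≤ 2 ^ s * F (p.1 - 0 * t, p.2 - mu * t ^ b)
    rw [E1_apply]
    have hx : |p.1 - lam * t - p.1| ≤ 2 * 2 ^ (-j) := by
      rw [show p.1 - lam * t - p.1 = -(lam * t) by ring, abs_neg, abs_mul, hlam,
        abs_of_nonneg ht0, mul_comm]
      gcongr; exact ht.2
    refine (cexp_le_integral (hf.fst_slice _) (fun _ => h0 _) hx).trans ?_
    have := integral_le_maxOp1 (k := j - s) (n := n) (m := m) (by linarith)
      (by have := Int.natCast_nonneg s; linarith) hf h0 (ρ := (2 + 1) * 2 ^ (-j)) (by positivity)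
      (by rw [zs]; nlinarith) p.1 (p.2 - mu * t ^ b)
    calc _ ≤ _ := mul_le_mul_of_nonneg_left this (by positivity)
      _ = 2 ^ s * F (p.1, p.2 - mu * t ^ b) * (2 ^ j * 2 ^ (-j)) := by rw [zs]; ring
      _ = _ := by rw [zc]; simp
  have step2 : cavg b 0 mu F p ≤ 2 ^ s * (K * 2 ^ b) * maxOp2 m n F p := by
    have hFs : Nice fun y => F (p.1, y) := hF.snd_slice p.1
    have hα : (0:ℝ) < (1 / 2) ^ b := by positivity
    have hαβ : ((1 / 2 : ℝ)) ^ b ≤ 2 ^ b :=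
      Real.rpow_le_rpow (by norm_num) (by norm_num) hb0.le
    obtain ⟨C, hC⟩ := hFs.bdd
    have hint : IntegrableOn (fun σ => F (p.1, p.2 - mu * σ)) (Icc ((1 / 2 : ℝ) ^ b) (2 ^ b)) :=
      Integrable.of_bound (hFs.meas.comp_measurable (by fun_prop :
        Measurable fun σ => p.2 - mu * σ)).aestronglyMeasurable C (Eventually.of_forall fun _ => hC _)
    have a1 : ∫ t in Icc (1 / 2 : ℝ) 2, F (p - (0 * t, mu * t ^ b)) ≤
        2 ^ b * ∫ σ in Icc ((1 / 2 : ℝ) ^ b) (2 ^ b), F (p.1, p.2 - mu * σ) := by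
      rw [integral_Icc_rpow_inv hb, ← integral_const_mul]
      refine integral_mono_of_nonneg ?_ (hint.const_mul _) ?_
      · filter_upwards [ae_restrict_mem measurableSet_Icc] with σ hσ
        have : 0 ≤ σ := hα.le.trans hσ.1
        exact mul_nonneg (by positivity) (hF0 _)
      · filter_upwards [ae_restrict_mem measurableSet_Icc] with σ hσ
        have hσ0 : 0 < σ := hα.trans_le hσ.1
        have e1 : (σ ^ b⁻¹) ^ b = σ := Real.rpow_inv_rpow hσ0.le hb0.ne'
        have e2 : p - (0 * σ ^ b⁻¹, mu * (σ ^ b⁻¹) ^ b) = (p.1, p.2 - mu * σ) := by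
          rw [e1]; ext <;> simp
        change b⁻¹ * σ ^ (b⁻¹ - 1) * F (p - (0 * σ ^ b⁻¹, mu * (σ ^ b⁻¹) ^ b)) ≤ _
        rw [e2]
        refine mul_le_mul_of_nonneg_right ?_ (hF0 _)
        have hbi : b⁻¹ ≤ 1 := inv_le_one_of_one_le₀ hb.le
        have e3 : σ ^ (b⁻¹ - 1) ≤ ((1 / 2 : ℝ) ^ b) ^ (b⁻¹ - 1) :=
          Real.rpow_le_rpow_of_nonpos hα hσ.1 (by linarith)
        have e4 : ((1 / 2 : ℝ) ^ b) ^ (b⁻¹ - 1) ≤ 2 ^ b := by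
          rw [← Real.rpow_mul (by norm_num), one_div, Real.inv_rpow (by norm_num),
            ← Real.rpow_neg (by norm_num)]
          refine Real.rpow_le_rpow_of_exponent_le (by norm_num) ?_
          rw [mul_sub, mul_inv_cancel₀ hb0.ne']; linarith
        have e5 : 0 ≤ σ ^ (b⁻¹ - 1) := by positivity
        calc b⁻¹ * σ ^ (b⁻¹ - 1) ≤ 1 * σ ^ (b⁻¹ - 1) := by gcongr
          _ ≤ _ := by rw [one_mul]; exact e3.trans e4
    have a2 := integral_comp_line_le (x := p.2) hFs (fun _ => hF0 _) hmu0 hα.le hαβ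
    have hz : (0:ℝ) < 2 ^ (-k) := by positivity
    have a3 := integral_le_maxOp2 (k := k - s) (n := n) (m := m) (by linarith)
      (by have := Int.natCast_nonneg s; linarith) hF hF0 (ρ := |mu| * 2 ^ b) (by positivity)
      (by
        rw [zs]
        have := mul_le_mul_of_nonneg_right hmu' (show (0:ℝ) ≤ 2 ^ b by positivity)
        nlinarith) p.1 p.2
    have hM0 : 0 ≤ maxOp2 m n F p := maxOp2_nonneg m n hF0 p
    have a4 : |mu|⁻¹ * ((2:ℝ) ^ (-(k - s)) * maxOp2 m n F p) ≤ K * (2 ^ s * maxOp2 m n F p) := by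
      rw [zs, inv_mul_le_iff₀ hmupos]
      have := mul_le_mul_of_nonneg_right hmu (show 0 ≤ 2 ^ s * maxOp2 m n F p by positivity)
      linarith
    rw [cavg_eq]
    have a5 : 0 ≤ ∫ t in Icc (1 / 2 : ℝ) 2, F (p - (0 * t, mu * t ^ b)) :=
      integral_nonneg fun _ => hF0 _
    calc _ ≤ ∫ t in Icc (1 / 2 : ℝ) 2, F (p - (0 * t, mu * t ^ b)) := by linarith
      _ ≤ _ := a1
      _ ≤ 2 ^ b * (|mu|⁻¹ * ((2:ℝ) ^ (-(k - s)) * maxOp2 m n F p)) :=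
          mul_le_mul_of_nonneg_left
            (a2.trans (mul_le_mul_of_nonneg_left a3 (by positivity))) (by positivity)
      _ ≤ 2 ^ b * (K * (2 ^ s * maxOp2 m n F p)) := by gcongr
      _ = _ := by ring
  calc _ ≤ _ := step1
    _ ≤ _ := mul_le_mul_of_nonneg_left step2 (by positivity)
    _ = _ := by rw [show (4:ℝ) = 2 * 2 by norm_num, mul_pow]; ring

theorem cavg_E2_le (hb : 1 < b) (hs : 18 * (K * 2 ^ b + 1) < 2 ^ s) (hK : 1 ≤ K)
    (hj : m + s ≤ j) (hjn : j ≤ m + n) (hk : m + s ≤ k) (hkn : k ≤ m + n)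
    (hlam : |lam| = (2:ℝ) ^ (-j)) (hmu' : |mu| ≤ K * 2 ^ (-k)) (hf : Nice f)
    (h0 : ∀ x, 0 ≤ f x) (p : ℝ × ℝ) :
    cavg b lam mu (E2 k f) p ≤
      4 ^ s * (K * 2 ^ b) * maxOp1 m n (maxOp2 m n f) p := by
  have hb0 : 0 < b := by linarith
  have h2b : (1:ℝ) ≤ 2 ^ b := Real.one_le_rpow (by norm_num) hb0.le
  have hK2 : 1 ≤ K * 2 ^ b := one_le_mul_of_one_le_of_one_le hK h2b
  set F := maxOp2 m n f
  have hF : Nice F := maxOp2_nice m n hf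
  have hF0 : ∀ x, 0 ≤ F x := maxOp2_nonneg m n h0
  have hz : (0:ℝ) < 2 ^ (-j) := by positivity
  have hz' : (0:ℝ) < 2 ^ (-k) := by positivity
  have hlpos : 0 < |lam| := hlam ▸ hz
  have hl0 : lam ≠ 0 := abs_pos.1 hlpos
  have zs : ∀ i : ℤ, (2:ℝ) ^ (-(i - s)) = 2 ^ s * 2 ^ (-i) := fun i => by
    rw [neg_sub, sub_eq_add_neg, zpow_add₀ (by norm_num), zpow_natCast]
  have zc : ∀ i : ℤ, (2:ℝ) ^ i * 2 ^ (-i) = 1 := fun i => by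
    rw [← zpow_add₀ (by norm_num), add_neg_cancel, zpow_zero]
  have step1 : cavg b lam mu (E2 k f) p ≤ 2 ^ s * cavg b lam 0 F p := by
    rw [cavg, avg, cavg, avg, ← integral_const_mul]
    refine integral_mono_ae ((niceFam_cavg hb0.le lam mu).integrable (E2_nice k hf) p)
      (((niceFam_cavg hb0.le lam 0).integrable hF p).const_mul _) ?_
    filter_upwards [cmeas_ae] with t ht
    have ht0 : 0 ≤ t := by linarith [ht.1]
    have htb : 0 ≤ t ^ b := Real.rpow_nonneg ht0 b
    change E2 k f (p.1 - lam * t, p.2 - mu * t ^ b) ≤ 2 ^ s * F (p.1 - lam * t, p.2 - 0 * t ^ b)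
    rw [E2_apply]
    have hx : |p.2 - mu * t ^ b - p.2| ≤ (K * 2 ^ b) * 2 ^ (-k) := by
      rw [show p.2 - mu * t ^ b - p.2 = -(mu * t ^ b) by ring, abs_neg, abs_mul,
        abs_of_nonneg htb]
      calc |mu| * t ^ b ≤ (K * 2 ^ (-k)) * 2 ^ b :=
            mul_le_mul hmu' (Real.rpow_le_rpow ht0 ht.2 hb0.le) htb (by positivity)
        _ = _ := by ring
    refine (cexp_le_integral (hf.snd_slice _) (fun _ => h0 _) hx).trans ?_
    have := integral_le_maxOp2 (k := k - s) (n := n) (m := m) (by linarith)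
      (by have := Int.natCast_nonneg s; linarith) hf h0 (ρ := (K * 2 ^ b + 1) * 2 ^ (-k))
      (by positivity) (by rw [zs]; nlinarith) (p.1 - lam * t) p.2
    calc _ ≤ _ := mul_le_mul_of_nonneg_left this (by positivity)
      _ = 2 ^ s * F (p.1 - lam * t, p.2) * (2 ^ k * 2 ^ (-k)) := by rw [zs]; ring
      _ = _ := by rw [zc]; simp
  have step2 : cavg b lam 0 F p ≤ 2 ^ s * maxOp1 m n F p := by
    have hFs : Nice fun x => F (x, p.2) := hF.fst_slice p.2
    have a2 := integral_comp_line_le (x := p.1) hFs (fun _ => hF0 _) hl0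
      (show (0:ℝ) ≤ 1 / 2 by norm_num) (show (1 / 2 : ℝ) ≤ 2 by norm_num)
    have a3 := integral_le_maxOp1 (k := j - s) (n := n) (m := m) (by linarith)
      (by have := Int.natCast_nonneg s; linarith) hF hF0 (ρ := |lam| * 2) (by positivity)
      (by rw [zs, hlam]; nlinarith) p.1 p.2
    have hM0 : 0 ≤ maxOp1 m n F p := maxOp1_nonneg m n hF0 p
    have a5 : 0 ≤ ∫ t in Icc (1 / 2 : ℝ) 2, F (p.1 - lam * t, p.2) :=
      integral_nonneg fun _ => hF0 _
    have e : ∀ t : ℝ, p - (lam * t, 0 * t ^ b) = (p.1 - lam * t, p.2) := fun t => by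
      ext <;> simp
    rw [cavg_eq]
    simp only [e]
    calc _ ≤ ∫ t in Icc (1 / 2 : ℝ) 2, F (p.1 - lam * t, p.2) := by linarith
      _ ≤ |lam|⁻¹ * ((2:ℝ) ^ (-(j - s)) * maxOp1 m n F p) :=
          a2.trans (mul_le_mul_of_nonneg_left a3 (by positivity))
      _ = _ := by rw [zs, hlam]; field_simp
  have hM0 : 0 ≤ maxOp1 m n F p := maxOp1_nonneg m n hF0 p
  calc _ ≤ _ := step1
    _ ≤ 2 ^ s * (2 ^ s * maxOp1 m n F p) := mul_le_mul_of_nonneg_left step2 (by positivity)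
    _ = 4 ^ s * 1 * maxOp1 m n F p := by rw [show (4:ℝ) = 2 * 2 by norm_num, mul_pow]; ring
    _ ≤ _ := by gcongr

end CurveAverage

section Interpolation

theorem lintegral_low {c y a : ℝ} (hc : 0 < c) (hy : 0 ≤ y) (ha : 0 < a) :
    ∫⁻ t in Ioi (0:ℝ), ENNReal.ofReal (if c * t < y then t ^ (a - 1) else 0) ≤
      ENNReal.ofReal (c ^ (-a) / a * y ^ a) := by
  have hyc : 0 ≤ y / c := by positivity
  have e1 : ∀ t ∈ Ioi (0:ℝ), ENNReal.ofReal (if c * t < y then t ^ (a - 1) else 0) =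
      (Ioo 0 (y / c)).indicator (fun t => ENNReal.ofReal (t ^ (a - 1))) t := by
    intro t ht
    have : c * t < y ↔ t ∈ Ioo 0 (y / c) := by
      rw [mem_Ioo, lt_div_iff₀ hc, mul_comm]; exact ⟨fun h => ⟨ht, h⟩, fun h => h.2⟩
    by_cases h : c * t < y
    · rw [if_pos h, indicator_of_mem (this.1 h)]
    · rw [if_neg h, indicator_of_notMem (mt this.2 h), ENNReal.ofReal_zero]
  rw [setLIntegral_congr_fun measurableSet_Ioi e1]
  refine (lintegral_mono' Measure.restrict_le_self le_rfl).trans ?_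
  rw [lintegral_indicator measurableSet_Ioo]
  have hi := (intervalIntegral.intervalIntegrable_rpow' (a := 0) (b := y / c)
    (show -1 < a - 1 by linarith))
  rw [intervalIntegrable_iff_integrableOn_Ioo_of_le hyc] at hi
  rw [← ofReal_integral_eq_lintegral_ofReal hi
    (by filter_upwards [ae_restrict_mem measurableSet_Ioo] with t ht
        exact Real.rpow_nonneg ht.1.le _), ← integral_Ioc_eq_integral_Ioo,
    ← intervalIntegral.integral_of_le hyc, integral_rpow (Or.inl (by linarith)), sub_add_cancel,
    Real.zero_rpow ha.ne', sub_zero, Real.div_rpow hy hc.le, Real.rpow_neg hc.le]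
  refine ENNReal.ofReal_le_ofReal (le_of_eq ?_)
  field_simp

theorem lintegral_high {c y a : ℝ} (hc : 0 < c) (hy : 0 < y) (ha : 0 < a) :
    ∫⁻ t in Ioi (0:ℝ), ENNReal.ofReal (if y ≤ c * t then t ^ (-a - 1) else 0) ≤
      ENNReal.ofReal (c ^ a / a * y ^ (-a)) := by
  have hyc : 0 < y / c := by positivity
  have e1 : ∀ t ∈ Ioi (0:ℝ), ENNReal.ofReal (if y ≤ c * t then t ^ (-a - 1) else 0) =
      (Ici (y / c)).indicator (fun t => ENNReal.ofReal (t ^ (-a - 1))) t := by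
    intro t _
    have : y ≤ c * t ↔ t ∈ Ici (y / c) := by
      rw [mem_Ici, div_le_iff₀ hc, mul_comm]
    by_cases h : y ≤ c * t
    · rw [if_pos h, indicator_of_mem (this.1 h)]
    · rw [if_neg h, indicator_of_notMem (mt this.2 h), ENNReal.ofReal_zero]
  rw [setLIntegral_congr_fun measurableSet_Ioi e1]
  refine (lintegral_mono' Measure.restrict_le_self le_rfl).trans ?_
  rw [lintegral_indicator measurableSet_Ici, setLIntegral_congr Ioi_ae_eq_Ici.symm]
  have hi := integrableOn_Ioi_rpow_of_lt (show -a - 1 < -1 by linarith) hyc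
  rw [← ofReal_integral_eq_lintegral_ofReal hi
    (by filter_upwards [ae_restrict_mem measurableSet_Ioi] with t ht
        exact Real.rpow_nonneg (hyc.trans ht).le _),
    integral_Ioi_rpow_of_lt (by linarith) hyc, sub_add_cancel, Real.div_rpow hy.le hc.le,
    Real.rpow_neg hc.le, Real.rpow_neg hy.le]
  refine ENNReal.ofReal_le_ofReal (le_of_eq ?_)
  have := (Real.rpow_pos_of_pos hc a).ne'
  have := (Real.rpow_pos_of_pos hy a).ne'
  field_simp

theorem meas_lt_abs_le {U : ℝ × ℝ → ℝ} (hU : Nice U) {s t : ℝ} (hs : 0 < s) (ht : 0 < t) :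
    volume {x | t < |U x|} ≤ ENNReal.ofReal (t ^ (-s)) * ENNReal.ofReal (∫ x, |U x| ^ s) := by
  have hts : 0 < t ^ s := Real.rpow_pos_of_pos ht s
  have hUs : Nice fun x => |U x| ^ s := hU.abs.rpow (fun _ => abs_nonneg _) hs
  rw [ofReal_integral_eq_lintegral_ofReal hUs.integrable
    (Eventually.of_forall fun x => Real.rpow_nonneg (abs_nonneg _) _), Real.rpow_neg ht.le,
    ENNReal.ofReal_inv_of_pos hts, mul_comm, ← div_eq_mul_inv,
    ENNReal.le_div_iff_mul_le (Or.inl (by simpa using hts)) (Or.inl ENNReal.ofReal_ne_top), mul_comm]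
  refine le_trans ?_ (mul_meas_ge_le_lintegral₀
    hUs.meas.measurable.ennreal_ofReal.aemeasurable (ENNReal.ofReal (t ^ s)))
  refine mul_le_mul_right (measure_mono fun x hx => ?_) _
  have hx : t < |U x| := hx
  exact ENNReal.ofReal_le_ofReal (Real.rpow_le_rpow ht.le hx.le hs.le)

theorem interpolation {F h : ℝ × ℝ → ℝ} (hF : Nice F) (hF0 : ∀ x, 0 ≤ F x) (hh : Nice h)
    (h0 : ∀ x, 0 ≤ h x) {r0 r r1 A B c : ℝ} (hr0 : 0 < r0) (hr : r0 < r) (hr1 : r < r1)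
    (hA : 0 ≤ A) (hB : 0 ≤ B) (hc : 0 < c)
    (H : ∀ t : ℝ, 0 < t → ∃ U V : ℝ × ℝ → ℝ, Nice U ∧ Nice V ∧ (∀ x, F x ≤ |U x| + |V x|) ∧
      ∫ x, |U x| ^ r0 ≤ A * ∫ x, (if c * t < h x then h x else 0) ^ r0 ∧
      ∫ x, |V x| ^ r1 ≤ B * ∫ x, (if h x ≤ c * t then h x else 0) ^ r1) :
    ∫ x, F x ^ r ≤ 2 ^ r * r * (A * (c ^ (-(r - r0)) / (r - r0)) + B * (c ^ (r1 - r) / (r1 - r))) *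
      ∫ x, h x ^ r := by
  have hrp : 0 < r := hr0.trans hr
  have hr1p : 0 < r1 := hrp.trans hr1
  have hm := hh.meas.measurable
  have hset1 : ∀ t : ℝ, MeasurableSet {x | c * t < h x} := fun t =>
    measurableSet_lt measurable_const hm
  have hset2 : ∀ t : ℝ, MeasurableSet {x | h x ≤ c * t} := fun t =>
    measurableSet_le hm measurable_const
  have hlo : ∀ t, Nice fun x => if c * t < h x then h x else 0 := fun t =>
    hh.indicator (hset1 t)
  have hhi : ∀ t, Nice fun x => if h x ≤ c * t then h x else 0 := fun t =>
    hh.indicator (hset2 t)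
  have hlo0 : ∀ t x, 0 ≤ if c * t < h x then h x else 0 := fun t x => by
    split_ifs; exacts [h0 x, le_rfl]
  have hhi0 : ∀ t x, 0 ≤ if h x ≤ c * t then h x else 0 := fun t x => by
    split_ifs; exacts [h0 x, le_rfl]
  set L : ℝ → ℝ × ℝ → ℝ≥0∞ := fun t x => ENNReal.ofReal (h x ^ r0) *
    ENNReal.ofReal (if c * t < h x then t ^ (r - r0 - 1) else 0) with hL
  set G : ℝ → ℝ × ℝ → ℝ≥0∞ := fun t x => ENNReal.ofReal (h x ^ r1) *
    ENNReal.ofReal (if h x ≤ c * t then t ^ (-(r1 - r) - 1) else 0) with hG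
  have mL : Measurable (Function.uncurry L) := by
    refine ((hm.comp measurable_snd).pow_const r0).ennreal_ofReal.mul
      (Measurable.ennreal_ofReal ?_)
    exact Measurable.ite (measurableSet_lt (measurable_const.mul measurable_fst)
      (hm.comp measurable_snd)) (measurable_fst.pow_const _) measurable_const
  have mG : Measurable (Function.uncurry G) := by
    refine ((hm.comp measurable_snd).pow_const r1).ennreal_ofReal.mul
      (Measurable.ennreal_ofReal ?_)
    exact Measurable.ite (measurableSet_le (hm.comp measurable_snd)
      (measurable_const.mul measurable_fst)) (measurable_fst.pow_const _) measurable_const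
  have key : ∀ t ∈ Ioi (0:ℝ), volume {x | t < F x / 2} * ENNReal.ofReal (t ^ (r - 1)) ≤
      ENNReal.ofReal A * (∫⁻ x, L t x) + ENNReal.ofReal B * ∫⁻ x, G t x := by
    intro t ht
    have ht : 0 < t := ht
    obtain ⟨U, V, hU, hV, hUV, h1, h2⟩ := H t ht
    have s1 : {x | t < F x / 2} ⊆ {x | t < |U x|} ∪ {x | t < |V x|} := by
      intro x hx
      have hx : t < F x / 2 := hx
      by_contra hcon
      rw [mem_union, not_or] at hcon
      have a1 : ¬ t < |U x| := hcon.1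
      have a2 : ¬ t < |V x| := hcon.2
      rw [not_lt] at a1 a2
      linarith [hUV x]
    have s2 := (measure_mono s1).trans (measure_union_le (μ := volume) _ _)
    have e1 : ENNReal.ofReal (t ^ (-r0)) * ENNReal.ofReal (∫ x, |U x| ^ r0) *
        ENNReal.ofReal (t ^ (r - 1)) ≤ ENNReal.ofReal A * ∫⁻ x, L t x := by
      have b1 : ∫⁻ x, L t x = ENNReal.ofReal (t ^ (r - r0 - 1)) *
          ENNReal.ofReal (∫ x, (if c * t < h x then h x else 0) ^ r0) := by
        rw [ofReal_integral_eq_lintegral_ofReal ((hlo t).rpow (hlo0 t) hr0).integrable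
          (Eventually.of_forall fun x => Real.rpow_nonneg (hlo0 t x) _),
          ← lintegral_const_mul' _ _ ENNReal.ofReal_ne_top]
        congr 1; funext x
        by_cases hx : c * t < h x
        · simp only [hL, if_pos hx]; rw [mul_comm]
        · simp only [hL, if_neg hx, Real.zero_rpow hr0.ne', ENNReal.ofReal_zero, mul_zero]
      have b2 : ENNReal.ofReal (t ^ (r - r0 - 1)) =
          ENNReal.ofReal (t ^ (-r0)) * ENNReal.ofReal (t ^ (r - 1)) := by
        rw [← ENNReal.ofReal_mul (by positivity), ← Real.rpow_add ht]
        congr 2; ring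
      have b3 := ENNReal.ofReal_le_ofReal h1
      rw [ENNReal.ofReal_mul hA] at b3
      rw [b1, b2]
      calc _ ≤ ENNReal.ofReal (t ^ (-r0)) * (ENNReal.ofReal A *
            ENNReal.ofReal (∫ x, (if c * t < h x then h x else 0) ^ r0)) *
            ENNReal.ofReal (t ^ (r - 1)) := by gcongr
        _ = _ := by ring
    have e2 : ENNReal.ofReal (t ^ (-r1)) * ENNReal.ofReal (∫ x, |V x| ^ r1) *
        ENNReal.ofReal (t ^ (r - 1)) ≤ ENNReal.ofReal B * ∫⁻ x, G t x := by
      have b1 : ∫⁻ x, G t x = ENNReal.ofReal (t ^ (-(r1 - r) - 1)) *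
          ENNReal.ofReal (∫ x, (if h x ≤ c * t then h x else 0) ^ r1) := by
        rw [ofReal_integral_eq_lintegral_ofReal ((hhi t).rpow (hhi0 t) hr1p).integrable
          (Eventually.of_forall fun x => Real.rpow_nonneg (hhi0 t x) _),
          ← lintegral_const_mul' _ _ ENNReal.ofReal_ne_top]
        congr 1; funext x
        by_cases hx : h x ≤ c * t
        · simp only [hG, if_pos hx]; rw [mul_comm]
        · simp only [hG, if_neg hx, Real.zero_rpow hr1p.ne', ENNReal.ofReal_zero, mul_zero]
      have b2 : ENNReal.ofReal (t ^ (-(r1 - r) - 1)) =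
          ENNReal.ofReal (t ^ (-r1)) * ENNReal.ofReal (t ^ (r - 1)) := by
        rw [← ENNReal.ofReal_mul (by positivity), ← Real.rpow_add ht]
        congr 2; ring
      have b3 := ENNReal.ofReal_le_ofReal h2
      rw [ENNReal.ofReal_mul hB] at b3
      rw [b1, b2]
      calc _ ≤ ENNReal.ofReal (t ^ (-r1)) * (ENNReal.ofReal B *
            ENNReal.ofReal (∫ x, (if h x ≤ c * t then h x else 0) ^ r1)) *
            ENNReal.ofReal (t ^ (r - 1)) := by gcongr
        _ = _ := by ring
    calc _ ≤ (volume {x | t < |U x|} + volume {x | t < |V x|}) * ENNReal.ofReal (t ^ (r - 1)) := by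
          gcongr
      _ ≤ (ENNReal.ofReal (t ^ (-r0)) * ENNReal.ofReal (∫ x, |U x| ^ r0) +
          ENNReal.ofReal (t ^ (-r1)) * ENNReal.ofReal (∫ x, |V x| ^ r1)) *
            ENNReal.ofReal (t ^ (r - 1)) := by
          gcongr
          exacts [meas_lt_abs_le hU hr0 ht, meas_lt_abs_le hV hr1p ht]
      _ ≤ _ := by rw [add_mul]; exact add_le_add e1 e2
  have hFr : Nice fun x => F x ^ r := hF.rpow hF0 hrp
  have hhr : Nice fun x => h x ^ r := hh.rpow h0 hrp
  have hhr0 : 0 ≤ ∫ x, h x ^ r := integral_nonneg fun x => Real.rpow_nonneg (h0 x) _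
  have k1 : 0 ≤ c ^ (-(r - r0)) / (r - r0) :=
    div_nonneg (Real.rpow_nonneg hc.le _) (by linarith)
  have k2 : 0 ≤ c ^ (r1 - r) / (r1 - r) := div_nonneg (Real.rpow_nonneg hc.le _) (by linarith)
  have low : ∫⁻ t in Ioi (0:ℝ), ∫⁻ x, L t x ≤
      ENNReal.ofReal (c ^ (-(r - r0)) / (r - r0)) * ENNReal.ofReal (∫ x, h x ^ r) := by
    rw [lintegral_lintegral_swap mL.aemeasurable, ofReal_integral_eq_lintegral_ofReal
      hhr.integrable (Eventually.of_forall fun x => Real.rpow_nonneg (h0 x) _),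
      ← lintegral_const_mul' _ _ ENNReal.ofReal_ne_top]
    refine lintegral_mono fun x => ?_
    simp only [hL]
    rw [lintegral_const_mul' _ _ ENNReal.ofReal_ne_top]
    refine (mul_le_mul_right (lintegral_low hc (h0 x) (sub_pos.2 hr)) _).trans ?_
    rw [← ENNReal.ofReal_mul (Real.rpow_nonneg (h0 x) _), ← ENNReal.ofReal_mul k1]
    refine ENNReal.ofReal_le_ofReal (le_of_eq ?_)
    rw [show h x ^ r = h x ^ r0 * h x ^ (r - r0) by
      rw [← Real.rpow_add_of_nonneg (h0 x) hr0.le (by linarith)]; congr 1; ring]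
    ring
  have high : ∫⁻ t in Ioi (0:ℝ), ∫⁻ x, G t x ≤
      ENNReal.ofReal (c ^ (r1 - r) / (r1 - r)) * ENNReal.ofReal (∫ x, h x ^ r) := by
    rw [lintegral_lintegral_swap mG.aemeasurable, ofReal_integral_eq_lintegral_ofReal
      hhr.integrable (Eventually.of_forall fun x => Real.rpow_nonneg (h0 x) _),
      ← lintegral_const_mul' _ _ ENNReal.ofReal_ne_top]
    refine lintegral_mono fun x => ?_
    simp only [hG]
    rw [lintegral_const_mul' _ _ ENNReal.ofReal_ne_top]
    rcases (h0 x).eq_or_lt with hx | hx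
    · rw [← hx, Real.zero_rpow hr1p.ne', ENNReal.ofReal_zero, zero_mul]; exact zero_le
    refine (mul_le_mul_right (lintegral_high hc hx (sub_pos.2 hr1)) _).trans ?_
    rw [← ENNReal.ofReal_mul (Real.rpow_nonneg (h0 x) _), ← ENNReal.ofReal_mul k2]
    refine ENNReal.ofReal_le_ofReal (le_of_eq ?_)
    rw [show h x ^ r = h x ^ r1 * h x ^ (-(r1 - r)) by
      rw [← Real.rpow_add hx]; congr 1; ring]
    ring
  have main : ENNReal.ofReal (∫ x, (F x / 2) ^ r) ≤ ENNReal.ofReal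
      (r * (A * (c ^ (-(r - r0)) / (r - r0)) + B * (c ^ (r1 - r) / (r1 - r))) *
        ∫ x, h x ^ r) := by
    have hF2 : ∀ x, 0 ≤ F x / 2 := fun x => by linarith [hF0 x]
    have nF2 : Nice fun x => F x / 2 := by
      have := hF.const_mul (1 / 2)
      refine (congrArg Nice (funext fun x => ?_)).mp this
      ring
    rw [ofReal_integral_eq_lintegral_ofReal (nF2.rpow hF2 hrp).integrable
      (Eventually.of_forall fun x => Real.rpow_nonneg (hF2 x) _),
      lintegral_rpow_eq_lintegral_meas_lt_mul volume (Eventually.of_forall hF2)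
        nF2.meas.measurable.aemeasurable hrp]
    calc _ ≤ ENNReal.ofReal r * ∫⁻ t in Ioi (0:ℝ),
          (ENNReal.ofReal A * (∫⁻ x, L t x) + ENNReal.ofReal B * ∫⁻ x, G t x) := by
          refine mul_le_mul_right ?_ _
          exact setLIntegral_mono_ae' measurableSet_Ioi (Eventually.of_forall key)
      _ ≤ ENNReal.ofReal r * (ENNReal.ofReal A * (ENNReal.ofReal (c ^ (-(r - r0)) / (r - r0)) *
          ENNReal.ofReal (∫ x, h x ^ r)) + ENNReal.ofReal B *
          (ENNReal.ofReal (c ^ (r1 - r) / (r1 - r)) * ENNReal.ofReal (∫ x, h x ^ r))) := by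
          have mL' : Measurable fun t => ENNReal.ofReal A * ∫⁻ x, L t x :=
            (Measurable.lintegral_prod_right' mL).const_mul _
          rw [lintegral_add_left mL',
            lintegral_const_mul' _ _ ENNReal.ofReal_ne_top,
            lintegral_const_mul' _ _ ENNReal.ofReal_ne_top]
          gcongr
      _ = _ := by
          rw [← ENNReal.ofReal_mul k1, ← ENNReal.ofReal_mul k2, ← ENNReal.ofReal_mul hA,
            ← ENNReal.ofReal_mul hB, ← ENNReal.ofReal_add (by positivity) (by positivity),
            ← ENNReal.ofReal_mul hrp.le]
          congr 1; ring
  rw [ENNReal.ofReal_le_ofReal_iff (by positivity)] at main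
  have e : ∫ x, (F x / 2) ^ r = (2 ^ r)⁻¹ * ∫ x, F x ^ r := by
    rw [← integral_const_mul]
    congr 1; funext x
    rw [Real.div_rpow (hF0 x) (by norm_num)]; ring
  rw [e, inv_mul_le_iff₀ (by positivity)] at main
  exact main.trans_eq (by ring)

/-- Interpolation between exponents `2` and `2r` with explicit constants. -/
theorem interpolation_two {F h : ℝ × ℝ → ℝ} (hF : Nice F) (hF0 : ∀ x, 0 ≤ F x) (hh : Nice h)
    (h0 : ∀ x, 0 ≤ h x) {r M0 M1 : ℝ} (hr : 3 ≤ r) (hM0 : 0 < M0) (hM1 : 0 < M1)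
    (H : ∀ t : ℝ, 0 < t → ∃ U V : ℝ × ℝ → ℝ, Nice U ∧ Nice V ∧ (∀ x, F x ≤ |U x| + |V x|) ∧
      ∫ x, |U x| ^ (2:ℝ) ≤ M0 ^ (2:ℝ) * ∫ x, (if t < h x then h x else 0) ^ (2:ℝ) ∧
      ∫ x, |V x| ^ (2 * r) ≤ M1 ^ (2 * r) * ∫ x, (if h x ≤ t then h x else 0) ^ (2 * r)) :
    Ln r F ≤ 4 * (M0 ^ (1 / (r - 1)) * M1 ^ ((r - 2) / (r - 1))) * Ln r h := by
  have hr1 : 0 < r - 1 := by linarith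
  have hr2 : 0 < r - 2 := by linarith
  have hr0 : 0 < r := by linarith
  set Q := M0 ^ (1 / (r - 1)) * M1 ^ ((r - 2) / (r - 1)) with hQ
  have hQ0 : 0 < Q := by positivity
  set c := M0 ^ (1 / (r - 1)) * M1 ^ (-(r / (r - 1))) with hc
  have hc0 : 0 < c := by positivity
  have I := interpolation hF hF0 hh h0 (r0 := 2) (r := r) (r1 := 2 * r) (A := M0 ^ (2:ℝ))
    (B := M1 ^ (2 * r)) (c := c) (by norm_num) (by linarith) (by linarith) (by positivity)
    (by positivity) hc0 fun t ht => H (c * t) (by positivity)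
  have cp : ∀ a : ℝ, c ^ a = M0 ^ (a / (r - 1)) * M1 ^ (-(r / (r - 1)) * a) := by
    intro a
    rw [hc, Real.mul_rpow (by positivity) (by positivity), ← Real.rpow_mul hM0.le,
      ← Real.rpow_mul hM1.le]
    congr 2; ring
  have Qr : Q ^ r = M0 ^ (r / (r - 1)) * M1 ^ ((r - 2) / (r - 1) * r) := by
    rw [hQ, Real.mul_rpow (by positivity) (by positivity), ← Real.rpow_mul hM0.le,
      ← Real.rpow_mul hM1.le]
    congr 2; ring
  have e1 : M0 ^ (2:ℝ) * c ^ (-(r - 2)) = Q ^ r := by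
    rw [cp, Qr, ← mul_assoc, ← Real.rpow_add hM0]
    congr 2 <;> field_simp <;> ring
  have e2 : M1 ^ (2 * r) * c ^ (2 * r - r) = Q ^ r := by
    rw [cp, Qr, mul_comm, mul_assoc, ← Real.rpow_add hM1]
    congr 2 <;> field_simp <;> ring
  have hhr0 : 0 ≤ ∫ x, h x ^ r := integral_nonneg fun x => Real.rpow_nonneg (h0 x) _
  refine Ln_le_of_integral_le hr0 (by positivity) hF0 h0 (I.trans ?_)
  refine mul_le_mul_of_nonneg_right ?_ hhr0
  have e3 : M0 ^ (2:ℝ) * (c ^ (-(r - 2)) / (r - 2)) + M1 ^ (2 * r) * (c ^ (2 * r - r) / (2 * r - r))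
      = Q ^ r * (1 / (r - 2) + 1 / r) := by
    rw [mul_div_assoc', mul_div_assoc', e1, e2, show 2 * r - r = r by ring]; ring
  have e4 : r * (1 / (r - 2) + 1 / r) ≤ 4 := by
    have : 1 / (r - 2) ≤ 3 / r := by
      rw [div_le_div_iff₀ hr2 hr0]; linarith
    calc r * (1 / (r - 2) + 1 / r) ≤ r * (3 / r + 1 / r) := by gcongr
      _ = 4 := by field_simp; norm_num
  have e5 : (4:ℝ) ≤ 2 ^ r := by
    calc (4:ℝ) = 2 ^ (2:ℝ) := by norm_num
      _ ≤ 2 ^ r := Real.rpow_le_rpow_of_exponent_le (by norm_num) (by linarith)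
  rw [e3, Real.mul_rpow (by norm_num) hQ0.le, show (4:ℝ) ^ r = 2 ^ r * 2 ^ r by
    rw [← Real.mul_rpow (by norm_num) (by norm_num)]; norm_num]
  calc 2 ^ r * r * (Q ^ r * (1 / (r - 2) + 1 / r)) = 2 ^ r * Q ^ r * (r * (1 / (r - 2) + 1 / r)) := by
        ring
    _ ≤ 2 ^ r * Q ^ r * 2 ^ r := by gcongr; exact e4.trans e5
    _ = _ := by ring

end Interpolation

section Dyadic

variable {f g : ℝ × ℝ → ℝ} {b : ℝ}

/-- Conditional expectation in both variables. -/
def E12 (L : ℤ) (f : ℝ × ℝ → ℝ) : ℝ × ℝ → ℝ := E1 L (E2 L f)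

/-- Two-parameter martingale difference. -/
def D12 (n n' : ℤ) (f : ℝ × ℝ → ℝ) : ℝ × ℝ → ℝ := D1 n (D2 n' f)

theorem E12_nice (L : ℤ) (hf : Nice f) : Nice (E12 L f) := E1_nice _ (E2_nice _ hf)
theorem D12_nice (n n' : ℤ) (hf : Nice f) : Nice (D12 n n' f) := D1_nice _ (D2_nice _ hf)

theorem E12_nonneg (L : ℤ) (h0 : ∀ x, 0 ≤ f x) (x : ℝ × ℝ) : 0 ≤ E12 L f x :=
  E1_nonneg _ (E2_nonneg _ h0) x

theorem E12_mono (L : ℤ) (hf : Nice f) (hg : Nice g) (h : ∀ x, f x ≤ g x) (x : ℝ × ℝ) :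
    E12 L f x ≤ E12 L g x :=
  avg_mono (niceFam_E1 L) (E2_nice _ hf) (E2_nice _ hg) (avg_mono (niceFam_E2 L) hf hg h) x

theorem E12_sum (L : ℤ) {ι : Type*} (s : Finset ι) {F : ι → ℝ × ℝ → ℝ}
    (hF : ∀ i ∈ s, Nice (F i)) (x : ℝ × ℝ) :
    E12 L (fun x => ∑ i ∈ s, F i x) x = ∑ i ∈ s, E12 L (F i) x := by
  have : E2 L (fun x => ∑ i ∈ s, F i x) = fun x => ∑ i ∈ s, E2 L (F i) x :=
    funext fun x => avg_sum (niceFam_E2 L) s hF x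
  rw [E12, this]
  exact avg_sum (niceFam_E1 L) s (fun i hi => E2_nice _ (hF i hi)) x

theorem E12_sq_le (L : ℤ) (hf : Nice f) (x : ℝ × ℝ) :
    E12 L f x ^ 2 ≤ E12 L (fun x => f x ^ 2) x :=
  (avg_sq_le (niceFam_E1 L) (E2_nice _ hf) x).trans
    (avg_mono (niceFam_E1 L) (E2_nice _ hf).sq (E2_nice _ hf.sq)
      (fun x => avg_sq_le (niceFam_E2 L) hf x) x)

theorem E12_rpow_le (L : ℤ) (hf : Nice f) (h0 : ∀ x, 0 ≤ f x) {r : ℝ} (hr : 1 ≤ r) (x : ℝ × ℝ) :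
    E12 L f x ^ r ≤ E12 L (fun x => f x ^ r) x :=
  (avg_rpow_le (niceFam_E1 L) (E2_nice _ hf) (E2_nonneg _ h0) hr x).trans
    (avg_mono (niceFam_E1 L) ((E2_nice _ hf).rpow (E2_nonneg _ h0) (by linarith))
      (E2_nice _ (hf.rpow h0 (by linarith))) (fun x => avg_rpow_le (niceFam_E2 L) hf h0 hr x) x)

theorem integral_E12 (L : ℤ) (hf : Nice f) : ∫ x, E12 L f x = ∫ x, f x := by
  rw [E12, integral_E1 _ (E2_nice _ hf), integral_E2 _ hf]

theorem integral_E12_adjoint (L : ℤ) (hf : Nice f) (hg : Nice g) :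
    ∫ x, g x * E12 L f x = ∫ x, E12 L g x * f x := by
  rw [E12, integral_E1_adjoint _ (E2_nice _ hf) hg, integral_E2_adjoint _ hf (E1_nice _ hg),
    ← E1_E2_comm _ _ hg, E12]

theorem integral_D12_adjoint (n n' : ℤ) (hf : Nice f) (hg : Nice g) :
    ∫ x, g x * D12 n n' f x = ∫ x, D12 n n' g x * f x := by
  rw [D12, integral_D1_adjoint _ (D2_nice _ hf) hg, integral_D2_adjoint _ hf (D1_nice _ hg),
    ← D1_D2_comm _ _ hg, D12]

theorem E1_E12 {L n : ℤ} (h : L ≤ n) (f : ℝ × ℝ → ℝ) : E1 n (E12 L f) = E12 L f :=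
  E1_E1_of_ge h _

theorem E2_E12 {L n : ℤ} (h : L ≤ n) (hf : Nice f) : E2 n (E12 L f) = E12 L f := by
  rw [E12, E1_E2_comm _ _ hf, E2_E2_of_ge h]

theorem E12_E12 (L : ℤ) (hf : Nice f) : E12 L (E12 L f) = E12 L f := by
  rw [E12, E2_E12 le_rfl hf, E1_E12 le_rfl]

theorem E12_D12 (L n n' : ℤ) (hf : Nice f) : E12 L (D12 n n' f) = D12 n n' (E12 L f) := by
  rw [E12, D12, E2_D1 _ _ (D2_nice _ hf), E2_D2 _ _ hf, E1_D1 _ _ (D2_nice _ (E2_nice _ hf)),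
    E1_D2 _ _ (E2_nice _ hf)]; rfl

theorem D12_D12 (n n' : ℤ) (hf : Nice f) : D12 n n' (D12 n n' f) = D12 n n' f := by
  rw [D12, D12, D1_D2_comm n n' hf, D2_D2 _ (D1_nice _ hf), ← D1_D2_comm n n' hf,
    D1_D1 _ (D2_nice _ hf)]

theorem cavg_D12_decay (hb : 1 < b) : ∃ C : ℝ, 0 ≤ C ∧ ∀ {lam mu δ : ℝ} (L n n' : ℤ)
    {g : ℝ × ℝ → ℝ}, Nice g → lam ≠ 0 → mu ≠ 0 → 0 < δ →
    (C * ((2:ℝ) ^ (-n) / |lam|) ^ (1 / 3 : ℝ) ≤ δ ∨ C * ((2:ℝ) ^ (-n') / |mu|) ^ (1 / 3 : ℝ) ≤ δ) →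
    ∫ p, D12 n n' (E12 L (cavg b (-lam) (-mu) g)) p ^ 2 ≤ δ * ∫ p, g p ^ 2 := by
  obtain ⟨C1, h10, h1⟩ := cavg_decay_fst hb
  obtain ⟨C2, h20, h2⟩ := cavg_decay_snd hb
  have hb0 : 0 ≤ b := by linarith
  refine ⟨max C1 C2, le_max_of_le_left h10, ?_⟩
  intro lam mu δ L n n' g hg hlam hmu hδ hd
  have hA : Nice (cavg b (-lam) (-mu) g) := cavg_nice hb0 _ _ hg
  have hEA := E12_nice L hA
  set q := D12 n n' (E12 L (cavg b (-lam) (-mu) g)) with hq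
  have nq : Nice q := D12_nice _ _ hEA
  have nAq : Nice (cavg b lam mu q) := cavg_nice hb0 _ _ nq
  have q0 : 0 ≤ ∫ p, q p ^ 2 := integral_nonneg fun _ => sq_nonneg _
  have decay : ∫ p, cavg b lam mu q p ^ 2 ≤ δ * ∫ p, q p ^ 2 := by
    rcases hd with hd | hd
    · refine (h1 nq (m := n) ?_ ?_ mu hlam).trans (mul_le_mul_of_nonneg_right (le_trans ?_ hd) q0)
      · exact fun y => lev_mdiff n fun x => D2 n' (E12 L (cavg b (-lam) (-mu) g)) (x, y)
      · exact fun y => cexp_mdiff (by linarith) ((D2_nice n' hEA).fst_slice y)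
      · gcongr; exact le_max_left _ _
    · have e : q = D2 n' (D1 n (E12 L (cavg b (-lam) (-mu) g))) := D1_D2_comm _ _ hEA
      refine (h2 nq (m := n') ?_ ?_ lam hmu).trans
        (mul_le_mul_of_nonneg_right (le_trans ?_ hd) q0)
      · rw [e]
        exact fun x => lev_mdiff n' fun y => D1 n (E12 L (cavg b (-lam) (-mu) g)) (x, y)
      · rw [e]
        exact fun x => cexp_mdiff (by linarith) ((D1_nice n hEA).snd_slice x)
      · gcongr; exact le_max_right _ _
  have self : ∫ p, q p ^ 2 = ∫ p, g p * cavg b lam mu q p := by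
    calc ∫ p, q p ^ 2 = ∫ p, q p * q p := by simp_rw [sq]
      _ = ∫ p, D12 n n' q p * E12 L (cavg b (-lam) (-mu) g) p :=
        integral_D12_adjoint n n' hEA nq
      _ = ∫ p, q p * E12 L (cavg b (-lam) (-mu) g) p := by rw [hq, D12_D12 _ _ hEA]
      _ = ∫ p, E12 L q p * cavg b (-lam) (-mu) g p := integral_E12_adjoint L hA nq
      _ = ∫ p, q p * cavg b (-lam) (-mu) g p := by
        rw [hq, E12_D12 _ _ _ hEA, E12_E12 _ hA]
      _ = ∫ p, cavg b (-lam) (-mu) g p * q p := by simp_rw [mul_comm]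
      _ = _ := (integral_cavg_adjoint hb0 lam mu nq hg).symm
  have am : ∫ p, g p * cavg b lam mu q p ≤ δ / 2 * (∫ p, g p ^ 2) +
      1 / (2 * δ) * ∫ p, cavg b lam mu q p ^ 2 := by
    rw [← integral_const_mul, ← integral_const_mul, ← integral_add
      (hg.sq.const_mul _).integrable (nAq.sq.const_mul _).integrable]
    refine integral_mono (hg.mul nAq).integrable
      ((hg.sq.const_mul _).integrable.add (nAq.sq.const_mul _).integrable) fun p => ?_
    have : δ / 2 * g p ^ 2 + 1 / (2 * δ) * cavg b lam mu q p ^ 2 - g p * cavg b lam mu q p =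
        1 / (2 * δ) * (δ * g p - cavg b lam mu q p) ^ 2 := by field_simp; ring
    have h' : 0 ≤ 1 / (2 * δ) * (δ * g p - cavg b lam mu q p) ^ 2 := by positivity
    simp only
    linarith
  have h3 : 1 / (2 * δ) * ∫ p, cavg b lam mu q p ^ 2 ≤ 1 / 2 * ∫ p, q p ^ 2 := by
    calc _ ≤ 1 / (2 * δ) * (δ * ∫ p, q p ^ 2) := by gcongr
      _ = _ := by field_simp
  linarith

end Dyadic

section Bootstrap

variable {b K : ℝ} {m : ℤ} {N : ℕ} {mu : ℕ × ℕ → ℝ} {L : ℤ} {r : ℝ}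

/-- The averaging operator along the curve at scale `(m + κ.1, m + κ.2)`. -/
def fwd (b : ℝ) (m : ℤ) (mu : ℕ × ℕ → ℝ) (κ : ℕ × ℕ) (f : ℝ × ℝ → ℝ) : ℝ × ℝ → ℝ :=
  cavg b ((2:ℝ) ^ (-(m + (κ.1 : ℤ)))) (mu κ) f

/-- The adjoint of `fwd`. -/
def bwd (b : ℝ) (m : ℤ) (mu : ℕ × ℕ → ℝ) (κ : ℕ × ℕ) (f : ℝ × ℝ → ℝ) : ℝ × ℝ → ℝ :=
  cavg b (-(2:ℝ) ^ (-(m + (κ.1 : ℤ)))) (-mu κ) f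

/-- The square index set. -/
def box (N : ℕ) : Finset (ℕ × ℕ) := Finset.range N ×ˢ Finset.range N

/-- The dual `L^r` inequality with constant `B` for the smoothed operator. -/
def DualBound (b : ℝ) (m : ℤ) (mu : ℕ × ℕ → ℝ) (N : ℕ) (L : ℤ) (r B : ℝ) : Prop :=
  ∀ g : ℕ × ℕ → ℝ × ℝ → ℝ, (∀ κ, Nice (g κ)) → (∀ κ x, 0 ≤ g κ x) →
    ∫ x, E12 L (fun x => ∑ κ ∈ box N, bwd b m mu κ (g κ) x) x ^ r ≤
      B ^ r * ∫ x, (∑ κ ∈ box N, g κ x) ^ r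

theorem fwd_nice (hb : 0 ≤ b) (κ : ℕ × ℕ) {f : ℝ × ℝ → ℝ} (hf : Nice f) : Nice (fwd b m mu κ f) :=
  cavg_nice hb _ _ hf

theorem bwd_nice (hb : 0 ≤ b) (κ : ℕ × ℕ) {f : ℝ × ℝ → ℝ} (hf : Nice f) : Nice (bwd b m mu κ f) :=
  cavg_nice hb _ _ hf

theorem bwd_nonneg (κ : ℕ × ℕ) {f : ℝ × ℝ → ℝ} (h0 : ∀ x, 0 ≤ f x) (x : ℝ × ℝ) :
    0 ≤ bwd b m mu κ f x := cavg_nonneg _ _ h0 x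

theorem integral_fwd (hb : 0 ≤ b) (κ : ℕ × ℕ) {f g : ℝ × ℝ → ℝ} (hf : Nice f) (hg : Nice g) :
    ∫ x, g x * fwd b m mu κ f x = ∫ x, bwd b m mu κ g x * f x :=
  integral_cavg_adjoint hb _ _ hf hg

theorem dualBound_card (hb : 0 ≤ b) (hr : 1 ≤ r) :
    DualBound b m mu N L r ((box N).card : ℝ) := by
  intro g hg g0
  have hr0 : 0 < r := by linarith
  set G : ℝ × ℝ → ℝ := fun x => ∑ κ ∈ box N, g κ x with hG
  have nG : Nice G := Nice.sum _ fun κ _ => hg κ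
  have G0 : ∀ x, 0 ≤ G x := fun x => Finset.sum_nonneg fun κ _ => g0 κ x
  have nT : ∀ κ, Nice (E12 L (bwd b m mu κ G)) := fun κ => E12_nice _ (bwd_nice hb κ nG)
  have T0 : ∀ κ x, 0 ≤ E12 L (bwd b m mu κ G) x := fun κ => E12_nonneg _ (bwd_nonneg κ G0)
  have nW : Nice fun x => ∑ κ ∈ box N, bwd b m mu κ (g κ) x :=
    Nice.sum _ fun κ _ => bwd_nice hb κ (hg κ)
  have h1 : ∀ x, E12 L (fun x => ∑ κ ∈ box N, bwd b m mu κ (g κ) x) x ^ r ≤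
      ((box N).card : ℝ) ^ (r - 1) * ∑ κ ∈ box N, E12 L (bwd b m mu κ G) x ^ r := by
    intro x
    rw [E12_sum _ _ fun κ _ => bwd_nice hb κ (hg κ)]
    refine (Real.rpow_le_rpow (Finset.sum_nonneg fun κ _ => E12_nonneg _ (bwd_nonneg κ (g0 κ)) x)
      (Finset.sum_le_sum fun κ hκ => E12_mono L (bwd_nice hb κ (hg κ)) (bwd_nice hb κ nG)
        (fun y => avg_mono (niceFam_cavg hb _ _) (hg κ) nG (fun z => ?_) y) x) hr0.le).trans ?_
    · exact Finset.single_le_sum (f := fun κ => g κ z) (fun κ _ => g0 κ z) hκ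
    · have := Real.rpow_sum_le_const_mul_sum_rpow (s := box N)
        (f := fun κ => E12 L (bwd b m mu κ G) x) hr
      simp only [abs_of_nonneg (T0 _ x)] at this
      exact this
  have h2 : ∀ κ, ∫ x, E12 L (bwd b m mu κ G) x ^ r ≤ ∫ x, G x ^ r := by
    intro κ
    have n1 : Nice fun x => G x ^ r := nG.rpow G0 hr0
    have n2 := bwd_nice hb κ n1 (m := m) (mu := mu)
    have n3 : Nice (fun x => bwd b m mu κ G x ^ r) :=
      (bwd_nice hb κ nG).rpow (bwd_nonneg κ G0) hr0
    calc _ ≤ ∫ x, E12 L (bwd b m mu κ fun x => G x ^ r) x := by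
          refine integral_mono ((nT κ).rpow (T0 κ) hr0).integrable (E12_nice _ n2).integrable
            fun x => ?_
          refine (E12_rpow_le L (bwd_nice hb κ nG) (bwd_nonneg κ G0) hr x).trans ?_
          exact E12_mono L n3 n2 (fun y => avg_rpow_le (niceFam_cavg hb _ _) nG G0 hr y) x
      _ = _ := by rw [integral_E12 _ n2]; exact integral_cavg hb _ _ n1
  have nTr : ∀ κ ∈ box N, Integrable fun x => E12 L (bwd b m mu κ G) x ^ r :=
    fun κ _ => ((nT κ).rpow (T0 κ) hr0).integrable
  calc _ ≤ ∫ x, ((box N).card : ℝ) ^ (r - 1) * ∑ κ ∈ box N, E12 L (bwd b m mu κ G) x ^ r := by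
        refine integral_mono ((E12_nice _ nW).rpow (E12_nonneg _ fun x => Finset.sum_nonneg
          fun κ _ => bwd_nonneg κ (g0 κ) x) hr0).integrable ?_ h1
        exact (integrable_finsetSum _ nTr).const_mul _
    _ = ((box N).card : ℝ) ^ (r - 1) * ∑ κ ∈ box N, ∫ x, E12 L (bwd b m mu κ G) x ^ r := by
        rw [integral_const_mul, integral_finsetSum _ nTr]
    _ ≤ ((box N).card : ℝ) ^ (r - 1) * ∑ κ ∈ box N, ∫ x, G x ^ r :=
        mul_le_mul_of_nonneg_left (Finset.sum_le_sum fun κ _ => h2 κ) (by positivity)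
    _ = _ := by
        rw [Finset.sum_const, nsmul_eq_mul, ← mul_assoc]
        congr 1
        rcases Nat.eq_zero_or_pos (box N).card with h | h
        · rw [h]; simp [hr0.ne']
        · have : (0:ℝ) < (box N).card := by exact_mod_cast h
          rw [← Real.rpow_add_one this.ne']; congr 1; ring

/-- The block of the dual sum at frequency shift `(a, c)`. -/
def block (b : ℝ) (m : ℤ) (mu : ℕ × ℕ → ℝ) (N : ℕ) (L : ℤ) (a c : ℕ)
    (g : ℕ × ℕ → ℝ × ℝ → ℝ) (x : ℝ × ℝ) : ℝ :=
  ∑ κ ∈ box N, D12 (m + (a + 1) + κ.1) (m + (c + 1) + κ.2) (E12 L (bwd b m mu κ (g κ))) x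

theorem block_nice (hb : 0 ≤ b) (a c : ℕ) {g : ℕ × ℕ → ℝ × ℝ → ℝ} (hg : ∀ κ, Nice (g κ)) :
    Nice (block b m mu N L a c g) :=
  Nice.sum _ fun κ _ => D12_nice _ _ (E12_nice _ (bwd_nice hb κ (hg κ)))

theorem block_add (hb : 0 ≤ b) (a c : ℕ) {g h : ℕ × ℕ → ℝ × ℝ → ℝ} (hg : ∀ κ, Nice (g κ))
    (hh : ∀ κ, Nice (h κ)) (x : ℝ × ℝ) :
    block b m mu N L a c (fun κ x => g κ x + h κ x) x =
      block b m mu N L a c g x + block b m mu N L a c h x := by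
  rw [block, block, block, ← Finset.sum_add_distrib]
  refine Finset.sum_congr rfl fun κ _ => ?_
  have e1 : bwd b m mu κ (fun x => g κ x + h κ x) =
      fun x => bwd b m mu κ (g κ) x + bwd b m mu κ (h κ) x :=
    funext fun x => avg_add (niceFam_cavg hb _ _) (hg κ) (hh κ) x
  have l1 : ∀ (n : ℤ) {u v : ℝ × ℝ → ℝ}, Nice u → Nice v →
      E1 n (fun x => u x + v x) = fun x => E1 n u x + E1 n v x :=
    fun n u v hu hv => funext fun x => avg_add (niceFam_E1 n) hu hv x
  have l2 : ∀ (n : ℤ) {u v : ℝ × ℝ → ℝ}, Nice u → Nice v →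
      E2 n (fun x => u x + v x) = fun x => E2 n u x + E2 n v x :=
    fun n u v hu hv => funext fun x => avg_add (niceFam_E2 n) hu hv x
  have d1 : ∀ (n : ℤ) {u v : ℝ × ℝ → ℝ}, Nice u → Nice v →
      D1 n (fun x => u x + v x) = fun x => D1 n u x + D1 n v x :=
    fun n u v hu hv => by funext x; simp only [D1, l1 _ hu hv]; ring
  have d2 : ∀ (n : ℤ) {u v : ℝ × ℝ → ℝ}, Nice u → Nice v →
      D2 n (fun x => u x + v x) = fun x => D2 n u x + D2 n v x :=
    fun n u v hu hv => by funext x; simp only [D2, l2 _ hu hv]; ring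
  have n1 := bwd_nice hb κ (hg κ) (m := m) (mu := mu)
  have n2 := bwd_nice hb κ (hh κ) (m := m) (mu := mu)
  rw [e1, E12, l2 _ n1 n2, l1 _ (E2_nice _ n1) (E2_nice _ n2), D12,
    d2 _ (E1_nice L (E2_nice L n1)) (E1_nice L (E2_nice L n2)),
    d1 _ (D2_nice _ (E1_nice L (E2_nice L n1))) (D2_nice _ (E1_nice L (E2_nice L n2)))]
  rfl

theorem block_high (hb : 0 ≤ b) (hr : 1 ≤ r) {B : ℝ}
    (H : DualBound b m mu N L r B) (a c : ℕ) {g : ℕ × ℕ → ℝ × ℝ → ℝ} (hg : ∀ κ, Nice (g κ)) :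
    ∫ x, |block b m mu N L a c g x| ^ (2 * r) ≤
      ((16 * (2 * r)) ^ (2 * r)) ^ 2 * (B ^ r * ∫ x, (∑ κ ∈ box N, g κ x ^ 2) ^ r) := by
  have hr0 : 0 < r := by linarith
  have nh : ∀ κ, Nice (E12 L (bwd b m mu κ (g κ))) := fun κ => E12_nice _ (bwd_nice hb κ (hg κ))
  have n2 : ∀ κ, Nice (bwd b m mu κ fun x => g κ x ^ 2) := fun κ => bwd_nice hb κ (hg κ).sq
  have nW : Nice fun x => ∑ κ ∈ box N, bwd b m mu κ (fun x => g κ x ^ 2) x :=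
    Nice.sum _ fun κ _ => n2 κ
  have W0 : ∀ x, 0 ≤ ∑ κ ∈ box N, bwd b m mu κ (fun x => g κ x ^ 2) x := fun x =>
    Finset.sum_nonneg fun κ _ => bwd_nonneg κ (fun _ => sq_nonneg _) x
  have h1 := bdg_two (m + (a + 1)) (m + (c + 1))
    (h := fun i l => E12 L (bwd b m mu (i, l) (g (i, l)))) (fun i l => nh (i, l)) N
    (s := 2 * r) (by linarith)
  simp only [← Finset.sum_product' (Finset.range N) (Finset.range N)
    (fun i l => D1 (m + (a + 1) + (i : ℤ)) (D2 (m + (c + 1) + (l : ℤ))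
      (E12 L (bwd b m mu (i, l) (g (i, l))))) _),
    ← Finset.sum_product' (Finset.range N) (Finset.range N)
    (fun i l => E12 L (bwd b m mu (i, l) (g (i, l))) _ ^ 2)] at h1
  refine h1.trans ?_
  refine mul_le_mul_of_nonneg_left ?_ (by positivity)
  refine le_trans ?_ (H (fun κ x => g κ x ^ 2) (fun κ => (hg κ).sq) fun κ x => sq_nonneg _)
  rw [show 2 * r / 2 = r by ring]
  have ns : Nice fun x => ∑ κ ∈ box N, E12 L (bwd b m mu κ (g κ)) x ^ 2 :=
    Nice.sum _ fun κ _ => (nh κ).sq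
  have s0 : ∀ x, 0 ≤ ∑ κ ∈ box N, E12 L (bwd b m mu κ (g κ)) x ^ 2 := fun x =>
    Finset.sum_nonneg fun κ _ => sq_nonneg _
  refine integral_mono (ns.rpow s0 hr0).integrable
    ((E12_nice L nW).rpow (E12_nonneg L W0) hr0).integrable fun x => ?_
  refine Real.rpow_le_rpow (s0 x) ?_ hr0.le
  rw [E12_sum _ _ fun κ _ => n2 κ]
  refine Finset.sum_le_sum fun κ _ => (E12_sq_le L (bwd_nice hb κ (hg κ)) x).trans ?_
  exact E12_mono L (bwd_nice hb κ (hg κ)).sq (n2 κ)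
    (fun y => avg_sq_le (niceFam_cavg hb _ _) (hg κ) y) x

theorem block_low (hb : 1 < b) (hK : 1 ≤ K) : ∃ C : ℝ, 1 ≤ C ∧ ∀ {m : ℤ} {N : ℕ}
    {mu : ℕ × ℕ → ℝ} {L : ℤ}, (∀ κ : ℕ × ℕ, (2:ℝ) ^ (-(m + (κ.2 : ℤ))) ≤ K * |mu κ|) →
    ∀ (a c : ℕ) {g : ℕ × ℕ → ℝ × ℝ → ℝ}, (∀ κ, Nice (g κ)) →
    ∫ x, |block b m mu N L a c g x| ^ (2:ℝ) ≤
      C * (2:ℝ) ^ (-((a + c : ℝ) / 6)) * ∫ x, ∑ κ ∈ box N, g κ x ^ 2 := by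
  obtain ⟨C, hC, D⟩ := cavg_D12_decay hb
  have hb0 : 0 ≤ b := by linarith
  refine ⟨((16 * 2) ^ (2:ℝ)) ^ 2 * ((C + 1) * K), ?_, ?_⟩
  · have h1 : (1:ℝ) ≤ ((16 * 2) ^ (2:ℝ)) ^ 2 := by norm_num
    have h2 : 1 ≤ (C + 1) * K := one_le_mul_of_one_le_of_one_le (by linarith) hK
    exact one_le_mul_of_one_le_of_one_le h1 h2
  intro m N mu L hmu a c g hg
  set δ := (C + 1) * K * (2:ℝ) ^ (-((a + c : ℝ) / 6)) with hδ
  have hδ0 : 0 < δ := by positivity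
  set q : ℕ × ℕ → ℝ × ℝ → ℝ := fun κ =>
    D12 (m + (a + 1) + κ.1) (m + (c + 1) + κ.2) (E12 L (bwd b m mu κ (g κ))) with hq
  have nq : ∀ κ, Nice (q κ) := fun κ => D12_nice _ _ (E12_nice _ (bwd_nice hb0 κ (hg κ)))
  have h1 := bdg_two (m + (a + 1)) (m + (c + 1))
    (h := fun i l => q (i, l)) (fun i l => nq (i, l)) N (s := 2) (by norm_num)
  have pw : ∀ n : ℕ, ((2:ℝ) ^ (-((n : ℤ) + 1))) = 2 ^ (-((n : ℝ) + 1)) := by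
    intro n
    rw [← Real.rpow_intCast]; push_cast; rfl
  have third : ∀ n : ℕ, (a + c : ℝ) ≤ 2 * n →
      ((2:ℝ) ^ (-((n : ℤ) + 1))) ^ (1 / 3 : ℝ) ≤ 2 ^ (-((a + c : ℝ) / 6)) := by
    intro n hn
    rw [pw, ← Real.rpow_mul (by norm_num)]
    exact Real.rpow_le_rpow_of_exponent_le (by norm_num) (by linarith)
  have dec : ∀ κ, ∫ x, q κ x ^ 2 ≤ δ * ∫ x, g κ x ^ 2 := by
    intro κ
    have hmu0 : mu κ ≠ 0 := by
      intro h
      have := hmu κ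
      rw [h, abs_zero, mul_zero] at this
      exact absurd this (not_le.2 (by positivity))
    refine D L _ _ (hg κ) (by positivity) hmu0 hδ0 ?_
    rcases le_total c a with hac | hac
    · left
      have e : (2:ℝ) ^ (-(m + ((a:ℤ) + 1) + (κ.1 : ℤ))) / |(2:ℝ) ^ (-(m + (κ.1 : ℤ)))| =
          2 ^ (-((a : ℤ) + 1)) := by
        rw [abs_of_pos (by positivity), div_eq_iff (by positivity), ← zpow_add₀ (by norm_num)]
        congr 1; ring
      rw [e]
      have := third a (by have : (c:ℝ) ≤ a := by exact_mod_cast hac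
                          linarith)
      calc _ ≤ C * (2:ℝ) ^ (-((a + c : ℝ) / 6)) := by gcongr
        _ ≤ _ := by
          rw [hδ]; gcongr
          nlinarith
    · right
      have e : (2:ℝ) ^ (-(m + ((c:ℤ) + 1) + (κ.2 : ℤ))) / |mu κ| ≤ K * 2 ^ (-((c : ℤ) + 1)) := by
        rw [div_le_iff₀ (abs_pos.2 hmu0)]
        calc (2:ℝ) ^ (-(m + ((c:ℤ) + 1) + (κ.2 : ℤ))) =
            2 ^ (-((c : ℤ) + 1)) * 2 ^ (-(m + (κ.2 : ℤ))) := by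
              rw [← zpow_add₀ (by norm_num)]; congr 1; ring
          _ ≤ 2 ^ (-((c : ℤ) + 1)) * (K * |mu κ|) := by gcongr; exact hmu κ
          _ = _ := by ring
      have := third c (by have : (a:ℝ) ≤ c := by exact_mod_cast hac
                          linarith)
      have K3 : K ^ (1 / 3 : ℝ) ≤ K := by
        calc K ^ (1 / 3 : ℝ) ≤ K ^ (1 : ℝ) :=
              Real.rpow_le_rpow_of_exponent_le hK (by norm_num)
          _ = K := Real.rpow_one K
      calc _ ≤ C * (K * 2 ^ (-((c : ℤ) + 1))) ^ (1 / 3 : ℝ) := by gcongr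
        _ = C * (K ^ (1 / 3 : ℝ) * (2 ^ (-((c : ℤ) + 1))) ^ (1 / 3 : ℝ)) := by
          rw [Real.mul_rpow (by linarith) (by positivity)]
        _ ≤ (C + 1) * (K * (2:ℝ) ^ (-((a + c : ℝ) / 6))) := by gcongr; linarith
        _ = _ := by rw [hδ]; ring
  have e1 : ∀ x, ∑ i ∈ Finset.range N, ∑ l ∈ Finset.range N,
      D1 (m + (a + 1) + (i : ℤ)) (D2 (m + (c + 1) + (l : ℤ)) (q (i, l))) x =
      block b m mu N L a c g x := by
    intro x
    rw [block, box, Finset.sum_product]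
    refine Finset.sum_congr rfl fun i _ => Finset.sum_congr rfl fun l _ => ?_
    exact congrFun (D12_D12 _ _ (E12_nice _ (bwd_nice hb0 (i, l) (hg (i, l))))) x
  have e2 : ∀ x, ∑ i ∈ Finset.range N, ∑ l ∈ Finset.range N, q (i, l) x ^ 2 =
      ∑ κ ∈ box N, q κ x ^ 2 := by
    intro x
    rw [box, Finset.sum_product]
  simp only [e1, e2] at h1
  refine h1.trans ?_
  rw [mul_assoc, mul_assoc]
  refine mul_le_mul_of_nonneg_left ?_ (by positivity)
  simp only [div_self (two_ne_zero' ℝ), Real.rpow_one]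
  rw [integral_finsetSum _ fun κ _ => (nq κ).sq.integrable,
    integral_finsetSum _ fun κ _ => (hg κ).sq.integrable, ← mul_assoc, Finset.mul_sum]
  exact Finset.sum_le_sum fun κ _ => dec κ

end Bootstrap

section Bootstrap

variable {b K : ℝ} {m : ℤ} {N : ℕ} {mu : ℕ × ℕ → ℝ} {L : ℤ} {r : ℝ}

theorem DualBound.mono {B B' : ℝ} (hB : 0 ≤ B) (hBB : B ≤ B') (hr : 0 ≤ r)
    (H : DualBound b m mu N L r B) : DualBound b m mu N L r B' := fun g hg g0 =>
  (H g hg g0).trans (mul_le_mul_of_nonneg_right (Real.rpow_le_rpow hB hBB hr)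
    (integral_nonneg fun x => Real.rpow_nonneg (Finset.sum_nonneg fun κ _ => g0 κ x) _))

theorem block_Ln (hb : 1 < b) (hK : 1 ≤ K) : ∃ C : ℝ, 1 ≤ C ∧ ∀ {m : ℤ} {N : ℕ}
    {mu : ℕ × ℕ → ℝ} {L : ℤ} {r B : ℝ},
    (∀ κ : ℕ × ℕ, (2:ℝ) ^ (-(m + (κ.2 : ℤ))) ≤ K * |mu κ|) → 3 ≤ r → 1 ≤ B →
    DualBound b m mu N L r B →
    ∀ (a c : ℕ) {g : ℕ × ℕ → ℝ × ℝ → ℝ}, (∀ κ, Nice (g κ)) → (∀ κ x, 0 ≤ g κ x) →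
    Ln r (fun x => |block b m mu N L a c g x|) ≤ C * (r ^ 2 * B ^ (1 / 2 : ℝ)) *
      (((1 / 2 : ℝ) ^ (1 / (12 * (r - 1)))) ^ a * ((1 / 2 : ℝ) ^ (1 / (12 * (r - 1)))) ^ c) *
      Ln r fun x => ∑ κ ∈ box N, g κ x := by
  obtain ⟨C, hC, D⟩ := block_low hb hK
  have hb0 : 0 ≤ b := by linarith
  refine ⟨4 * C * 32 ^ 2, by nlinarith, ?_⟩
  intro m N mu L r B hmu hr hB H a c g hg g0
  have hr1 : 0 < r - 1 := by linarith
  have hr2 : 0 < r - 2 := by linarith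
  set G : ℝ × ℝ → ℝ := fun x => ∑ κ ∈ box N, g κ x with hG
  have nG : Nice G := Nice.sum _ fun κ _ => hg κ
  have G0 : ∀ x, 0 ≤ G x := fun x => Finset.sum_nonneg fun κ _ => g0 κ x
  set M0 := C * (2:ℝ) ^ (-((a + c : ℝ) / 12)) with hM0
  set M1 := (32 * r) ^ (2:ℝ) * B ^ (1 / 2 : ℝ) with hM1
  have hM00 : 0 < M0 := by positivity
  have hM11 : 1 ≤ M1 := one_le_mul_of_one_le_of_one_le
    (Real.one_le_rpow (by linarith) (by norm_num)) (Real.one_le_rpow hB (by norm_num))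
  have I := interpolation_two (F := fun x => |block b m mu N L a c g x|) (h := G)
    (block_nice hb0 a c hg).abs (fun _ => abs_nonneg _) nG G0 hr hM00 (by linarith : 0 < M1) ?_
  · refine I.trans (mul_le_mul_of_nonneg_right ?_ (Ln_nonneg G0))
    have e1 : M0 ^ (1 / (r - 1)) ≤ C * (((1 / 2 : ℝ) ^ (1 / (12 * (r - 1)))) ^ a *
        ((1 / 2 : ℝ) ^ (1 / (12 * (r - 1)))) ^ c) := by
      rw [hM0, Real.mul_rpow (by linarith) (by positivity)]
      have c1 : C ^ (1 / (r - 1)) ≤ C := by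
        calc C ^ (1 / (r - 1)) ≤ C ^ (1:ℝ) := by
              refine Real.rpow_le_rpow_of_exponent_le hC ?_
              rw [div_le_one hr1]; linarith
          _ = C := Real.rpow_one C
      refine mul_le_mul c1 (le_of_eq ?_) (by positivity) (by linarith)
      rw [← pow_add, ← Real.rpow_natCast, ← Real.rpow_mul (by norm_num),
        ← Real.rpow_mul (by norm_num), one_div (2:ℝ), Real.inv_rpow (by norm_num), ← Real.rpow_neg (by norm_num)]
      congr 1; push_cast; field_simp
    have e2 : M1 ^ ((r - 2) / (r - 1)) ≤ M1 := by
      calc M1 ^ ((r - 2) / (r - 1)) ≤ M1 ^ (1:ℝ) := by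
            refine Real.rpow_le_rpow_of_exponent_le hM11 ?_
            rw [div_le_one hr1]; linarith
        _ = M1 := Real.rpow_one M1
    calc _ ≤ 4 * ((C * (((1 / 2 : ℝ) ^ (1 / (12 * (r - 1)))) ^ a *
        ((1 / 2 : ℝ) ^ (1 / (12 * (r - 1)))) ^ c)) * M1) := by gcongr
      _ = _ := by
        rw [hM1, Real.rpow_two]; ring
  · intro t ht
    set g1 : ℕ × ℕ → ℝ × ℝ → ℝ := fun κ x => if t < G x then g κ x else 0 with hg1
    set g2 : ℕ × ℕ → ℝ × ℝ → ℝ := fun κ x => if G x ≤ t then g κ x else 0 with hg2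
    have n1 : ∀ κ, Nice (g1 κ) := fun κ =>
      (hg κ).indicator (measurableSet_lt measurable_const nG.meas.measurable)
    have n2 : ∀ κ, Nice (g2 κ) := fun κ =>
      (hg κ).indicator (measurableSet_le nG.meas.measurable measurable_const)
    have g10 : ∀ κ x, 0 ≤ g1 κ x := fun κ x => by
      simp only [hg1]; split_ifs; exacts [g0 κ x, le_rfl]
    have g20 : ∀ κ x, 0 ≤ g2 κ x := fun κ x => by
      simp only [hg2]; split_ifs; exacts [g0 κ x, le_rfl]
    have s1 : ∀ x, ∑ κ ∈ box N, g1 κ x = if t < G x then G x else 0 := fun x => by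
      simp only [hg1]; split_ifs
      · rfl
      · exact Finset.sum_const_zero
    have s2 : ∀ x, ∑ κ ∈ box N, g2 κ x = if G x ≤ t then G x else 0 := fun x => by
      simp only [hg2]; split_ifs
      · rfl
      · exact Finset.sum_const_zero
    have nS1 : Nice fun x => if t < G x then G x else 0 :=
      nG.indicator (measurableSet_lt measurable_const nG.meas.measurable)
    have nS2 : Nice fun x => if G x ≤ t then G x else 0 :=
      nG.indicator (measurableSet_le nG.meas.measurable measurable_const)
    refine ⟨block b m mu N L a c g1, block b m mu N L a c g2, block_nice hb0 a c n1,
      block_nice hb0 a c n2, fun x => ?_, ?_, ?_⟩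
    · have e : g = fun κ x => g1 κ x + g2 κ x := by
        funext κ x
        simp only [hg1, hg2]
        rcases lt_or_ge t (G x) with h | h
        · rw [if_pos h, if_neg (not_le.2 h), add_zero]
        · rw [if_neg (not_lt.2 h), if_pos h, zero_add]
      have e' : block b m mu N L a c g x =
          block b m mu N L a c g1 x + block b m mu N L a c g2 x := by
        conv_lhs => rw [e]
        exact block_add hb0 a c n1 n2 x
      simp only [e']
      exact abs_add_le _ _
    · refine (D hmu a c n1).trans ?_
      have q1 : ∫ x, ∑ κ ∈ box N, g1 κ x ^ 2 ≤ ∫ x, (if t < G x then G x else 0) ^ (2:ℝ) := by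
        refine integral_mono (Nice.sum _ fun κ _ => (n1 κ).sq).integrable ?_ fun x => ?_
        · simp only [Real.rpow_two]; exact nS1.sq.integrable
        · simp only [Real.rpow_two, ← s1]
          exact Finset.sum_sq_le_sq_sum_of_nonneg fun κ _ => g10 κ x
      refine mul_le_mul ?_ q1
        (integral_nonneg fun x => Finset.sum_nonneg fun κ _ => sq_nonneg _) (by positivity)
      rw [hM0, Real.rpow_two, mul_pow, ← Real.rpow_natCast ((2:ℝ) ^ (-((a + c : ℝ) / 12))),
        ← Real.rpow_mul (by norm_num)]
      refine mul_le_mul (by nlinarith) (le_of_eq ?_) (by positivity) (by positivity)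
      congr 1; push_cast; ring
    · refine (block_high hb0 (by linarith) H a c n2).trans ?_
      have q1 : ∫ x, (∑ κ ∈ box N, g2 κ x ^ 2) ^ r ≤
          ∫ x, (if G x ≤ t then G x else 0) ^ (2 * r) := by
        refine integral_mono ((Nice.sum _ fun κ _ => (n2 κ).sq).rpow
          (fun x => Finset.sum_nonneg fun κ _ => sq_nonneg _) (by linarith)).integrable
          (nS2.rpow (fun x => ?_) (by linarith)).integrable fun x => ?_
        · rw [← s2]; exact Finset.sum_nonneg fun κ _ => g20 κ x
        · simp only [← s2]
          rw [Real.rpow_mul (Finset.sum_nonneg fun κ _ => g20 κ x), Real.rpow_two]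
          exact Real.rpow_le_rpow (Finset.sum_nonneg fun κ _ => sq_nonneg _)
            (Finset.sum_sq_le_sq_sum_of_nonneg fun κ _ => g20 κ x) (by linarith)
      rw [← mul_assoc]
      refine mul_le_mul (le_of_eq ?_) q1 (integral_nonneg fun x =>
        Real.rpow_nonneg (Finset.sum_nonneg fun κ _ => sq_nonneg _) _) (by positivity)
      rw [hM1, Real.mul_rpow (x := (32 * r) ^ (2:ℝ)) (by positivity) (by positivity),
        ← Real.rpow_mul (by linarith), ← Real.rpow_mul (by linarith),
        ← Real.rpow_natCast ((16 * (2 * r)) ^ (2 * r)), ← Real.rpow_mul (by linarith)]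
      congr 2
      · ring
      · push_cast; ring
      · ring

theorem sum_theta_le (hr : 3 ≤ r) (A : ℕ) :
    ∑ a ∈ Finset.range A, ((1 / 2 : ℝ) ^ (1 / (12 * (r - 1)))) ^ a ≤ 24 * r := by
  have hr1 : 0 < r - 1 := by linarith
  have hy : 1 / (12 * (r - 1)) ≤ 1 := by
    rw [div_le_one (by linarith)]; linarith
  have h := _root_.rpow_one_add_le_one_add_mul_self (s := -(1 / 2)) (by norm_num)
    (p := 1 / (12 * (r - 1))) (by positivity) hy
  rw [show (1:ℝ) + -(1 / 2) = 1 / 2 by norm_num] at h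
  set θ := (1 / 2 : ℝ) ^ (1 / (12 * (r - 1)))
  have hθ0 : 0 ≤ θ := by positivity
  have h2 : 1 / (24 * r) ≤ 1 - θ := by
    have : 1 / (24 * r) ≤ 1 / (12 * (r - 1)) * (1 / 2) := by
      rw [← one_div_mul_one_div, one_div_mul_one_div, one_div_mul_one_div]
      exact one_div_le_one_div_of_le (by linarith) (by linarith)
    linarith
  have h3 : 0 < 1 / (24 * r) := by positivity
  calc _ ≤ ∑' a, θ ^ a := Summable.sum_le_tsum _ (fun _ _ => by positivity)
        (summable_geometric_of_lt_one hθ0 (by linarith))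
    _ = (1 - θ)⁻¹ := tsum_geometric_of_lt_one hθ0 (by linarith)
    _ ≤ (1 / (24 * r))⁻¹ := inv_anti₀ h3 h2
    _ = _ := by rw [one_div, inv_inv]

theorem le_E1_add_E2_add_sum {f : ℝ × ℝ → ℝ} (hf : Nice f) (h0 : ∀ x, 0 ≤ f x) {j k : ℤ} {A : ℕ}
    (h1 : E1 (j + A) f = f) (h2 : E2 (k + A) f = f) (x : ℝ × ℝ) :
    f x ≤ E1 j f x + E2 k f x +
      ∑ a ∈ Finset.range A, ∑ c ∈ Finset.range A, D12 (j + (a + 1)) (k + (c + 1)) f x := by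
  have e1 : ∀ n : ℤ, ∑ c ∈ Finset.range A, D12 n (k + (c + 1)) f x =
      D1 n f x - D1 n (E2 k f) x := by
    intro n
    simp only [D12, D1_D2_comm n _ hf]
    rw [E2_sub_telescope, E2_D1 _ _ hf, E2_D1 _ _ hf, h2]
  simp only [e1, Finset.sum_sub_distrib]
  rw [E1_sub_telescope, E1_sub_telescope, h1, E1_E2_comm _ _ hf, h1]
  have := E1_nonneg j (E2_nonneg k h0) x
  linarith

end Bootstrap

section Bootstrap

variable {b K : ℝ} {m : ℤ} {N : ℕ} {mu : ℕ × ℕ → ℝ} {L : ℤ} {r : ℝ}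

theorem fwd_sum (hb : 0 ≤ b) {ι : Type*} (s : Finset ι) (κ : ℕ × ℕ) {F : ι → ℝ × ℝ → ℝ}
    (hF : ∀ i ∈ s, Nice (F i)) (x : ℝ × ℝ) :
    fwd b m mu κ (fun x => ∑ i ∈ s, F i x) x = ∑ i ∈ s, fwd b m mu κ (F i) x :=
  avg_sum (niceFam_cavg hb _ _) s hF x

theorem fwd_mono (hb : 0 ≤ b) (κ : ℕ × ℕ) {f g : ℝ × ℝ → ℝ} (hf : Nice f) (hg : Nice g)
    (h : ∀ x, f x ≤ g x) (x : ℝ × ℝ) : fwd b m mu κ f x ≤ fwd b m mu κ g x :=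
  avg_mono (niceFam_cavg hb _ _) hf hg h x

theorem fwd_add (hb : 0 ≤ b) (κ : ℕ × ℕ) {f g : ℝ × ℝ → ℝ} (hf : Nice f) (hg : Nice g)
    (x : ℝ × ℝ) :
    fwd b m mu κ (fun x => f x + g x) x = fwd b m mu κ f x + fwd b m mu κ g x :=
  avg_add (niceFam_cavg hb _ _) hf hg x

theorem integral_fwd_D12 (hb : 0 ≤ b) (κ : ℕ × ℕ) (n n' : ℤ) {f g : ℝ × ℝ → ℝ} (hf : Nice f)
    (hg : Nice g) (hL : E12 L f = f) :
    ∫ x, g x * fwd b m mu κ (D12 n n' f) x =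
      ∫ x, D12 n n' (E12 L (bwd b m mu κ g)) x * f x := by
  have nb := bwd_nice hb κ hg (m := m) (mu := mu)
  rw [integral_fwd hb κ (D12_nice _ _ hf) hg,
    ← integral_D12_adjoint _ _ hf (E12_nice L nb),
    ← integral_E12_adjoint _ (D12_nice _ _ hf) nb, E12_D12 _ _ _ hf, hL]

theorem E1_rpow_E12 {n : ℤ} (hn : L ≤ n) (W : ℝ × ℝ → ℝ) (q : ℝ) :
    E1 n (fun x => E12 L W x ^ q) = fun x => E12 L W x ^ q := by
  refine E1_eq_of_lev fun y x x' h => ?_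
  exact congrArg (· ^ q) ((lev_cexp L fun x => E2 L W (x, y)).mono hn x x' h)

theorem E2_rpow_E12 {n : ℤ} (hn : L ≤ n) {W : ℝ × ℝ → ℝ} (hW : Nice W) (q : ℝ) :
    E2 n (fun x => E12 L W x ^ q) = fun x => E12 L W x ^ q := by
  have e : E12 L W = E2 L (E1 L W) := E1_E2_comm _ _ hW
  rw [e]
  funext ⟨x, y⟩
  have : Lev n fun y => E2 L (E1 L W) (x, y) ^ q := fun y y' h =>
    congrArg (· ^ q) ((lev_cexp L fun y => E1 L W (x, y)).mono hn y y' h)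
  rw [E2_apply, this.cexp_eq]

theorem fwd_E1_le (hb : 1 < b) (hK : 1 ≤ K) : ∃ (s : ℕ) (C : ℝ), 0 ≤ C ∧ ∀ {m : ℤ} {N : ℕ}
    {mu : ℕ × ℕ → ℝ}, (∀ κ : ℕ × ℕ, (2:ℝ) ^ (-(m + (κ.2 : ℤ))) ≤ K * |mu κ|) →
    (∀ κ : ℕ × ℕ, |mu κ| ≤ K * (2:ℝ) ^ (-(m + (κ.2 : ℤ)))) →
    ∀ κ ∈ box N, ∀ {f : ℝ × ℝ → ℝ}, Nice f → (∀ x, 0 ≤ f x) → ∀ x,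
      fwd b m mu κ (E1 (m + κ.1) f) x + fwd b m mu κ (E2 (m + κ.2) f) x ≤
        C * (maxOp2 (m - s) (N + s) (maxOp1 (m - s) (N + s) f) x +
          maxOp1 (m - s) (N + s) (maxOp2 (m - s) (N + s) f) x) := by
  obtain ⟨s, hs⟩ := pow_unbounded_of_one_lt (18 * (K * 2 ^ b + 1)) (one_lt_two (α := ℝ))
  have h2b : 0 < (2:ℝ) ^ b := by positivity
  refine ⟨s, 4 ^ s * (K * 2 ^ b), by positivity, ?_⟩
  intro m N mu hmu hmu' κ hκ f hf h0 x
  simp only [box, Finset.mem_product, Finset.mem_range] at hκ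
  have lam : |(2:ℝ) ^ (-(m + (κ.1 : ℤ)))| = 2 ^ (-(m + (κ.1 : ℤ))) := abs_of_pos (by positivity)
  have a1 := cavg_E1_le hb hs hK (m := m - s) (n := N + s) (j := m + κ.1) (k := m + κ.2)
    (by omega) (by push_cast; omega) (by omega) (by push_cast; omega) lam (hmu κ) (hmu' κ) hf h0 x
  have a2 := cavg_E2_le hb hs hK (m := m - s) (n := N + s) (j := m + κ.1) (k := m + κ.2)
    (by omega) (by push_cast; omega) (by omega) (by push_cast; omega) lam (hmu' κ) hf h0 x
  rw [mul_add]
  exact add_le_add a1 a2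

theorem dual_step (hb : 1 < b) (hK : 1 ≤ K) : ∃ C : ℝ, 1 ≤ C ∧ ∀ {m : ℤ} {N : ℕ}
    {mu : ℕ × ℕ → ℝ} {L : ℤ} {r B : ℝ},
    (∀ κ : ℕ × ℕ, (2:ℝ) ^ (-(m + (κ.2 : ℤ))) ≤ K * |mu κ|) →
    (∀ κ : ℕ × ℕ, |mu κ| ≤ K * (2:ℝ) ^ (-(m + (κ.2 : ℤ)))) → 3 ≤ r → 1 ≤ B →
    DualBound b m mu N L r B → DualBound b m mu N L r (C * (r ^ 2 + r ^ 4 * B ^ (1 / 2 : ℝ))) := by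
  obtain ⟨C, hC, HB⟩ := block_Ln hb hK
  obtain ⟨s, c, hc, HM⟩ := fwd_E1_le hb hK
  have hb0 : 0 ≤ b := by linarith
  refine ⟨8 * c + 576 * C, by linarith, ?_⟩
  intro m N mu L r B hmu hmu' hr hB H g hg g0
  have hr0 : 0 < r := by linarith
  have hr1 : 0 < r - 1 := by linarith
  set p := r / (r - 1) with hp
  have hp1 : 1 < p := by rw [hp, one_lt_div hr1]; linarith
  have hpr : p / (p - 1) = r := by rw [hp]; field_simp; ring
  have hconj : r.HolderConjugate p := Real.HolderConjugate.conjExponent (by linarith)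
  set G : ℝ × ℝ → ℝ := fun x => ∑ κ ∈ box N, g κ x with hG
  have nG : Nice G := Nice.sum _ fun κ _ => hg κ
  have G0 : ∀ x, 0 ≤ G x := fun x => Finset.sum_nonneg fun κ _ => g0 κ x
  have nb : ∀ κ, Nice (bwd b m mu κ (g κ)) := fun κ => bwd_nice hb0 κ (hg κ)
  set W : ℝ × ℝ → ℝ := fun x => ∑ κ ∈ box N, bwd b m mu κ (g κ) x with hW
  have nW : Nice W := Nice.sum _ fun κ _ => nb κ
  have W0 : ∀ x, 0 ≤ W x := fun x => Finset.sum_nonneg fun κ _ => bwd_nonneg κ (g0 κ) x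
  have nw : Nice (E12 L W) := E12_nice L nW
  have w0 : ∀ x, 0 ≤ E12 L W x := E12_nonneg L W0
  set f : ℝ × ℝ → ℝ := fun x => E12 L W x ^ (r - 1) with hf
  have nf : Nice f := nw.rpow w0 hr1
  have f0 : ∀ x, 0 ≤ f x := fun x => Real.rpow_nonneg (w0 x) _
  have f1 : ∀ n : ℤ, L ≤ n → E1 n f = f := fun n hn => E1_rpow_E12 hn W _
  have f2 : ∀ n : ℤ, L ≤ n → E2 n f = f := fun n hn => E2_rpow_E12 hn nW _
  have fL : E12 L f = f := by rw [E12, f2 L le_rfl, f1 L le_rfl]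
  have X1 : ∫ x, E12 L W x ^ r = ∑ κ ∈ box N, ∫ x, g κ x * fwd b m mu κ f x := by
    calc ∫ x, E12 L W x ^ r = ∫ x, f x * E12 L W x := by
          congr 1; funext x
          rw [hf]; simp only
          rw [← Real.rpow_add_one' (w0 x) (by linarith), sub_add_cancel]
      _ = ∫ x, f x * W x := by rw [integral_E12_adjoint L nW nf, fL]
      _ = ∫ x, ∑ κ ∈ box N, bwd b m mu κ (g κ) x * f x := by
          congr 1; funext x
          rw [hW]; simp only
          rw [mul_comm, Finset.sum_mul]
      _ = ∑ κ ∈ box N, ∫ x, bwd b m mu κ (g κ) x * f x :=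
          integral_finsetSum _ fun κ _ => ((nb κ).mul nf).integrable
      _ = _ := Finset.sum_congr rfl fun κ _ => (integral_fwd hb0 κ nf (hg κ)).symm
  set A := (L - m).toNat with hA
  have hAL : L ≤ m + A := by omega
  set M1 := maxOp2 (m - s) (N + s) (maxOp1 (m - s) (N + s) f) with hM1
  set M2 := maxOp1 (m - s) (N + s) (maxOp2 (m - s) (N + s) f) with hM2
  have nM1' := maxOp1_nice (m - s) (N + s) nf
  have nM2' := maxOp2_nice (m - s) (N + s) nf
  have nM1 : Nice M1 := maxOp2_nice _ _ nM1'
  have nM2 : Nice M2 := maxOp1_nice _ _ nM2'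
  have M1'0 := maxOp1_nonneg (m - s) (N + s) f0
  have M2'0 := maxOp2_nonneg (m - s) (N + s) f0
  have M10 : ∀ x, 0 ≤ M1 x := maxOp2_nonneg _ _ M1'0
  have M20 : ∀ x, 0 ≤ M2 x := maxOp1_nonneg _ _ M2'0
  have hf0 : 0 ≤ Ln p f := Ln_nonneg f0
  have LM1 : Ln p M1 ≤ 4 * r ^ 2 * Ln p f := by
    have h1 := Ln_maxOp2_le hp1 (m - s) (N + s) nM1' M1'0
    have h2 := Ln_maxOp1_le hp1 (m - s) (N + s) nf f0
    rw [hpr] at h1 h2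
    calc _ ≤ 2 * r * (2 * r * Ln p f) := h1.trans (by gcongr)
      _ = _ := by ring
  have LM2 : Ln p M2 ≤ 4 * r ^ 2 * Ln p f := by
    have h1 := Ln_maxOp1_le hp1 (m - s) (N + s) nM2' M2'0
    have h2 := Ln_maxOp2_le hp1 (m - s) (N + s) nf f0
    rw [hpr] at h1 h2
    calc _ ≤ 2 * r * (2 * r * Ln p f) := h1.trans (by gcongr)
      _ = _ := by ring
  have nD : ∀ (κ : ℕ × ℕ) (a c : ℕ),
      Nice (D12 (m + κ.1 + (a + 1)) (m + κ.2 + (c + 1)) f) := fun κ a c => D12_nice _ _ nf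
  have nS : ∀ κ : ℕ × ℕ, Nice fun x => ∑ a ∈ Finset.range A, ∑ c ∈ Finset.range A,
      D12 (m + κ.1 + (a + 1)) (m + κ.2 + (c + 1)) f x := fun κ =>
    Nice.sum _ fun a _ => Nice.sum _ fun c _ => nD κ a c
  have P : ∀ κ ∈ box N, ∀ x, g κ x * fwd b m mu κ f x ≤ c * (g κ x * (M1 x + M2 x)) +
      ∑ a ∈ Finset.range A, ∑ c ∈ Finset.range A,
        g κ x * fwd b m mu κ (D12 (m + κ.1 + (a + 1)) (m + κ.2 + (c + 1)) f) x := by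
    intro κ hκ x
    have n12 : Nice fun x => E1 (m + κ.1) f x + E2 (m + κ.2) f x :=
      (E1_nice _ nf).add (E2_nice _ nf)
    have h1 := fwd_mono hb0 κ nf (n12.add (nS κ)) (fun x =>
      le_E1_add_E2_add_sum nf f0 (j := m + κ.1) (k := m + κ.2) (A := A)
        (f1 _ (by omega)) (f2 _ (by omega)) x) x (m := m) (mu := mu)
    rw [fwd_add hb0 κ n12 (nS κ), fwd_add hb0 κ (E1_nice _ nf) (E2_nice _ nf),
      fwd_sum hb0 _ κ fun a _ => Nice.sum _ fun c _ => nD κ a c] at h1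
    simp only [fwd_sum hb0 _ κ fun c _ => nD κ _ c] at h1
    have h2 := HM hmu hmu' κ hκ nf f0 x
    have h3 := mul_le_mul_of_nonneg_left (h1.trans (add_le_add_left h2 _)) (g0 κ x)
    refine h3.trans (le_of_eq ?_)
    simp only [mul_add, Finset.mul_sum]
    ring
  have nR : ∀ (κ : ℕ × ℕ) (a c : ℕ), Nice fun x =>
      g κ x * fwd b m mu κ (D12 (m + κ.1 + (a + 1)) (m + κ.2 + (c + 1)) f) x :=
    fun κ a c => (hg κ).mul (fwd_nice hb0 κ (D12_nice _ _ nf))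
  have X2 : ∑ κ ∈ box N, ∫ x, g κ x * fwd b m mu κ f x ≤
      c * (∫ x, G x * (M1 x + M2 x)) + ∑ a ∈ Finset.range A, ∑ c ∈ Finset.range A,
        ∫ x, block b m mu N L a c g x * f x := by
    have i1 : ∀ κ, Nice fun x => c * (g κ x * (M1 x + M2 x)) := fun κ =>
      ((hg κ).mul (nM1.add nM2)).const_mul c
    have i2 : ∀ κ : ℕ × ℕ, Nice fun x => ∑ a ∈ Finset.range A, ∑ c ∈ Finset.range A,
        g κ x * fwd b m mu κ (D12 (m + κ.1 + (a + 1)) (m + κ.2 + (c + 1)) f) x := fun κ =>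
      Nice.sum _ fun a _ => Nice.sum _ fun c _ => nR κ a c
    have st : ∀ κ ∈ box N, ∫ x, g κ x * fwd b m mu κ f x ≤ c * (∫ x, g κ x * (M1 x + M2 x)) +
        ∑ a ∈ Finset.range A, ∑ c ∈ Finset.range A,
          ∫ x, D12 (m + (a + 1) + κ.1) (m + (c + 1) + κ.2) (E12 L (bwd b m mu κ (g κ))) x * f x := by
      intro κ hκ
      refine (integral_mono ((hg κ).mul (fwd_nice hb0 κ nf)).integrable
        ((i1 κ).add (i2 κ)).integrable (P κ hκ)).trans (le_of_eq ?_)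
      rw [integral_add (i1 κ).integrable (i2 κ).integrable, integral_const_mul,
        integral_finsetSum _ fun a _ => (Nice.sum _ fun c _ => nR κ a c).integrable]
      congr 1
      refine Finset.sum_congr rfl fun a _ => ?_
      rw [integral_finsetSum _ fun c _ => (nR κ a c).integrable]
      refine Finset.sum_congr rfl fun c _ => ?_
      rw [integral_fwd_D12 hb0 κ _ _ nf (hg κ) fL, add_right_comm m, add_right_comm m (κ.2 : ℤ)]
    refine (Finset.sum_le_sum st).trans (le_of_eq ?_)
    rw [Finset.sum_add_distrib, ← Finset.mul_sum]
    congr 1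
    · rw [← integral_finsetSum _ fun κ _ => ((hg κ).mul (nM1.add nM2)).integrable]
      simp only [hG, Finset.sum_mul]
    · rw [Finset.sum_comm]
      refine Finset.sum_congr rfl fun a _ => ?_
      rw [Finset.sum_comm]
      refine Finset.sum_congr rfl fun c _ => ?_
      rw [← integral_finsetSum _ fun κ _ =>
        ((D12_nice _ _ (E12_nice L (nb κ))).mul nf).integrable]
      simp only [block, Finset.sum_mul]
  set Q := (8 * c + 576 * C) * (r ^ 2 + r ^ 4 * B ^ (1 / 2 : ℝ)) with hQ
  have hBs : 0 < B ^ (1 / 2 : ℝ) := by positivity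
  have hQ0 : 0 ≤ Q := by positivity
  have hLG : 0 ≤ Ln r G := Ln_nonneg G0
  set θ := (1 / 2 : ℝ) ^ (1 / (12 * (r - 1))) with hθ
  have hθ0 : 0 ≤ θ := by positivity
  have X3 : ∫ x, E12 L W x ^ r ≤ Q * Ln r G * Ln p f := by
    have t1 : ∫ x, G x * (M1 x + M2 x) ≤ 8 * r ^ 2 * (Ln r G * Ln p f) := by
      simp only [mul_add]
      rw [integral_add (nG.mul nM1).integrable (nG.mul nM2).integrable]
      have u1 := integral_mul_le_Ln hconj nG nM1 G0 M10
      have u2 := integral_mul_le_Ln hconj nG nM2 G0 M20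
      have v1 := mul_le_mul_of_nonneg_left LM1 hLG
      have v2 := mul_le_mul_of_nonneg_left LM2 hLG
      linarith
    have t2 : ∀ a d : ℕ, ∫ x, block b m mu N L a d g x * f x ≤
        C * (r ^ 2 * B ^ (1 / 2 : ℝ)) * (Ln r G * Ln p f) * (θ ^ a * θ ^ d) := by
      intro a d
      have nbl := block_nice hb0 a d hg (m := m) (mu := mu) (N := N) (L := L)
      have u := integral_mul_le_Ln hconj nbl.abs nf (fun _ => abs_nonneg _) f0
      have v := mul_le_mul_of_nonneg_right (HB hmu hr hB H a d hg g0) hf0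
      calc _ ≤ ∫ x, |block b m mu N L a d g x| * f x :=
            integral_mono (nbl.mul nf).integrable (nbl.abs.mul nf).integrable fun x =>
              mul_le_mul_of_nonneg_right (le_abs_self _) (f0 x)
        _ ≤ _ := u.trans v
        _ = _ := by ring
    have t3 : ∑ a ∈ Finset.range A, ∑ d ∈ Finset.range A, ∫ x, block b m mu N L a d g x * f x ≤
        C * (r ^ 2 * B ^ (1 / 2 : ℝ)) * (Ln r G * Ln p f) * ((24 * r) * (24 * r)) := by
      calc _ ≤ ∑ a ∈ Finset.range A, ∑ d ∈ Finset.range A,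
            C * (r ^ 2 * B ^ (1 / 2 : ℝ)) * (Ln r G * Ln p f) * (θ ^ a * θ ^ d) :=
            Finset.sum_le_sum fun a _ => Finset.sum_le_sum fun d _ => t2 a d
        _ = C * (r ^ 2 * B ^ (1 / 2 : ℝ)) * (Ln r G * Ln p f) *
            ((∑ a ∈ Finset.range A, θ ^ a) * ∑ d ∈ Finset.range A, θ ^ d) := by
            rw [Finset.sum_mul_sum, Finset.mul_sum]
            refine Finset.sum_congr rfl fun a _ => ?_
            rw [Finset.mul_sum]
        _ ≤ _ := by
            have := sum_theta_le hr A
            have h0 : 0 ≤ ∑ a ∈ Finset.range A, θ ^ a := Finset.sum_nonneg fun _ _ => by positivity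
            gcongr
    have t4 := mul_le_mul_of_nonneg_left t1 hc
    rw [X1]
    refine X2.trans ((add_le_add t4 t3).trans ?_)
    have z : 0 ≤ Ln r G * Ln p f := mul_nonneg hLG hf0
    have e : Q * Ln r G * Ln p f - (c * (8 * r ^ 2 * (Ln r G * Ln p f)) +
        C * (r ^ 2 * B ^ (1 / 2 : ℝ)) * (Ln r G * Ln p f) * ((24 * r) * (24 * r))) =
        (8 * c * (r ^ 4 * B ^ (1 / 2 : ℝ)) + 576 * C * r ^ 2) * (Ln r G * Ln p f) := by
      rw [hQ]; ring
    have : 0 ≤ (8 * c * (r ^ 4 * B ^ (1 / 2 : ℝ)) + 576 * C * r ^ 2) * (Ln r G * Ln p f) := by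
      positivity
    linarith
  have Y0 : 0 ≤ Ln r (E12 L W) := Ln_nonneg w0
  have Yr := Ln_rpow hr0 w0
  have Yf : Ln p f = Ln r (E12 L W) ^ (r - 1) := by
    have : ∀ x, f x ^ p = E12 L W x ^ r := fun x => by
      rw [hf]; simp only
      rw [← Real.rpow_mul (w0 x), hp]; congr 1; field_simp
    rw [Ln]
    simp only [this]
    rw [← Yr, ← Real.rpow_mul Y0, hp]; congr 1; field_simp
  have Y1 : Ln r (E12 L W) ≤ Q * Ln r G := by
    rcases Y0.eq_or_lt with h | h
    · rw [← h]; positivity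
    · rw [← Yr, Yf] at X3
      have hp := Real.rpow_pos_of_pos h (r - 1)
      have e : Ln r (E12 L W) ^ r = Ln r (E12 L W) * Ln r (E12 L W) ^ (r - 1) := by
        rw [← Real.rpow_one_add' Y0 (by linarith)]; congr 1; ring
      rw [e] at X3
      exact le_of_mul_le_mul_right X3 hp
  rw [← Yr, ← Ln_rpow hr0 G0, ← Real.mul_rpow hQ0 hLG]
  exact Real.rpow_le_rpow Y0 Y1 hr0.le

theorem dualBound_large (hb : 1 < b) (hK : 1 ≤ K) : ∃ C : ℝ, 1 ≤ C ∧ ∀ {m : ℤ} {N : ℕ}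
    {mu : ℕ × ℕ → ℝ} {L : ℤ} {r : ℝ},
    (∀ κ : ℕ × ℕ, (2:ℝ) ^ (-(m + (κ.2 : ℤ))) ≤ K * |mu κ|) →
    (∀ κ : ℕ × ℕ, |mu κ| ≤ K * (2:ℝ) ^ (-(m + (κ.2 : ℤ)))) → 3 ≤ r →
    DualBound b m mu N L r (C * r ^ 8) := by
  obtain ⟨C, hC, H⟩ := dual_step hb hK
  refine ⟨9 * C ^ 2, by nlinarith, ?_⟩
  intro m N mu L r hmu hmu' hr
  have hb0 : 0 ≤ b := by linarith
  set S := {B : ℝ | 1 ≤ B ∧ DualBound b m mu N L r B} with hS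
  have hne : S.Nonempty := ⟨max ((box N).card : ℝ) 1, le_max_right _ _,
    (dualBound_card hb0 (by linarith)).mono (Nat.cast_nonneg _) (le_max_left _ _) (by linarith)⟩
  have hbd : BddBelow S := ⟨1, fun B hB => hB.1⟩
  obtain ⟨B, hBS, hB⟩ := exists_lt_of_csInf_lt hne (lt_add_one (sInf S))
  have h1 : 1 ≤ sInf S := le_csInf hne fun B hB => hB.1
  set y := (sInf S + 1) ^ (1 / 2 : ℝ) with hy
  have hy1 : 1 ≤ y := Real.one_le_rpow (by linarith) (by norm_num)
  have hyy : y ^ 2 = sInf S + 1 := by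
    rw [hy, ← Real.rpow_natCast, ← Real.rpow_mul (by linarith)]; norm_num
  have hr2 : 1 ≤ r ^ 2 := by nlinarith
  have hr4 : r ^ 2 ≤ r ^ 4 := by nlinarith
  have hBy : B ^ (1 / 2 : ℝ) ≤ y := Real.rpow_le_rpow (by linarith [hBS.1]) hB.le (by norm_num)
  have hB1 : 1 ≤ B ^ (1 / 2 : ℝ) := Real.one_le_rpow hBS.1 (by norm_num)
  have hnew : C * (r ^ 2 + r ^ 4 * B ^ (1 / 2 : ℝ)) ∈ S := by
    refine ⟨?_, H hmu hmu' hr hBS.1 hBS.2⟩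
    refine one_le_mul_of_one_le_of_one_le hC ?_
    nlinarith
  have h2 := csInf_le hbd hnew
  have h3 : C * (r ^ 2 + r ^ 4 * B ^ (1 / 2 : ℝ)) ≤ C * (r ^ 4 * y + r ^ 4 * y) := by
    gcongr
    nlinarith
  have h4 : (1:ℝ) ≤ C * (r ^ 4 * y) := one_le_mul_of_one_le_of_one_le hC
    (one_le_mul_of_one_le_of_one_le (by linarith) hy1)
  have h5 : y * y ≤ (3 * C * r ^ 4) * y := by rw [← sq, hyy]; linarith
  have h6 : y ≤ 3 * C * r ^ 4 := le_of_mul_le_mul_right h5 (by linarith)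
  refine hBS.2.mono (by linarith [hBS.1]) ?_ (by linarith)
  calc B ≤ y ^ 2 := by rw [hyy]; exact hB.le
    _ ≤ (3 * C * r ^ 4) ^ 2 := by gcongr
    _ = _ := by ring

end Bootstrap

section Bootstrap

variable {b K : ℝ} {m : ℤ} {N : ℕ} {mu : ℕ × ℕ → ℝ} {L : ℤ} {r : ℝ}

theorem integral_E12_bwd (hb : 0 ≤ b) {g : ℕ × ℕ → ℝ × ℝ → ℝ} (hg : ∀ κ, Nice (g κ)) :
    ∫ x, E12 L (fun x => ∑ κ ∈ box N, bwd b m mu κ (g κ) x) x = ∫ x, ∑ κ ∈ box N, g κ x := by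
  have nb : ∀ κ, Nice (bwd b m mu κ (g κ)) := fun κ => bwd_nice hb κ (hg κ)
  rw [integral_E12 L (Nice.sum _ fun κ _ => nb κ), integral_finsetSum _ fun κ _ => (nb κ).integrable,
    integral_finsetSum _ fun κ _ => (hg κ).integrable]
  exact Finset.sum_congr rfl fun κ _ => integral_cavg hb _ _ (hg κ)

theorem DualBound.interpolate (hb : 0 ≤ b) {M : ℝ} (hM : 1 ≤ M)
    (H : DualBound b m mu N L 4 M) (hr : 2 ≤ r) (hr3 : r ≤ 3) :
    DualBound b m mu N L r (48 * M ^ 4) := by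
  intro g hg g0
  set G : ℝ × ℝ → ℝ := fun x => ∑ κ ∈ box N, g κ x with hG
  have nG : Nice G := Nice.sum _ fun κ _ => hg κ
  have G0 : ∀ x, 0 ≤ G x := fun x => Finset.sum_nonneg fun κ _ => g0 κ x
  set T : (ℕ × ℕ → ℝ × ℝ → ℝ) → ℝ × ℝ → ℝ := fun g =>
    E12 L (fun x => ∑ κ ∈ box N, bwd b m mu κ (g κ) x) with hT
  have nT : ∀ {g : ℕ × ℕ → ℝ × ℝ → ℝ}, (∀ κ, Nice (g κ)) → Nice (T g) := fun h =>
    E12_nice L (Nice.sum _ fun κ _ => bwd_nice hb κ (h κ))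
  have T0 : ∀ {g : ℕ × ℕ → ℝ × ℝ → ℝ}, (∀ κ x, 0 ≤ g κ x) → ∀ x, 0 ≤ T g x := fun h =>
    E12_nonneg L fun x => Finset.sum_nonneg fun κ _ => bwd_nonneg κ (h κ) x
  have I := interpolation (nT hg) (T0 g0) nG G0 one_pos (by linarith : 1 < r)
    (by linarith : r < 4) zero_le_one (by positivity : 0 ≤ M ^ (4:ℝ)) one_pos ?_
  · refine I.trans (mul_le_mul_of_nonneg_right ?_ (integral_nonneg fun x =>
      Real.rpow_nonneg (G0 x) _))
    rw [Real.one_rpow, Real.one_rpow, one_mul]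
    have h1 : 1 / (r - 1) ≤ 1 := by rw [div_le_one (by linarith)]; linarith
    have h2 : 1 / (4 - r) ≤ 1 := by rw [div_le_one (by linarith)]; linarith
    have hM4 : M ^ (4:ℝ) = M ^ 4 := by exact_mod_cast Real.rpow_natCast M 4
    have hM1 : 1 ≤ M ^ 4 := one_le_pow₀ hM
    have h8 : (2:ℝ) ^ r ≤ 8 := by
      calc (2:ℝ) ^ r ≤ 2 ^ (3:ℝ) := Real.rpow_le_rpow_of_exponent_le (by norm_num) hr3
        _ = 8 := by norm_num
    have h3 : 0 < 1 / (4 - r) := by apply one_div_pos.2; linarith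
    have h4 : 0 < 1 / (r - 1) := by apply one_div_pos.2; linarith
    rw [hM4]
    calc _ ≤ 8 * 3 * (1 + M ^ 4 * 1) := by gcongr
      _ ≤ 48 * M ^ 4 := by linarith
      _ = (48 * M ^ 4) ^ (1:ℝ) := (Real.rpow_one _).symm
      _ ≤ _ := Real.rpow_le_rpow_of_exponent_le (by linarith) (by linarith)
  · intro t ht
    set g1 : ℕ × ℕ → ℝ × ℝ → ℝ := fun κ x => if 1 * t < G x then g κ x else 0 with hg1
    set g2 : ℕ × ℕ → ℝ × ℝ → ℝ := fun κ x => if G x ≤ 1 * t then g κ x else 0 with hg2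
    have n1 : ∀ κ, Nice (g1 κ) := fun κ =>
      (hg κ).indicator (measurableSet_lt measurable_const nG.meas.measurable)
    have n2 : ∀ κ, Nice (g2 κ) := fun κ =>
      (hg κ).indicator (measurableSet_le nG.meas.measurable measurable_const)
    have g10 : ∀ κ x, 0 ≤ g1 κ x := fun κ x => by
      simp only [hg1]; split_ifs; exacts [g0 κ x, le_rfl]
    have g20 : ∀ κ x, 0 ≤ g2 κ x := fun κ x => by
      simp only [hg2]; split_ifs; exacts [g0 κ x, le_rfl]
    have s1 : ∀ x, ∑ κ ∈ box N, g1 κ x = if 1 * t < G x then G x else 0 := fun x => by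
      simp only [hg1]; split_ifs
      · rfl
      · exact Finset.sum_const_zero
    have s2 : ∀ x, ∑ κ ∈ box N, g2 κ x = if G x ≤ 1 * t then G x else 0 := fun x => by
      simp only [hg2]; split_ifs
      · rfl
      · exact Finset.sum_const_zero
    refine ⟨T g1, T g2, nT n1, nT n2, fun x => ?_, ?_, ?_⟩
    · have e : g = fun κ x => g1 κ x + g2 κ x := by
        funext κ x
        simp only [hg1, hg2]
        rcases lt_or_ge (1 * t) (G x) with h | h
        · rw [if_pos h, if_neg (not_le.2 h), add_zero]
        · rw [if_neg (not_lt.2 h), if_pos h, zero_add]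
      rw [abs_of_nonneg (T0 g10 x), abs_of_nonneg (T0 g20 x)]
      refine le_of_eq ?_
      simp only [hT]
      rw [E12_sum _ _ fun κ _ => bwd_nice hb κ (hg κ), E12_sum _ _ fun κ _ => bwd_nice hb κ (n1 κ),
        E12_sum _ _ fun κ _ => bwd_nice hb κ (n2 κ), ← Finset.sum_add_distrib]
      refine Finset.sum_congr rfl fun κ _ => ?_
      have e1 : bwd b m mu κ (g κ) = fun x => bwd b m mu κ (g1 κ) x + bwd b m mu κ (g2 κ) x := by
        conv_lhs => rw [e]
        exact funext fun x => avg_add (niceFam_cavg hb _ _) (n1 κ) (n2 κ) x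
      rw [e1]
      have e2 : E2 L (fun x => bwd b m mu κ (g1 κ) x + bwd b m mu κ (g2 κ) x) = fun x =>
          E2 L (bwd b m mu κ (g1 κ)) x + E2 L (bwd b m mu κ (g2 κ)) x :=
        funext fun x => avg_add (niceFam_E2 L) (bwd_nice hb κ (n1 κ)) (bwd_nice hb κ (n2 κ)) x
      rw [E12, e2]
      exact avg_add (niceFam_E1 L) (E2_nice _ (bwd_nice hb κ (n1 κ)))
        (E2_nice _ (bwd_nice hb κ (n2 κ))) x
    · simp only [Real.rpow_one, one_mul, abs_of_nonneg (T0 g10 _)]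
      rw [hT]
      simp only
      rw [integral_E12_bwd hb n1]
      simp only [s1, one_mul, le_refl]
    · simp only [abs_of_nonneg (T0 g20 _)]
      have := H g2 n2 g20
      simp only [s2] at this
      exact this

theorem dualBound_of_two_le (hb : 1 < b) (hK : 1 ≤ K) : ∃ C : ℝ, 1 ≤ C ∧ ∀ {m : ℤ} {N : ℕ}
    {mu : ℕ × ℕ → ℝ} {L : ℤ} {r : ℝ},
    (∀ κ : ℕ × ℕ, (2:ℝ) ^ (-(m + (κ.2 : ℤ))) ≤ K * |mu κ|) →
    (∀ κ : ℕ × ℕ, |mu κ| ≤ K * (2:ℝ) ^ (-(m + (κ.2 : ℤ)))) → 2 ≤ r →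
    DualBound b m mu N L r (C * r ^ 8) := by
  obtain ⟨C, hC, H⟩ := dualBound_large hb hK
  have hM : 1 ≤ C * 4 ^ 8 := by linarith
  refine ⟨48 * (C * 4 ^ 8) ^ 4 + C, by nlinarith [one_le_pow₀ hM (n := 4)], ?_⟩
  intro m N mu L r hmu hmu' hr
  have hr8 : 1 ≤ r ^ 8 := one_le_pow₀ (by linarith)
  have hM4 : 0 ≤ 48 * (C * 4 ^ 8) ^ 4 := by positivity
  rcases le_or_gt 3 r with h3 | h3
  · refine (H hmu hmu' h3).mono (by positivity) ?_ (by linarith)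
    exact mul_le_mul_of_nonneg_right (by linarith) (by linarith)
  · refine (DualBound.interpolate (by linarith) hM
      (H hmu hmu' (by norm_num)) hr h3.le).mono hM4 ?_ (by linarith)
    calc _ ≤ 48 * (C * 4 ^ 8) ^ 4 + C := by linarith
      _ ≤ _ := le_mul_of_one_le_right (by linarith) hr8

end Bootstrap

section Maximal

variable {b K : ℝ} {m : ℤ} {N : ℕ} {mu : ℕ × ℕ → ℝ} {L : ℤ} {p : ℝ} {f : ℝ × ℝ → ℝ}

theorem le_avg_of_ae_le {ν : Measure ℝ} [IsProbabilityMeasure ν] {Φ : ℝ × ℝ → ℝ → ℝ × ℝ}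
    (h : NiceFam ν Φ) (hf : Nice f) {x : ℝ × ℝ} {c : ℝ} (hc : ∀ᵐ u ∂ν, c ≤ f (Φ x u)) :
    c ≤ avg ν Φ f x := by
  have := integral_mono_ae (integrable_const c) (h.integrable hf x) hc
  rw [integral_const] at this
  simpa [avg] using this

theorem exists_le_E12_add (hf : Nice f) (hc : Continuous f) {ε : ℝ} (hε : 0 < ε) :
    ∃ L : ℤ, ∀ x, f x ≤ E12 L f x + ε := by
  obtain ⟨R, hR⟩ := hf.supp
  have hs : HasCompactSupport f := HasCompactSupport.intro (isCompact_closedBall (0 : ℝ × ℝ) R)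
    fun x hx => hR x (by simpa using hx)
  obtain ⟨δ, hδ, H⟩ := Metric.uniformContinuous_iff.1
    (hs.uniformContinuous_of_continuous hc) (ε / 2) (by linarith)
  obtain ⟨n, hn⟩ := exists_pow_lt_of_lt_one hδ (by norm_num : (1 / 2 : ℝ) < 1)
  have hn' : (2:ℝ) ^ (-(n:ℤ)) < δ := by
    rw [zpow_neg, zpow_natCast, ← inv_pow, ← one_div]; exact hn
  refine ⟨n, fun x => ?_⟩
  have h2 : ∀ z, f z - ε / 2 ≤ E2 n f z := fun z => by
    refine le_avg_of_ae_le (niceFam_E2 n) hf ?_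
    filter_upwards [unitMeas_ae] with u hu
    have hd : dist (z.1, cellpt n z.2 u) z < δ := by
      rw [Prod.dist_eq]
      refine max_lt (by simpa using hδ) ?_
      rw [Real.dist_eq]
      exact (abs_cellpt_sub n z.2 hu).trans hn'
    have := H hd
    rw [Real.dist_eq] at this
    linarith [(abs_lt.1 this).1]
  have h1 : f x - ε ≤ E12 n f x := by
    refine le_avg_of_ae_le (niceFam_E1 n) (E2_nice _ hf) ?_
    filter_upwards [unitMeas_ae] with u hu
    have hd : dist (cellpt n x.1 u, x.2) x < δ := by
      rw [Prod.dist_eq]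
      refine max_lt ?_ (by simpa using hδ)
      rw [Real.dist_eq]
      exact (abs_cellpt_sub n x.1 hu).trans hn'
    have := H hd
    rw [Real.dist_eq] at this
    linarith [(abs_lt.1 this).1, h2 (cellpt n x.1 u, x.2)]
  linarith

theorem fwd_le_add (hb : 0 ≤ b) (κ : ℕ × ℕ) {g : ℝ × ℝ → ℝ} (hf : Nice f) (hg : Nice g) {ε : ℝ}
    (h : ∀ x, f x ≤ g x + ε) (x : ℝ × ℝ) :
    fwd b m mu κ f x ≤ fwd b m mu κ g x + ε := by
  have h1 := le_avg_of_ae_le (niceFam_cavg hb ((2:ℝ) ^ (-(m + (κ.1 : ℤ)))) (mu κ))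
    (hg.sub hf) (x := x) (c := -ε) (Eventually.of_forall fun u => by linarith [h (x -
      ((2:ℝ) ^ (-(m + (κ.1 : ℤ))) * u, mu κ * u ^ b))])
  rw [avg_sub (niceFam_cavg hb _ _) hg hf] at h1
  change -ε ≤ fwd b m mu κ g x - fwd b m mu κ f x at h1
  linarith

theorem fwd_nonneg (κ : ℕ × ℕ) (h0 : ∀ x, 0 ≤ f x) (x : ℝ × ℝ) :
    0 ≤ fwd b m mu κ f x := cavg_nonneg _ _ h0 x

theorem integral_sum_mul_fwd_le (hb : 0 ≤ b) {r B : ℝ} (hrp : r.HolderConjugate p) (hB : 0 ≤ B)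
    (H : ∀ L, DualBound b m mu N L r B) (hf : Nice f) (h0 : ∀ x, 0 ≤ f x) (hc : Continuous f)
    {g : ℕ × ℕ → ℝ × ℝ → ℝ} (hg : ∀ κ, Nice (g κ)) (g0 : ∀ κ x, 0 ≤ g κ x) :
    ∫ x, ∑ κ ∈ box N, g κ x * fwd b m mu κ f x ≤
      B * Ln r (fun x => ∑ κ ∈ box N, g κ x) * Ln p f := by
  set G : ℝ × ℝ → ℝ := fun x => ∑ κ ∈ box N, g κ x with hG
  have nG : Nice G := Nice.sum _ fun κ _ => hg κ
  have G0 : ∀ x, 0 ≤ G x := fun x => Finset.sum_nonneg fun κ _ => g0 κ x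
  have hI : 0 ≤ ∫ x, G x := integral_nonneg G0
  refine le_of_forall_pos_le_add fun η hη => ?_
  set ε := η / (1 + ∫ x, G x) with hεd
  have hε : 0 < ε := by positivity
  have hεI : ε * ∫ x, G x ≤ η := by
    rw [hεd, div_mul_eq_mul_div, div_le_iff₀ (by linarith)]
    nlinarith
  obtain ⟨L, hL⟩ := exists_le_E12_add hf hc hε
  have nE := E12_nice L hf
  have nb : ∀ κ, Nice (bwd b m mu κ (g κ)) := fun κ => bwd_nice hb κ (hg κ)
  set W : ℝ × ℝ → ℝ := fun x => ∑ κ ∈ box N, bwd b m mu κ (g κ) x with hW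
  have nW : Nice W := Nice.sum _ fun κ _ => nb κ
  have W0 : ∀ x, 0 ≤ W x := fun x => Finset.sum_nonneg fun κ _ => bwd_nonneg κ (g0 κ) x
  have nP : ∀ {h : ℝ × ℝ → ℝ}, Nice h → ∀ κ, Nice fun x => g κ x * fwd b m mu κ h x := fun hh κ =>
    (hg κ).mul (fwd_nice hb κ hh)
  have e1 : ∫ x, ∑ κ ∈ box N, g κ x * fwd b m mu κ (E12 L f) x = ∫ x, E12 L W x * f x := by
    rw [integral_finsetSum _ fun κ _ => (nP nE κ).integrable, ← integral_E12_adjoint L hf nW]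
    simp only [hW, Finset.sum_mul]
    rw [integral_finsetSum _ fun κ _ => ((nb κ).mul nE).integrable]
    exact Finset.sum_congr rfl fun κ _ => integral_fwd hb κ nE (hg κ)
  calc ∫ x, ∑ κ ∈ box N, g κ x * fwd b m mu κ f x
      ≤ ∫ x, ((∑ κ ∈ box N, g κ x * fwd b m mu κ (E12 L f) x) + ε * G x) := by
        refine integral_mono (Nice.sum _ fun κ _ => nP hf κ).integrable
          ((Nice.sum _ fun κ _ => nP nE κ).add (nG.const_mul ε)).integrable fun x => ?_
        simp only [hG, Finset.mul_sum]
        rw [← Finset.sum_add_distrib]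
        refine Finset.sum_le_sum fun κ _ => ?_
        have := mul_le_mul_of_nonneg_left (fwd_le_add hb κ hf nE hL x (m := m) (mu := mu)) (g0 κ x)
        linarith
    _ = (∫ x, E12 L W x * f x) + ε * ∫ x, G x := by
        rw [integral_add (Nice.sum _ fun κ _ => nP nE κ).integrable (nG.const_mul ε).integrable, e1,
          integral_const_mul]
    _ ≤ B * Ln r G * Ln p f + η := by
        refine add_le_add ?_ hεI
        refine (integral_mul_le_Ln hrp (E12_nice L nW) hf (E12_nonneg L W0) h0).trans ?_
        refine mul_le_mul_of_nonneg_right ?_ (Ln_nonneg h0)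
        exact Ln_le_of_integral_le hrp.pos hB (E12_nonneg L W0) G0 (H L g hg g0)

/-- The maximum of the averages over the box. -/
def fwdMax (b : ℝ) (m : ℤ) (mu : ℕ × ℕ → ℝ) (N : ℕ) (hN : (box N).Nonempty) (f : ℝ × ℝ → ℝ)
    (x : ℝ × ℝ) : ℝ := (box N).sup' hN fun κ => fwd b m mu κ f x

theorem Nice.of_abs_le {u v : ℝ × ℝ → ℝ} (hu : Measurable u) (hv : Nice v)
    (huv : ∀ x, |u x| ≤ v x) : Nice u := by
  obtain ⟨C, hC⟩ := hv.bdd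
  obtain ⟨R, hR⟩ := hv.supp
  refine ⟨hu.stronglyMeasurable, ⟨C, fun x => ((huv x).trans (le_abs_self _)).trans (hC x)⟩,
    ⟨R, fun x hx => ?_⟩⟩
  have := huv x
  rw [hR x hx] at this
  exact abs_nonpos_iff.1 this

theorem fwdMax_nonneg (hN : (box N).Nonempty) (h0 : ∀ x, 0 ≤ f x) (x : ℝ × ℝ) :
    0 ≤ fwdMax b m mu N hN f x := by
  obtain ⟨κ, -, e⟩ := Finset.exists_mem_eq_sup' hN fun κ => fwd b m mu κ f x
  rw [fwdMax, e]
  exact fwd_nonneg κ h0 x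

theorem fwdMax_nice (hb : 0 ≤ b) (hN : (box N).Nonempty) (hf : Nice f) (h0 : ∀ x, 0 ≤ f x) :
    Nice (fwdMax b m mu N hN f) := by
  have nf : ∀ κ, Nice (fwd b m mu κ f) := fun κ => fwd_nice hb κ hf
  have mS : Measurable (fwdMax b m mu N hN f) := by
    have := Finset.measurable_sup' hN (f := fun κ => fwd b m mu κ f)
      fun κ _ => (nf κ).meas.measurable
    convert this using 1
    funext x
    simp only [fwdMax, Finset.sup'_apply]
  refine Nice.of_abs_le mS (Nice.sum (box N) fun κ _ => nf κ) fun x => ?_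
  rw [abs_of_nonneg (fwdMax_nonneg hN h0 x)]
  obtain ⟨κ, hκ, e⟩ := Finset.exists_mem_eq_sup' hN fun κ => fwd b m mu κ f x
  rw [fwdMax, e]
  exact Finset.single_le_sum (f := fun κ => fwd b m mu κ f x) (fun κ _ => fwd_nonneg κ h0 x) hκ

theorem integral_fwdMax_le (hb : 0 ≤ b) (hN : (box N).Nonempty) {r B : ℝ}
    (hrp : r.HolderConjugate p) (hB : 0 ≤ B)
    (H : ∀ L, DualBound b m mu N L r B) (hf : Nice f) (h0 : ∀ x, 0 ≤ f x) (hc : Continuous f) :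
    ∫ x, fwdMax b m mu N hN f x ^ p ≤ B ^ p * ∫ x, f x ^ p := by
  have hp1 : 1 < p := hrp.symm.lt
  have hp0 : 0 < p := by linarith
  have hr0 : 0 < r := hrp.pos
  set S := fwdMax b m mu N hN f with hS
  have nf : ∀ κ, Nice (fwd b m mu κ f) := fun κ => fwd_nice hb κ hf
  have f0 : ∀ κ x, 0 ≤ fwd b m mu κ f x := fun κ => fwd_nonneg κ h0
  have le_S : ∀ κ ∈ box N, ∀ x, fwd b m mu κ f x ≤ S x := fun κ hκ x =>
    Finset.le_sup' (fun κ => fwd b m mu κ f x) hκ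
  have ex_S : ∀ x, ∃ κ ∈ box N, S x = fwd b m mu κ f x := fun x =>
    Finset.exists_mem_eq_sup' hN fun κ => fwd b m mu κ f x
  have S0 : ∀ x, 0 ≤ S x := fwdMax_nonneg hN h0
  have nS : Nice S := fwdMax_nice hb hN hf h0
  have mS : Measurable S := nS.meas.measurable
  set a : ℕ × ℕ → ℝ × ℝ → ℝ := fun κ x => if fwd b m mu κ f x = S x then 1 else 0 with ha
  have a0 : ∀ κ x, 0 ≤ a κ x := fun κ x => by simp only [ha]; split_ifs <;> norm_num
  have ma : ∀ κ, Measurable (a κ) := fun κ =>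
    Measurable.ite (measurableSet_eq_fun (nf κ).meas.measurable mS) measurable_const
      measurable_const
  set A : ℝ × ℝ → ℝ := fun x => ∑ κ ∈ box N, a κ x with hA
  have A1 : ∀ x, 1 ≤ A x := fun x => by
    obtain ⟨κ, hκ, e⟩ := ex_S x
    refine le_trans ?_ (Finset.single_le_sum (f := fun κ => a κ x) (fun κ _ => a0 κ x) hκ)
    simp only [ha, e, if_true, le_refl]
  have mA : Measurable A := Finset.measurable_fun_sum _ fun κ _ => ma κ
  set q := p - 1 with hq
  have hq0 : 0 < q := by linarith
  have nSq : Nice fun x => S x ^ q := nS.rpow S0 hq0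
  have Sq0 : ∀ x, 0 ≤ S x ^ q := fun x => Real.rpow_nonneg (S0 x) _
  set g : ℕ × ℕ → ℝ × ℝ → ℝ := fun κ x => if κ ∈ box N then S x ^ q * (a κ x / A x) else 0 with hg
  have g0 : ∀ κ x, 0 ≤ g κ x := fun κ x => by
    simp only [hg]; split_ifs
    · exact mul_nonneg (Sq0 x) (div_nonneg (a0 κ x) (by linarith [A1 x]))
    · rfl
  have ng : ∀ κ, Nice (g κ) := fun κ => by
    by_cases hκ : κ ∈ box N
    · simp only [hg, hκ, if_true]
      refine Nice.of_abs_le (nSq.meas.measurable.mul ((ma κ).div mA)) nSq fun x => ?_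
      have h1 : a κ x / A x ≤ 1 := by
        rw [div_le_one (by linarith [A1 x])]
        exact Finset.single_le_sum (f := fun κ => a κ x) (fun κ _ => a0 κ x) hκ
      rw [abs_of_nonneg (mul_nonneg (Sq0 x) (div_nonneg (a0 κ x) (by linarith [A1 x])))]
      exact mul_le_of_le_one_right (Sq0 x) h1
    · simp only [hg, hκ, if_false]; exact Nice.zero
  have sg : ∀ x, ∑ κ ∈ box N, g κ x = S x ^ q := fun x => by
    have : ∀ κ ∈ box N, g κ x = S x ^ q * (a κ x / A x) := fun κ hκ => by
      simp only [hg, hκ, if_true]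
    rw [Finset.sum_congr rfl this, ← Finset.mul_sum, ← Finset.sum_div, div_self
      (by have := A1 x; simp only [hA] at this; linarith), mul_one]
  have sgf : ∀ x, ∑ κ ∈ box N, g κ x * fwd b m mu κ f x = S x ^ p := fun x => by
    have : ∀ κ ∈ box N, g κ x * fwd b m mu κ f x = g κ x * S x := fun κ hκ => by
      by_cases e : fwd b m mu κ f x = S x
      · rw [e]
      · simp only [hg, ha, e, hκ, if_true, if_false]; simp
    rw [Finset.sum_congr rfl this, ← Finset.sum_mul, sg, ← Real.rpow_add_one' (S0 x) (by linarith),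
      hq, sub_add_cancel]
  have I := integral_sum_mul_fwd_le hb hrp hB H hf h0 hc ng g0
  simp only [sgf, sg] at I
  set X := ∫ x, S x ^ p with hX
  have X0 : 0 ≤ X := integral_nonneg fun x => Real.rpow_nonneg (S0 x) _
  have LX : Ln r (fun x => S x ^ q) = X ^ (1 / r) := by
    rw [Ln]
    congr 2
    funext x
    rw [← Real.rpow_mul (S0 x), hq, hrp.symm.sub_one_mul_conj]
  rw [LX] at I
  rcases X0.eq_or_lt with h | h
  · rw [← h]
    exact mul_nonneg (Real.rpow_nonneg hB _) (integral_nonneg fun x => Real.rpow_nonneg (h0 x) _)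
  · have e : X = X ^ (1 / p) * X ^ (1 / r) := by
      rw [← Real.rpow_add h, one_div, one_div, hrp.symm.inv_add_inv_eq_one, Real.rpow_one]
    have I2 : X ^ (1 / p) ≤ B * Ln p f := by
      refine le_of_mul_le_mul_right ?_ (Real.rpow_pos_of_pos h (1 / r))
      rw [← e]; linarith
    rw [← Ln_rpow hp0 h0, ← Real.mul_rpow hB (Ln_nonneg h0)]
    calc X = (X ^ (1 / p)) ^ p := by
          rw [← Real.rpow_mul X0, one_div_mul_cancel hp0.ne', Real.rpow_one]
      _ ≤ _ := Real.rpow_le_rpow (Real.rpow_nonneg X0 _) I2 hp0.le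

end Maximal

section Transfer

theorem lintegral_iSup_mul_le {J X : Type*} [Fintype J] [MeasurableSpace X] {μ : Measure X}
    [SFinite μ] {a : J → ℕ → ℝ≥0∞} (ha : ∀ n, ∑' i, a n i ≤ 1) {Φ : J → ℕ → X → ℝ≥0∞}
    (hΦ : ∀ n i, Measurable (Φ n i)) {Q : ℝ≥0∞}
    (H : ∀ ω : J → ℕ, ∫⁻ x, ⨆ n, Φ n (ω n) x ∂μ ≤ Q) :
    ∫⁻ x, ⨆ n, ⨆ i, a n i * Φ n i x ∂μ ≤ Q := by
  set ν : J → Measure ℕ := fun n =>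
    Measure.sum (fun i => a n i • Measure.dirac i) + (1 - ∑' i, a n i) • Measure.dirac 0 with hν
  have hprob : ∀ n, IsProbabilityMeasure (ν n) := fun n => ⟨by
    simp only [hν, Measure.add_apply, Measure.sum_apply _ MeasurableSet.univ, Measure.smul_apply,
      measure_univ, smul_eq_mul, mul_one]
    exact add_tsub_cancel_of_le (ha n)⟩
  have hle : ∀ n i (φ : ℕ → ℝ≥0∞), a n i * φ i ≤ ∫⁻ k, φ k ∂ν n := by
    intro n i φ
    rw [hν]
    simp only
    rw [lintegral_add_measure, lintegral_sum_measure]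
    simp only [lintegral_smul_measure, lintegral_dirac, smul_eq_mul]
    exact (ENNReal.le_tsum (f := fun i => a n i * φ i) i).trans le_self_add
  have hm : Measurable (Function.uncurry fun (x : X) (ω : J → ℕ) => ⨆ n, Φ n (ω n) x) :=
    measurable_from_prod_countable_left fun ω => Measurable.iSup fun n => hΦ n (ω n)
  calc ∫⁻ x, ⨆ n, ⨆ i, a n i * Φ n i x ∂μ
      ≤ ∫⁻ x, ∫⁻ ω, ⨆ n, Φ n (ω n) x ∂Measure.pi ν ∂μ := by
        refine lintegral_mono fun x => iSup_le fun n => iSup_le fun i => ?_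
        refine (hle n i fun k => Φ n k x).trans ?_
        rw [← (measurePreserving_eval ν n).lintegral_comp
          (Measurable.of_discrete (f := fun k => Φ n k x))]
        exact lintegral_mono fun ω => le_iSup (fun n => Φ n (ω n) x) n
    _ = ∫⁻ ω, ∫⁻ x, ⨆ n, Φ n (ω n) x ∂μ ∂Measure.pi ν :=
        lintegral_lintegral_swap hm.aemeasurable
    _ ≤ ∫⁻ ω, Q ∂Measure.pi ν := lintegral_mono H
    _ = Q := by simp

variable {b cp cm : ℝ} {χ : ℝ → ℝ}

theorem curve_of_pos {t : ℝ} (ht : 0 < t) : curve b cp cm t = cp * t ^ b := by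
  simp [curve, ht]

theorem measurable_curve : Measurable (curve b cp cm) := by
  unfold curve
  refine Measurable.ite measurableSet_Ioi ?_ (Measurable.ite measurableSet_Iio ?_ measurable_const)
  · exact (measurable_id.pow_const b).const_mul cp
  · exact (measurable_neg.pow_const b).const_mul cm

theorem measurable_tauConv (hχ : Measurable χ) {f : ℝ × ℝ → ℝ} (hf : Measurable f) (j : ℤ)
    (u : ℝ) : Measurable (tauConv b cp cm χ j u f) := by
  refine (StronglyMeasurable.integral_prod_right (ν := volume)
    (f := fun (x : ℝ × ℝ) (t : ℝ) =>
      f (x - (t, u * curve b cp cm t)) * ((2:ℝ) ^ j * χ ((2:ℝ) ^ j * t))) ?_).measurable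
  refine Measurable.stronglyMeasurable ?_
  refine (hf.comp (measurable_fst.sub (measurable_snd.prodMk
    ((measurable_curve.comp measurable_snd).const_mul u)))).mul ?_
  exact (hχ.comp (measurable_snd.const_mul _)).const_mul _

theorem abs_tauConv_le (hb : 0 ≤ b) {M : ℝ} (hM : ∀ t, |χ t| ≤ M)
    (hχ : ∀ t : ℝ, t ∉ Ioo (1/2 : ℝ) 2 → χ t = 0) (j : ℤ) (u : ℝ) {f φ : ℝ × ℝ → ℝ}
    (hφ : Nice φ) {x : ℝ × ℝ}
    (h : ∀ t ∈ Icc (1 / 2 : ℝ) 2,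
      |f (x - ((2:ℝ) ^ (-j) * t, u * cp * ((2:ℝ) ^ (-j)) ^ b * t ^ b))| ≤
        φ (x - ((2:ℝ) ^ (-j) * t, u * cp * ((2:ℝ) ^ (-j)) ^ b * t ^ b))) :
    |tauConv b cp cm χ j u f x| ≤
      3 / 2 * M * cavg b ((2:ℝ) ^ (-j)) (u * cp * ((2:ℝ) ^ (-j)) ^ b) φ x := by
  set lam := (2:ℝ) ^ (-j) with hlam
  set mu := u * cp * lam ^ b with hmu
  have hl0 : 0 < lam := by positivity
  have h2 : (2:ℝ) ^ j * lam = 1 := by rw [hlam, ← zpow_add₀ two_ne_zero]; simp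
  set F : ℝ → ℝ := fun τ => f (x - (lam * τ, u * curve b cp cm (lam * τ))) * χ τ with hF
  have e1 : tauConv b cp cm χ j u f x = ∫ τ, F τ := by
    have : tauConv b cp cm χ j u f x = ∫ t, (2:ℝ) ^ j * F ((2:ℝ) ^ j * t) := by
      rw [tauConv]
      congr 1; funext t
      simp only [hF]
      rw [← mul_assoc lam, mul_comm lam, h2, one_mul]
      ring
    rw [this, integral_const_mul, Measure.integral_comp_mul_left F, smul_eq_mul, ← mul_assoc,
      abs_of_pos (by positivity), mul_inv_cancel₀ (by positivity), one_mul]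
  have hint : Integrable (fun t => φ (x - (lam * t, mu * t ^ b))) (volume.restrict (Icc (1 / 2) 2)) := by
    have := (niceFam_cavg hb lam mu).integrable hφ x
    rw [cmeas] at this
    exact (integrable_smul_measure (by norm_num) ENNReal.ofReal_ne_top).1 this
  have hM0 : 0 ≤ M := (abs_nonneg _).trans (hM 0)
  have e2 : 3 / 2 * M * cavg b lam mu φ x =
      ∫ t, (Icc (1 / 2 : ℝ) 2).indicator (fun t => M * φ (x - (lam * t, mu * t ^ b))) t := by
    rw [integral_indicator measurableSet_Icc, integral_const_mul, cavg_eq]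
    ring
  rw [e1, e2, ← Real.norm_eq_abs]
  refine norm_integral_le_of_norm_le (f := F)
    ((integrable_indicator_iff measurableSet_Icc).2 (hint.const_mul M))
    (Eventually.of_forall fun t => ?_)
  by_cases ht : t ∈ Icc (1 / 2 : ℝ) 2
  · have t0 : 0 < t := by linarith [ht.1]
    rw [indicator_of_mem ht, hF]
    simp only
    rw [curve_of_pos (mul_pos hl0 t0), Real.mul_rpow hl0.le t0.le, Real.norm_eq_abs, abs_mul,
      mul_comm M, show u * (cp * (lam ^ b * t ^ b)) = mu * t ^ b by rw [hmu]; ring]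
    exact mul_le_mul (h t ht) (hM t) (abs_nonneg _) ((abs_nonneg _).trans (h t ht))
  · rw [indicator_of_notMem ht, hF]
    simp only
    rw [hχ t fun h => ht ⟨h.1.le, h.2.le⟩, mul_zero, norm_zero]

end Transfer

section Linearized

variable {b cp cm : ℝ} {χ : ℝ → ℝ}

/-- The vertical scale attached to the box index `κ`: horizontal scale `j = m + κ.1` and dyadic
vertical frequency `k = m + κ.2`; at most one dilation index `n` has `⌊b (j - n)⌋ = k`. -/
def vertScale (b cp : ℝ) (u : ℤ → ℝ) (m : ℤ) (κ : ℕ × ℕ) : ℝ :=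
  if h : ∃ n : ℤ, ⌊b * (((m + (κ.1 : ℤ) : ℤ) : ℝ) - n)⌋ = m + (κ.2 : ℤ) then
    u h.choose * cp * ((2:ℝ) ^ (-(m + (κ.1 : ℤ)))) ^ b
  else (2:ℝ) ^ (-(m + (κ.2 : ℤ)))

theorem vertScale_eq (hb : 1 < b) (u : ℤ → ℝ) (m : ℤ) (κ : ℕ × ℕ) {n : ℤ}
    (h : ⌊b * (((m + (κ.1 : ℤ) : ℤ) : ℝ) - n)⌋ = m + (κ.2 : ℤ)) :
    vertScale b cp u m κ = u n * cp * ((2:ℝ) ^ (-(m + (κ.1 : ℤ)))) ^ b := by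
  have hex : ∃ n : ℤ, ⌊b * (((m + (κ.1 : ℤ) : ℤ) : ℝ) - n)⌋ = m + (κ.2 : ℤ) := ⟨n, h⟩
  rw [vertScale, dif_pos hex]
  have e : hex.choose = n := by
    have h' := hex.choose_spec
    set n' := hex.choose
    rw [Int.floor_eq_iff] at h h'
    by_contra hne
    rcases lt_or_gt_of_ne hne with hlt | hlt
    · have : (n' : ℝ) + 1 ≤ n := by exact_mod_cast hlt
      nlinarith [h.1, h.2, h'.1, h'.2]
    · have : (n : ℝ) + 1 ≤ n' := by exact_mod_cast hlt
      nlinarith [h.1, h.2, h'.1, h'.2]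
  rw [e]

theorem vertScale_bounds (hb : 1 < b) (hcp : cp ≠ 0) {v : ℤ → ℝ}
    (hv : ∀ n, v n ∈ Icc (1:ℝ) ((2:ℝ) ^ b)) (m : ℤ) (κ : ℕ × ℕ) :
    (2:ℝ) ^ (-(m + (κ.2 : ℤ))) ≤ (2 / |cp| + |cp| * 2 ^ b + 1) *
        |vertScale b cp (fun n => (2:ℝ) ^ (b * (n : ℝ)) * v n) m κ| ∧
      |vertScale b cp (fun n => (2:ℝ) ^ (b * (n : ℝ)) * v n) m κ| ≤
        (2 / |cp| + |cp| * 2 ^ b + 1) * (2:ℝ) ^ (-(m + (κ.2 : ℤ))) := by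
  have hc : 0 < |cp| := abs_pos.2 hcp
  have h2b : (0:ℝ) < 2 ^ b := by positivity
  have hK1 : 2 / |cp| ≤ 2 / |cp| + |cp| * 2 ^ b + 1 := by
    have : 0 < |cp| * 2 ^ b := by positivity
    linarith
  have hK2 : |cp| * 2 ^ b ≤ 2 / |cp| + |cp| * 2 ^ b + 1 := by
    have : 0 < 2 / |cp| := by positivity
    linarith
  have hK3 : 1 ≤ 2 / |cp| + |cp| * 2 ^ b + 1 := by
    have : 0 < 2 / |cp| := by positivity
    have : 0 < |cp| * 2 ^ b := by positivity
    linarith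
  set K := 2 / |cp| + |cp| * 2 ^ b + 1
  set k := m + (κ.2 : ℤ) with hk
  set j := m + (κ.1 : ℤ) with hj
  have hpk : (0:ℝ) < 2 ^ (-k) := by positivity
  by_cases hex : ∃ n : ℤ, ⌊b * ((j : ℝ) - n)⌋ = k
  · obtain ⟨n, hn⟩ := hex
    rw [vertScale_eq hb _ m κ hn]
    obtain ⟨h1, h2⟩ := Int.floor_eq_iff.1 hn
    obtain ⟨v1, v2⟩ := hv n
    set E := (2:ℝ) ^ (-(b * ((j : ℝ) - n))) with hE
    have e : |(2:ℝ) ^ (b * (n : ℝ)) * v n * cp * ((2:ℝ) ^ (-j)) ^ b| = |cp| * (v n * E) := by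
      rw [abs_mul, abs_mul, abs_mul, abs_of_nonneg (by positivity : (0:ℝ) ≤ 2 ^ (b * (n : ℝ))),
        abs_of_nonneg (by positivity : (0:ℝ) ≤ ((2:ℝ) ^ (-j)) ^ b),
        abs_of_nonneg (by linarith : 0 ≤ v n), ← Real.rpow_intCast, ← Real.rpow_mul (by norm_num),
        hE, show -(b * ((j : ℝ) - n)) = b * n + ((-j : ℤ) : ℝ) * b by push_cast; ring,
        Real.rpow_add (by norm_num)]
      ring
    rw [e]
    have E1 : E ≤ 2 ^ (-k) := by
      rw [hE, ← Real.rpow_intCast]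
      refine Real.rpow_le_rpow_of_exponent_le (by norm_num) ?_
      push_cast; linarith
    have E2 : (2:ℝ) ^ (-k) ≤ 2 * E := by
      have : (2:ℝ) * E = 2 ^ (1 + -(b * ((j : ℝ) - n))) := by
        rw [Real.rpow_add (by norm_num), Real.rpow_one]
      rw [this, ← Real.rpow_intCast]
      refine Real.rpow_le_rpow_of_exponent_le (by norm_num) ?_
      push_cast; linarith
    have E0 : 0 < E := by positivity
    constructor
    · calc (2:ℝ) ^ (-k) ≤ 2 * E := E2
        _ ≤ 2 * (v n * E) := by nlinarith
        _ = 2 / |cp| * (|cp| * (v n * E)) := by field_simp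
        _ ≤ _ := mul_le_mul_of_nonneg_right hK1 (by positivity)
    · calc |cp| * (v n * E) ≤ |cp| * (2 ^ b * 2 ^ (-k)) := by gcongr
        _ = |cp| * 2 ^ b * 2 ^ (-k) := by ring
        _ ≤ _ := mul_le_mul_of_nonneg_right hK2 hpk.le
  · rw [vertScale, dif_neg hex, abs_of_pos hpk]
    exact ⟨le_mul_of_one_le_left hpk.le hK3, le_mul_of_one_le_left hpk.le hK3⟩

theorem abs_tauConv_le_fwdMax (hb : 1 < b) {M : ℝ} (hM : ∀ t, |χ t| ≤ M)
    (hχ : ∀ t : ℝ, t ∉ Ioo (1/2 : ℝ) 2 → χ t = 0) {u : ℤ → ℝ} {m : ℤ} {N : ℕ}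
    (hN : (box N).Nonempty) {j n : ℤ} (hj : m ≤ j) (hj' : j < m + N)
    (hk : m ≤ ⌊b * ((j : ℝ) - n)⌋) (hk' : ⌊b * ((j : ℝ) - n)⌋ < m + N)
    {f φ : ℝ × ℝ → ℝ} (hφ : Nice φ) {x : ℝ × ℝ}
    (h : ∀ κ ∈ box N, ∀ t ∈ Icc (1 / 2 : ℝ) 2,
      |f (x - ((2:ℝ) ^ (-(m + (κ.1 : ℤ))) * t, vertScale b cp u m κ * t ^ b))| ≤
        φ (x - ((2:ℝ) ^ (-(m + (κ.1 : ℤ))) * t, vertScale b cp u m κ * t ^ b))) :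
    |tauConv b cp cm χ j (u n) f x| ≤
      3 / 2 * M * fwdMax b m (vertScale b cp u m) N hN φ x := by
  set k := ⌊b * ((j : ℝ) - n)⌋ with hk0
  set κ : ℕ × ℕ := ((j - m).toNat, (k - m).toNat) with hκ
  have e1 : m + (κ.1 : ℤ) = j := by simp only [hκ]; omega
  have e2 : m + (κ.2 : ℤ) = k := by simp only [hκ]; omega
  have hmem : κ ∈ box N := by
    simp only [box, Finset.mem_product, Finset.mem_range]
    omega
  have ev := vertScale_eq (cp := cp) hb u m κ (n := n) (by rw [e1, e2])
  have hM0 : 0 ≤ M := (abs_nonneg _).trans (hM 0)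
  have h' := h κ hmem
  rw [ev, e1] at h'
  refine (abs_tauConv_le (by linarith) hM hχ j (u n) hφ h').trans ?_
  refine mul_le_mul_of_nonneg_left ?_ (by positivity)
  refine le_trans (le_of_eq ?_) (Finset.le_sup' (fun κ => fwd b m (vertScale b cp u m) κ φ x) hmem)
  simp only [fwd]
  rw [ev, e1]

/-- The modulus of `f`, cut off continuously outside the ball of radius `A`. -/
def cutAbs (A : ℝ) (f : ℝ × ℝ → ℝ) (y : ℝ × ℝ) : ℝ := |f y| * max 0 (min 1 (A - ‖y‖))

theorem cutAbs_continuous (A : ℝ) {f : ℝ × ℝ → ℝ} (hf : Continuous f) :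
    Continuous (cutAbs A f) := by
  unfold cutAbs
  fun_prop

theorem cutAbs_nonneg (A : ℝ) (f : ℝ × ℝ → ℝ) (y : ℝ × ℝ) : 0 ≤ cutAbs A f y :=
  mul_nonneg (abs_nonneg _) (le_max_left _ _)

theorem cutAbs_le (A : ℝ) (f : ℝ × ℝ → ℝ) (y : ℝ × ℝ) : cutAbs A f y ≤ |f y| :=
  mul_le_of_le_one_right (abs_nonneg _) (max_le zero_le_one (min_le_left _ _))

theorem cutAbs_eq {A : ℝ} {f : ℝ × ℝ → ℝ} {y : ℝ × ℝ} (h : ‖y‖ ≤ A - 1) :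
    cutAbs A f y = |f y| := by
  rw [cutAbs, min_eq_left (by linarith), max_eq_right zero_le_one, mul_one]

theorem cutAbs_nice (A : ℝ) {f : ℝ × ℝ → ℝ} (hf : Continuous f) : Nice (cutAbs A f) := by
  have hz : ∀ y, A < ‖y‖ → cutAbs A f y = 0 := fun y hy => by
    rw [cutAbs, max_eq_left ((min_le_right _ _).trans (by linarith)), mul_zero]
  have hc := cutAbs_continuous A hf
  have hs : HasCompactSupport (cutAbs A f) :=
    HasCompactSupport.intro (isCompact_closedBall (0 : ℝ × ℝ) A) fun y hy => hz y (by
      simpa [Metric.mem_closedBall] using hy)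
  exact ⟨hc.stronglyMeasurable, hc.bounded_above_of_compact_support hs, ⟨A, hz⟩⟩

theorem lintegral_iSup_tauConv_le (hb : 1 < b) (hcp : cp ≠ 0) {M : ℝ} (hM : ∀ t, |χ t| ≤ M)
    (hχ : ∀ t : ℝ, t ∉ Ioo (1/2 : ℝ) 2 → χ t = 0) :
    ∃ C : ℝ, 0 ≤ C ∧ ∀ {v : ℤ → ℝ}, (∀ n, v n ∈ Icc (1:ℝ) ((2:ℝ) ^ b)) → ∀ {p r : ℝ},
      r.HolderConjugate p → 2 ≤ r → ∀ (R : ℕ) {f : ℝ × ℝ → ℝ}, Continuous f →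
      ∫⁻ x, ⨆ (n : Finset.Icc (-(R:ℤ)) R) (j : Finset.Icc (-(R:ℤ)) R), ENNReal.ofReal
          |tauConv b cp cm χ j ((2:ℝ) ^ (b * ((n : ℤ) : ℝ)) * v n) f x| ^ p ≤
        ENNReal.ofReal ((C * r ^ 8) ^ p) * ∫⁻ x, ‖f x‖ₑ ^ p := by
  have hM0 : 0 ≤ M := (abs_nonneg _).trans (hM 0)
  have hb0 : 0 ≤ b := by linarith
  have hK : 1 ≤ 2 / |cp| + |cp| * 2 ^ b + 1 := by
    have : 0 < |cp| := abs_pos.2 hcp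
    have : 0 < 2 / |cp| := by positivity
    have : 0 < |cp| * 2 ^ b := by positivity
    linarith
  obtain ⟨C, hC1, HC⟩ := dualBound_of_two_le hb hK
  refine ⟨3 / 2 * M * C, by positivity, fun {v} hv {p r} hrp hr R {f} hf => ?_⟩
  have hp0 : 0 < p := hrp.symm.pos
  have hr0 : 0 < r := hrp.pos
  set B := C * r ^ 8 with hB
  have hB0 : 0 ≤ B := by positivity
  set u : ℤ → ℝ := fun n => (2:ℝ) ^ (b * (n : ℝ)) * v n with hu
  obtain ⟨T, hT⟩ := exists_nat_ge (b * (2 * R) + 1)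
  have hRT : R ≤ T := by
    have : (R : ℝ) ≤ T := by nlinarith [(Nat.cast_nonneg R : (0:ℝ) ≤ R)]
    exact_mod_cast this
  set m : ℤ := -(T : ℤ) with hm
  set N : ℕ := 2 * T + 1 with hN'
  have hN : (box N).Nonempty := ⟨(0, 0), by simp [box, hN']⟩
  have hbd := fun κ => vertScale_bounds hb hcp hv m κ
  have HD : ∀ L, DualBound b m (vertScale b cp u m) N L r B := fun L =>
    HC (fun κ => (hbd κ).1) (fun κ => (hbd κ).2) hr
  set D : ℝ := ∑ κ ∈ box N, ((2:ℝ) ^ (-(m + (κ.1 : ℤ))) * 2 + |vertScale b cp u m κ| * 2 ^ b)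
    with hD
  have hdisp : ∀ κ ∈ box N, ∀ t ∈ Icc (1 / 2 : ℝ) 2,
      ‖(((2:ℝ) ^ (-(m + (κ.1 : ℤ))) * t, vertScale b cp u m κ * t ^ b) : ℝ × ℝ)‖ ≤ D := by
    intro κ hκ t ht
    have t0 : 0 ≤ t := by linarith [ht.1]
    refine le_trans ?_ (Finset.single_le_sum (f := fun κ : ℕ × ℕ =>
      (2:ℝ) ^ (-(m + (κ.1 : ℤ))) * 2 + |vertScale b cp u m κ| * 2 ^ b)
      (fun κ _ => by positivity) hκ)
    have p1 : 0 ≤ (2:ℝ) ^ (-(m + (κ.1 : ℤ))) * 2 := by positivity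
    have p2 : 0 ≤ |vertScale b cp u m κ| * (2:ℝ) ^ b := by positivity
    rw [Prod.norm_def, max_le_iff]
    simp only [Real.norm_eq_abs, abs_mul]
    rw [abs_of_nonneg t0, abs_of_nonneg (Real.rpow_nonneg t0 b),
      abs_of_nonneg (by positivity : (0:ℝ) ≤ 2 ^ (-(m + (κ.1 : ℤ))))]
    constructor
    · have : (2:ℝ) ^ (-(m + (κ.1 : ℤ))) * t ≤ (2:ℝ) ^ (-(m + (κ.1 : ℤ))) * 2 :=
        mul_le_mul_of_nonneg_left ht.2 (by positivity)
      linarith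
    · have : |vertScale b cp u m κ| * t ^ b ≤ |vertScale b cp u m κ| * 2 ^ b :=
        mul_le_mul_of_nonneg_left (Real.rpow_le_rpow t0 ht.2 hb0) (abs_nonneg _)
      linarith
  set G : ℝ × ℝ → ℝ≥0∞ := fun x => ⨆ (n : Finset.Icc (-(R:ℤ)) R) (j : Finset.Icc (-(R:ℤ)) R),
    ENNReal.ofReal |tauConv b cp cm χ j (u n) f x| ^ p with hG
  have hloc : ∀ k : ℕ, ∫⁻ x in Metric.closedBall 0 k, G x ≤
      ENNReal.ofReal ((3 / 2 * M * B) ^ p) * ∫⁻ x, ‖f x‖ₑ ^ p := by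
    intro k
    set A : ℝ := k + D + 1 with hA
    have nφ := cutAbs_nice A hf
    have φ0 := cutAbs_nonneg A f
    set S := fwdMax b m (vertScale b cp u m) N hN (cutAbs A f) with hS
    have S0 : ∀ x, 0 ≤ S x := fwdMax_nonneg hN φ0
    have nS : Nice S := fwdMax_nice hb0 hN nφ φ0
    have hGS : ∀ x ∈ Metric.closedBall (0 : ℝ × ℝ) k,
        G x ≤ ENNReal.ofReal ((3 / 2 * M) ^ p) * ENNReal.ofReal (S x ^ p) := by
      intro x hx
      rw [mem_closedBall_zero_iff] at hx
      refine iSup₂_le fun n j => ?_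
      obtain ⟨n, hn⟩ := n
      obtain ⟨j, hj⟩ := j
      rw [Finset.mem_Icc] at hn hj
      have hnr : -(R:ℝ) ≤ n ∧ (n:ℝ) ≤ R := by exact_mod_cast hn
      have hjr : -(R:ℝ) ≤ j ∧ (j:ℝ) ≤ R := by exact_mod_cast hj
      have key := abs_tauConv_le_fwdMax (cp := cp) (cm := cm) hb hM hχ (u := u) (m := m) hN
        (j := j) (n := n) (by omega) (by omega)
        (by
          rw [Int.le_floor, hm]
          push_cast
          nlinarith)
        (by
          rw [Int.floor_lt, hm, hN']
          push_cast
          nlinarith) nφ (f := f) (x := x) (fun κ hκ t ht => by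
            rw [cutAbs_eq]
            have := norm_sub_le x
              (((2:ℝ) ^ (-(m + (κ.1 : ℤ))) * t, vertScale b cp u m κ * t ^ b) : ℝ × ℝ)
            linarith [hdisp κ hκ t ht])
      rw [← ENNReal.ofReal_mul (by positivity), ← Real.mul_rpow (by positivity) (S0 x),
        ENNReal.ofReal_rpow_of_nonneg (abs_nonneg _) hp0.le]
      exact ENNReal.ofReal_le_ofReal (Real.rpow_le_rpow (abs_nonneg _) key hp0.le)
    have eS : ∫⁻ x, ENNReal.ofReal (S x ^ p) = ENNReal.ofReal (∫ x, S x ^ p) :=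
      (ofReal_integral_eq_lintegral_ofReal (nS.rpow S0 hp0).integrable
        (Eventually.of_forall fun x => Real.rpow_nonneg (S0 x) _)).symm
    have eφ : ENNReal.ofReal (∫ x, cutAbs A f x ^ p) = ∫⁻ x, ENNReal.ofReal (cutAbs A f x ^ p) :=
      ofReal_integral_eq_lintegral_ofReal (nφ.rpow φ0 hp0).integrable
        (Eventually.of_forall fun x => Real.rpow_nonneg (φ0 x) _)
    calc ∫⁻ x in Metric.closedBall 0 k, G x
        ≤ ∫⁻ x in Metric.closedBall 0 k,
            ENNReal.ofReal ((3 / 2 * M) ^ p) * ENNReal.ofReal (S x ^ p) :=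
          setLIntegral_mono' measurableSet_closedBall hGS
      _ ≤ ∫⁻ x, ENNReal.ofReal ((3 / 2 * M) ^ p) * ENNReal.ofReal (S x ^ p) :=
          setLIntegral_le_lintegral _ _
      _ = ENNReal.ofReal ((3 / 2 * M) ^ p) * ENNReal.ofReal (∫ x, S x ^ p) := by
          rw [lintegral_const_mul' _ _ ENNReal.ofReal_ne_top, eS]
      _ ≤ ENNReal.ofReal ((3 / 2 * M) ^ p) *
            ENNReal.ofReal (B ^ p * ∫ x, cutAbs A f x ^ p) := by
          gcongr
          exact integral_fwdMax_le hb0 hN hrp hB0 HD nφ φ0 (cutAbs_continuous A hf)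
      _ = ENNReal.ofReal ((3 / 2 * M * B) ^ p) * ∫⁻ x, ENNReal.ofReal (cutAbs A f x ^ p) := by
          rw [ENNReal.ofReal_mul (by positivity), ← mul_assoc, ← ENNReal.ofReal_mul (by positivity),
            ← Real.mul_rpow (by positivity) hB0, eφ]
      _ ≤ _ := by
          gcongr with x
          rw [← ENNReal.ofReal_rpow_of_nonneg (φ0 x) hp0.le, Real.enorm_eq_ofReal_abs]
          gcongr
          exact cutAbs_le A f x
  have hun : (⋃ k : ℕ, Metric.closedBall (0 : ℝ × ℝ) k) = univ := Metric.iUnion_closedBall_nat 0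
  have hdir : Directed (· ⊆ ·) fun k : ℕ => Metric.closedBall (0 : ℝ × ℝ) k :=
    (monotone_nat_of_le_succ fun k => Metric.closedBall_subset_closedBall (by
      push_cast; linarith)).directed_le
  have e : 3 / 2 * M * C * r ^ 8 = 3 / 2 * M * B := by rw [hB]; ring
  rw [e, ← setLIntegral_univ, ← hun, setLIntegral_iUnion_of_directed _ hdir]
  exact iSup_le hloc

end Linearized

theorem rpow_le_of_dual_exponent {p r : ℝ} (hp : 1 < p) (hp2 : p ≤ 2) (h : r = p / (p - 1)) :
    r ^ 8 ≤ 2 ^ 8 * Real.exp 10 * (p - 1) ^ (2 - 10 / p) := by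
  set q := p - 1 with hq
  have q0 : 0 < q := by linarith
  have r0 : 0 ≤ r := by rw [h]; positivity
  have hr : r ≤ 2 / q := by rw [h]; gcongr
  have e : q ^ (2 - 10 / p) = q ^ (-8 : ℝ) * q ^ (10 / p * q) := by
    rw [← Real.rpow_add q0]
    congr 1
    have : p = q + 1 := by rw [hq]; ring
    rw [this]
    field_simp
    ring
  have hlog : -1 ≤ q * Real.log q := by
    have := mul_le_mul_of_nonneg_left (Real.one_sub_inv_le_log_of_pos q0) q0.le
    rw [mul_sub, mul_inv_cancel₀ q0.ne'] at this
    linarith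
  have hexp : Real.exp (-10) ≤ q ^ (10 / p * q) := by
    rw [Real.rpow_def_of_pos q0, Real.exp_le_exp]
    have h1 : 0 ≤ 10 / p := by positivity
    have h2 : 10 / p ≤ 10 := div_le_self (by norm_num) hp.le
    nlinarith
  have e8 : q ^ (-8 : ℝ) = (q ^ 8)⁻¹ := by
    rw [Real.rpow_neg q0.le]
    norm_cast
  calc r ^ 8 ≤ (2 / q) ^ 8 := pow_le_pow_left₀ r0 hr 8
    _ = 2 ^ 8 * (Real.exp 10 * Real.exp (-10)) * q ^ (-8 : ℝ) := by
        rw [← Real.exp_add, e8]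
        norm_num
        ring_nf
    _ ≤ 2 ^ 8 * (Real.exp 10 * q ^ (10 / p * q)) * q ^ (-8 : ℝ) := by gcongr
    _ = _ := by rw [e]; ring

theorem tsum_le_one_of_wNorm_le_one {w : ℕ → ℂ} {p : ℝ} (hp : 0 < p) (h : wNorm w p ≤ 1) :
    ∑' i, ENNReal.ofReal (‖w i‖ ^ p) ≤ 1 := by
  rw [wNorm, one_div, ENNReal.rpow_inv_le_iff hp] at h
  simpa using h

theorem statement14 (b cp cm : ℝ) (hb : 1 < b) (hcp : cp ≠ 0) (hcm : cm ≠ 0)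
    (χp : ℝ → ℝ) (hχsm : ContDiff ℝ (⊤ : ℕ∞) χp)
    (hχsupp : ∀ t : ℝ, t ∉ Ioo (1/2 : ℝ) 2 → χp t = 0)
    (hχsum : ∀ t : ℝ, 0 < t → HasSum (fun j : ℤ => χp ((2:ℝ) ^ j * t)) 1) :
    ∃ C : ℝ, ∀ s : ℤ → ℕ → ℝ, (∀ n i, s n i ∈ Icc (1:ℝ) ((2:ℝ) ^ b)) →
      ∀ p : ℝ, 1 < p → p ≤ 2 → ∀ R : ℕ,
        BpR b cp cm χp s p R ≤ ENNReal.ofReal (C * (p - 1) ^ (2 - 10 / p)) := by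
  have hcs : HasCompactSupport χp :=
    HasCompactSupport.intro (isCompact_Icc (a := (1 / 2 : ℝ)) (b := 2)) fun t ht =>
      hχsupp t fun h => ht ⟨h.1.le, h.2.le⟩
  obtain ⟨M, hM⟩ := hχsm.continuous.bounded_above_of_compact_support hcs
  obtain ⟨C, hC0, HC⟩ := lintegral_iSup_tauConv_le (b := b) (cm := cm) hb hcp hM hχsupp
  refine ⟨C * (2 ^ 8 * Real.exp 10), fun s hs p hp hp2 R => ?_⟩
  have hp0 : 0 < p := by linarith
  have hrp : (p.conjExponent).HolderConjugate p := (Real.HolderConjugate.conjExponent hp).symm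
  have hr2 : 2 ≤ p.conjExponent := by
    rw [Real.conjExponent, le_div_iff₀ (by linarith)]
    linarith
  set r := p.conjExponent with hr
  have hr0 : 0 < r := by linarith
  refine iSup₂_le fun f w => iSup₂_le fun hf hw => ?_
  have hfI : ∫⁻ x, ‖f x‖ₑ ^ p ≤ 1 := by
    rw [eLpNorm_eq_lintegral_rpow_enorm_toReal (by simpa [eN] using hp0)
      (by simp [eN]), eN, ENNReal.toReal_ofReal hp0.le, one_div,
      ENNReal.rpow_inv_le_iff hp0] at hf
    simpa using hf
  set J := Finset.Icc (-(R:ℤ)) R with hJ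
  set Φ : J → ℕ → ℝ × ℝ → ℝ≥0∞ := fun n i x => ⨆ j : J,
    ENNReal.ofReal |tauConv b cp cm χp j ((2:ℝ) ^ (b * ((n : ℤ) : ℝ)) * s n i) f x| ^ p with hΦ
  have hΦm : ∀ n i, Measurable (Φ n i) := fun n i => Measurable.iSup fun j =>
    ((measurable_tauConv hχsm.continuous.measurable f.continuous.measurable
      _ _).norm.ennreal_ofReal).pow_const p
  have hωb : ∀ ω : J → ℕ, ∫⁻ x, ⨆ n, Φ n (ω n) x ≤ ENNReal.ofReal ((C * r ^ 8) ^ p) := by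
    intro ω
    have := HC (v := fun n => s n (if h : n ∈ J then ω ⟨n, h⟩ else 0)) (fun n => hs n _) hrp hr2 R
      f.continuous
    refine le_trans (le_of_eq ?_) (this.trans (mul_le_of_le_one_right' hfI))
    congr 1
    funext x
    refine iSup_congr fun n => ?_
    simp only [hΦ]
    rw [dif_pos n.2]
  have hmain := lintegral_iSup_mul_le
    (fun n : J => tsum_le_one_of_wNorm_le_one hp0 (hw n)) hΦm hωb
  have hpt : ∀ x, MfrakR b cp cm χp s R f w x ^ p ≤
      ⨆ n : J, ⨆ i, ENNReal.ofReal (‖w n i‖ ^ p) * Φ n i x := by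
    intro x
    rw [← ENNReal.le_rpow_inv_iff hp0]
    refine iSup₂_le fun j hj => iSup₂_le fun n hn => iSup_le fun i => ?_
    rw [ENNReal.le_rpow_inv_iff hp0]
    refine le_trans ?_ (le_iSup₂_of_le (⟨n, Finset.mem_Icc.2 hn⟩ : J) i le_rfl)
    rw [ENNReal.ofReal_mul (norm_nonneg _), ENNReal.mul_rpow_of_nonneg _ _ hp0.le,
      ENNReal.ofReal_rpow_of_nonneg (norm_nonneg _) hp0.le]
    refine mul_le_mul_right ?_ _
    exact le_iSup_of_le (⟨j, Finset.mem_Icc.2 hj⟩ : J) le_rfl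
  have hCr : C * r ^ 8 ≤ C * (2 ^ 8 * Real.exp 10) * (p - 1) ^ (2 - 10 / p) := by
    rw [mul_assoc]
    exact mul_le_mul_of_nonneg_left (rpow_le_of_dual_exponent hp hp2 rfl) hC0
  rw [lpN]
  calc (∫⁻ x, MfrakR b cp cm χp s R f w x ^ p) ^ (1 / p)
      ≤ ENNReal.ofReal ((C * r ^ 8) ^ p) ^ (1 / p) :=
        ENNReal.rpow_le_rpow ((lintegral_mono hpt).trans hmain) (by positivity)
    _ = ENNReal.ofReal (C * r ^ 8) := by
        rw [ENNReal.ofReal_rpow_of_nonneg (by positivity) (by positivity),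
          ← Real.rpow_mul (by positivity), mul_one_div_cancel hp0.ne', Real.rpow_one]
    _ ≤ _ := ENNReal.ofReal_le_ofReal hCr

end
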